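/- Let E ⊆ ℝ be a nonempty closed set. Suppose there exists a function u : ℂ → ℝ which is continuous on ℂ, equal to 0 on E, positive and harmonic on ℂ∖E, symmetric (u(conj z) = u(z) for all z), satisfies u(z) ≤ A(1+|z|) for some constant A, and satisfies limsup_{y→+∞} u(iy)/y > 0. Then every entire function f of the Cartwright class is of bounded type in ℂ∖E. -/

import Mathlib

open Complex Filter MeasureTheory

noncomputable def logPlus (t : ℝ) : ℝ := max (Real.log t) 0

/-- `h` is harmonic on `U`: real-valued, `C²` on `U`, with vanishing Laplacian. -/
def HarmonicOn (h : ℂ → ℝ) (U : Set ℂ) : Prop :=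
  ContDiffOn ℝ 2 h U ∧ ∀ z ∈ U,
    iteratedFDerivWithin ℝ 2 h U z ![1, 1] +
      iteratedFDerivWithin ℝ 2 h U z ![Complex.I, Complex.I] = 0

/-- The subset of `ℂ` corresponding to a subset of `ℝ`. -/
def cplx (E : Set ℝ) : Set ℂ := (fun x : ℝ => (x : ℂ)) '' E

/-- `g` is of bounded type in `U`: `log⁺|g|` admits a positive harmonic majorant on `U`. -/
def BoundedTypeOn (g : ℂ → ℂ) (U : Set ℂ) : Prop :=
  ∃ h : ℂ → ℝ, HarmonicOn h U ∧ (∀ z ∈ U, 0 < h z) ∧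
    ∀ z ∈ U, logPlus ‖g z‖ ≤ h z

open Topology Metric Real Set
open scoped ComplexConjugate

def SubM (w : ℂ → ℝ) (z : ℂ) : Prop := ∀ᶠ r in 𝓝[>] (0:ℝ), w z ≤ circleAverage w z r
def SupM (w : ℂ → ℝ) (z : ℂ) : Prop := ∀ᶠ r in 𝓝[>] (0:ℝ), circleAverage w z r ≤ w z

lemma SupM_neg {w : ℂ → ℝ} {z : ℂ} (h : SubM w z) : SupM (fun z => - w z) z := by
  filter_upwards [h] with r hr
  have : circleAverage (fun z => - w z) z r = - circleAverage w z r := by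
    simp [circleAverage_def]
  simp only [this]; linarith

lemma SubM_neg {w : ℂ → ℝ} {z : ℂ} (h : SupM w z) : SubM (fun z => - w z) z := by
  filter_upwards [h] with r hr
  have : circleAverage (fun z => - w z) z r = - circleAverage w z r := by
    simp [circleAverage_def]
  simp only [this]; linarith

lemma ball_ev {U : Set ℂ} (hU : IsOpen U) {z : ℂ} (hz : z ∈ U) :
    ∀ᶠ r in 𝓝[>] (0:ℝ), 0 < r ∧ closedBall z r ⊆ U := by
  obtain ⟨e, he, hb⟩ := Metric.isOpen_iff.1 hU z hz
  filter_upwards [Ioo_mem_nhdsGT he] with r hr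
  exact ⟨hr.1, (closedBall_subset_ball hr.2).trans hb⟩

lemma ci_of_cont {w : ℂ → ℝ} {z : ℂ} {r : ℝ} (hr : 0 ≤ r) (hw : ContinuousOn w (sphere z r)) :
    CircleIntegrable w z r := hw.circleIntegrable hr

lemma ci_of_contBall {U : Set ℂ} {w : ℂ → ℝ} {z : ℂ} {r : ℝ} (hr : 0 ≤ r) (hw : ContinuousOn w U)
    (h : closedBall z r ⊆ U) : CircleIntegrable w z r :=
  ci_of_cont hr (hw.mono (sphere_subset_closedBall.trans h))

lemma SubM_add {U : Set ℂ} (hU : IsOpen U) {w v : ℂ → ℝ} (hw : ContinuousOn w U)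
    (hv : ContinuousOn v U) {z : ℂ} (hz : z ∈ U) (h1 : SubM w z) (h2 : SubM v z) :
    SubM (fun z => w z + v z) z := by
  filter_upwards [h1, h2, ball_ev hU hz] with r a b c
  rw [circleAverage_fun_add (ci_of_contBall c.1.le hw c.2) (ci_of_contBall c.1.le hv c.2)]
  linarith

lemma SupM_add {U : Set ℂ} (hU : IsOpen U) {w v : ℂ → ℝ} (hw : ContinuousOn w U)
    (hv : ContinuousOn v U) {z : ℂ} (hz : z ∈ U) (h1 : SupM w z) (h2 : SupM v z) :
    SupM (fun z => w z + v z) z := by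
  filter_upwards [h1, h2, ball_ev hU hz] with r a b c
  rw [circleAverage_fun_add (ci_of_contBall c.1.le hw c.2) (ci_of_contBall c.1.le hv c.2)]
  linarith

lemma SupM_congr {w v : ℂ → ℝ} {z : ℂ} (h : w =ᶠ[𝓝 z] v) (hw : SupM w z) : SupM v z := by
  obtain ⟨e, he, hb⟩ := Metric.eventually_nhds_iff_ball.1 h
  filter_upwards [hw, Ioo_mem_nhdsGT he] with r h1 hr
  have : circleAverage v z r = circleAverage w z r := by
    apply circleAverage_congr_sphere
    intro x hx
    rw [abs_of_pos hr.1] at hx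
    exact (hb x (sphere_subset_ball hr.2 hx)).symm
  rw [this, ← hb z (mem_ball_self he)]; exact h1

lemma SubM_congr {w v : ℂ → ℝ} {z : ℂ} (h : w =ᶠ[𝓝 z] v) (hw : SubM w z) : SubM v z := by
  obtain ⟨e, he, hb⟩ := Metric.eventually_nhds_iff_ball.1 h
  filter_upwards [hw, Ioo_mem_nhdsGT he] with r h1 hr
  have : circleAverage v z r = circleAverage w z r := by
    apply circleAverage_congr_sphere
    intro x hx
    rw [abs_of_pos hr.1] at hx
    exact (hb x (sphere_subset_ball hr.2 hx)).symm
  rw [this, ← hb z (mem_ball_self he)]; exact h1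

/-- touching from below: sub-mean property transfers -/
lemma SubM_of_le {U : Set ℂ} (hU : IsOpen U) {w v : ℂ → ℝ} (hw : ContinuousOn w U)
    (hv : ContinuousOn v U) {z : ℂ} (hz : z ∈ U) (h1 : SubM v z) (hle : ∀ x ∈ U, v x ≤ w x)
    (he : w z = v z) : SubM w z := by
  filter_upwards [h1, ball_ev hU hz] with r a c
  rw [he]
  refine a.trans (circleAverage_mono (ci_of_contBall c.1.le hv c.2) (ci_of_contBall c.1.le hw c.2) ?_)
  intro x hx
  rw [abs_of_pos c.1] at hx
  exact hle x (c.2 (sphere_subset_closedBall hx))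

lemma SupM_of_ge {U : Set ℂ} (hU : IsOpen U) {w v : ℂ → ℝ} (hw : ContinuousOn w U)
    (hv : ContinuousOn v U) {z : ℂ} (hz : z ∈ U) (h1 : SupM v z) (hle : ∀ x ∈ U, w x ≤ v x)
    (he : w z = v z) : SupM w z := by
  filter_upwards [h1, ball_ev hU hz] with r a c
  rw [he]
  refine (circleAverage_mono (ci_of_contBall c.1.le hw c.2) (ci_of_contBall c.1.le hv c.2) ?_).trans a
  intro x hx
  rw [abs_of_pos c.1] at hx
  exact hle x (c.2 (sphere_subset_closedBall hx))

lemma avg_re {U : Set ℂ} {F : ℂ → ℂ} (hF : DifferentiableOn ℂ F U) {z : ℂ} {r : ℝ}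
    (hr : 0 < r) (h : closedBall z r ⊆ U) : circleAverage F z r = F z := by
  have hd : DiffContOnCl ℂ F (ball z |r|) := by
    rw [abs_of_pos hr]
    apply DifferentiableOn.diffContOnCl
    rw [closure_ball z hr.ne']
    exact hF.mono h
  exact hd.circleAverage

lemma avg_re' {U : Set ℂ} {F : ℂ → ℂ} (hF : DifferentiableOn ℂ F U) {z : ℂ} {r : ℝ}
    (hr : 0 < r) (h : closedBall z r ⊆ U) : circleAverage (fun z => (F z).re) z r = (F z).re := by
  have h1 := avg_re hF hr h
  have := ContinuousLinearMap.circleAverage_comp_comm (c := z) (R := r) (f := F) reCLM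
    ((hF.continuousOn.mono (sphere_subset_closedBall.trans h)).circleIntegrable hr.le)
  rw [h1] at this
  exact this

lemma avg_im' {U : Set ℂ} {F : ℂ → ℂ} (hF : DifferentiableOn ℂ F U) {z : ℂ} {r : ℝ}
    (hr : 0 < r) (h : closedBall z r ⊆ U) : circleAverage (fun z => (F z).im) z r = (F z).im := by
  have h1 := avg_re hF hr h
  have := ContinuousLinearMap.circleAverage_comp_comm (c := z) (R := r) (f := F) imCLM
    ((hF.continuousOn.mono (sphere_subset_closedBall.trans h)).circleIntegrable hr.le)
  rw [h1] at this
  exact this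

lemma SubM_im {U : Set ℂ} (hU : IsOpen U) {F : ℂ → ℂ} (hF : DifferentiableOn ℂ F U) {z : ℂ}
    (hz : z ∈ U) : SubM (fun z => (F z).im) z := by
  filter_upwards [ball_ev hU hz] with r c
  exact (avg_im' hF c.1 c.2).ge

lemma SupM_im {U : Set ℂ} (hU : IsOpen U) {F : ℂ → ℂ} (hF : DifferentiableOn ℂ F U) {z : ℂ}
    (hz : z ∈ U) : SupM (fun z => (F z).im) z := by
  filter_upwards [ball_ev hU hz] with r c
  exact (avg_im' hF c.1 c.2).le

lemma SupM_re {U : Set ℂ} (hU : IsOpen U) {F : ℂ → ℂ} (hF : DifferentiableOn ℂ F U) {z : ℂ}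
    (hz : z ∈ U) : SupM (fun z => (F z).re) z := by
  filter_upwards [ball_ev hU hz] with r c
  exact (avg_re' hF c.1 c.2).le

lemma avg_lt {w : ℂ → ℝ} {z : ℂ} {r M : ℝ} (hr : 0 < r) (hw : ContinuousOn w (sphere z r))
    (h1 : ∀ x ∈ sphere z r, w x ≤ M) (h2 : w (z + r) < M) : circleAverage w z r < M := by
  have key : ∫ θ in (0:ℝ)..2*π, w (circleMap z r θ) < ∫ θ in (0:ℝ)..2*π, M := by
    apply intervalIntegral.integral_lt_integral_of_continuousOn_of_le_of_exists_lt (by positivity)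
    · exact hw.comp (continuous_circleMap z r).continuousOn
        (fun θ _ => circleMap_mem_sphere z hr.le θ)
    · exact continuousOn_const
    · intro θ _; exact h1 _ (circleMap_mem_sphere z hr.le θ)
    · exact ⟨0, ⟨le_rfl, by positivity⟩, by simpa [circleMap] using h2⟩
  rw [circleAverage_def]
  simp only [intervalIntegral.integral_const, smul_eq_mul, sub_zero] at key ⊢
  rw [inv_mul_lt_iff₀ (by positivity)]
  linarith

theorem max_principle {U : Set ℂ} (hU : IsOpen U) (hb : Bornology.IsBounded U) {w : ℂ → ℝ}
    (hw : ContinuousOn w U) (hs : ∀ z ∈ U, SubM w z)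
    (hbd : ∀ ζ ∈ frontier U, ∀ ε > 0, ∀ᶠ z in 𝓝[U] ζ, w z ≤ ε) : ∀ z ∈ U, w z ≤ 0 := by
  intro z1 hz1
  by_contra hm
  push Not at hm
  set m := w z1 with hmdef
  set K : Set ℂ := {z | z ∈ U ∧ m ≤ w z} with hK
  have hKcl : IsClosed K := by
    apply isClosed_of_closure_subset
    intro ζ hζ
    have hfr : ∃ᶠ z in 𝓝 ζ, z ∈ K := mem_closure_iff_frequently.1 hζ
    by_cases hU' : ζ ∈ U
    · refine ⟨hU', ?_⟩
      by_contra hlt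
      push Not at hlt
      have hc : ContinuousAt w ζ := hw.continuousAt (hU.mem_nhds hU')
      exact hfr ((hc.eventually (gt_mem_nhds hlt)).mono (fun z hz hzK => absurd hzK.2 (not_le.2 hz)))
    · have hζf : ζ ∈ frontier U := by
        rw [hU.frontier_eq]
        exact ⟨closure_mono (fun z hz => hz.1) hζ, hU'⟩
      have := hbd ζ hζf (m/2) (by linarith)
      rw [eventually_nhdsWithin_iff] at this
      exact absurd (this.mono (fun z hz hzK => by
        have := hz hzK.1; have := hzK.2; linarith)) hfr
  have hKc : IsCompact K := Metric.isCompact_of_isClosed_isBounded hKcl (hb.subset (fun z hz => hz.1))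
  obtain ⟨z2, hz2, hmax⟩ := hKc.exists_isMaxOn ⟨z1, hz1, le_rfl⟩ (hw.mono (fun z hz => hz.1))
  set M := w z2
  have hle : ∀ z ∈ U, w z ≤ M := by
    intro z hz
    by_cases h : m ≤ w z
    · exact hmax (show z ∈ K from ⟨hz, h⟩)
    · exact (not_le.1 h).le.trans hz2.2
  set K2 : Set ℂ := {z | z ∈ K ∧ M ≤ w z}
  have hK2 : IsCompact K2 := by
    have : K2 = K ∩ w ⁻¹' (Ici M) := rfl
    rw [this]
    exact hKc.of_isClosed_subset
      ((hw.mono (fun z hz => hz.1)).preimage_isClosed_of_isClosed hKcl isClosed_Ici) inter_subset_left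
  obtain ⟨z3, hz3, hmax3⟩ := hK2.exists_isMaxOn ⟨z2, hz2, le_rfl⟩ (continuous_re.continuousOn)
  obtain ⟨r, h1, h2, h3⟩ := ((hs z3 hz3.1.1).and (ball_ev hU hz3.1.1)).exists
  have hlt : w (z3 + r) < M := by
    by_contra hge
    push Not at hge
    have hin : z3 + r ∈ U := h3 (by simp [abs_of_pos h2])
    have : z3 + r ∈ K2 := ⟨⟨hin, hz2.2.trans hge⟩, hge⟩
    have := hmax3 this
    simp at this
    linarith
  have := avg_lt h2 (hw.mono (sphere_subset_closedBall.trans h3))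
    (fun x hx => hle x (h3 (sphere_subset_closedBall hx))) hlt
  have := hz3.2
  linarith

theorem min_principle {U : Set ℂ} (hU : IsOpen U) (hb : Bornology.IsBounded U) {w : ℂ → ℝ}
    (hw : ContinuousOn w U) (hs : ∀ z ∈ U, SupM w z)
    (hbd : ∀ ζ ∈ frontier U, ∀ ε > 0, ∀ᶠ z in 𝓝[U] ζ, -ε ≤ w z) : ∀ z ∈ U, 0 ≤ w z := by
  intro z hz
  have := max_principle hU hb hw.neg (fun z hz => SubM_neg (hs z hz)) (by
    intro ζ hζ ε hε
    filter_upwards [hbd ζ hζ ε hε] with x hx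
    simp only [Pi.neg_apply]
    linarith) z hz
  simpa using this

/-- version for functions continuous up to the boundary -/
theorem min_principle' {U : Set ℂ} (hU : IsOpen U) (hb : Bornology.IsBounded U) {w : ℂ → ℝ}
    (hw : ContinuousOn w (closure U)) (hs : ∀ z ∈ U, SupM w z)
    (hbd : ∀ ζ ∈ frontier U, 0 ≤ w ζ) : ∀ z ∈ U, 0 ≤ w z := by
  apply min_principle hU hb (hw.mono subset_closure) hs
  intro ζ hζ ε hε
  have h1 := hw ζ (frontier_subset_closure hζ)
  have h2 : ∀ᶠ z in 𝓝[closure U] ζ, -ε < w z := h1.eventually (lt_mem_nhds (by linarith [hbd ζ hζ]))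
  exact (h2.filter_mono (nhdsWithin_mono _ subset_closure)).mono (fun _ h => h.le)

lemma PLgen {S : Set ℂ} (hS : IsOpen S) {a b : ℂ → ℝ} (ha : ContinuousOn a (closure S))
    (hb : ContinuousOn b (closure S)) (sa : ∀ z ∈ S, SupM a z) (sb : ∀ z ∈ S, ∀ η : ℝ, 0 < η → SupM (fun z => η * b z) z)
    (h0 : ∀ z ∈ frontier S, 0 ≤ a z) (hb0 : ∀ z ∈ closure S, 0 ≤ b z)
    (hinf : ∀ η > 0, ∃ R0 : ℝ, ∀ z ∈ closure S, R0 ≤ ‖z‖ → 0 ≤ a z + η * b z) :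
    ∀ z ∈ S, 0 ≤ a z := by
  intro z hz
  have key : ∀ η > 0, 0 ≤ a z + η * b z := by
    intro η hη
    obtain ⟨R0, hR0⟩ := hinf η hη
    set R := max R0 (‖z‖ + 1)
    have hzR : z ∈ S ∩ ball 0 R := ⟨hz, by simp [R]⟩
    refine min_principle' (U := S ∩ ball 0 R) (w := fun z => a z + η * b z)
      (hS.inter isOpen_ball) (isBounded_ball.subset inter_subset_right) ?_ ?_ ?_ z hzR
    · have hc : closure (S ∩ ball 0 R) ⊆ closure S := closure_mono inter_subset_left
      exact (ha.mono hc).add (continuousOn_const.mul (hb.mono hc))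
    · intro x hx
      exact SupM_add hS (ha.mono subset_closure) (continuousOn_const.mul (hb.mono subset_closure)) hx.1
        (sa x hx.1) (sb x hx.1 η hη)
    · intro ζ hζ
      have hζc : ζ ∈ closure S := closure_mono inter_subset_left (frontier_subset_closure hζ)
      rcases frontier_inter_subset _ _ hζ with h | h
      · have := h0 ζ h.1
        have := hb0 ζ hζc
        positivity
      · have : ζ ∈ sphere (0:ℂ) R := frontier_ball_subset_sphere h.2
        apply hR0 ζ hζc
        rw [mem_sphere_zero_iff_norm] at this
        rw [this]; exact le_max_left _ _
  by_contra hneg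
  push Not at hneg
  have hbz := hb0 z (subset_closure hz)
  have := key (-a z / (2 * (b z + 1))) (by apply div_pos <;> linarith)
  have h2 : -a z / (2 * (b z + 1)) * b z ≤ -a z / 2 := by
    rw [div_mul_eq_mul_div, div_le_div_iff₀ (by linarith) (by norm_num)]
    nlinarith
  linarith

/-- the quadrant barrier is nonnegative and superlinear -/
lemma barrier_lb {ζ : ℂ} (hre : 0 ≤ ζ.re) (him : 0 ≤ ζ.im) (h1 : 1 ≤ ‖ζ‖) :
    ‖ζ‖ * (Real.log ‖ζ‖ - 4) ≤ (ζ * Complex.log ζ).re + (ζ * Complex.log ζ).im := by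
  simp only [mul_re, mul_im, log_re, log_im]
  have hl := Real.log_nonneg h1
  have e1 : ‖ζ‖ ≤ ζ.re + ζ.im := by
    have := Complex.norm_le_abs_re_add_abs_im ζ
    rwa [abs_of_nonneg hre, abs_of_nonneg him] at this
  have hr : ζ.re ≤ ‖ζ‖ := (le_abs_self _).trans (abs_re_le_norm ζ)
  have hi : ζ.im ≤ ‖ζ‖ := (le_abs_self _).trans (abs_im_le_norm ζ)
  have ha0 : 0 ≤ ζ.arg := by rwa [arg_nonneg_iff]
  have ha1 : ζ.arg ≤ 4 := (arg_le_pi ζ).trans pi_le_four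
  nlinarith [mul_le_mul_of_nonneg_right e1 hl, mul_nonneg hre ha0, mul_nonneg him (sub_nonneg.2 ha1), norm_nonneg ζ]

lemma closure_quad (s : ℝ) : closure {z : ℂ | 0 < s * z.re ∧ 0 < z.im} ⊆ {z : ℂ | 0 ≤ s * z.re ∧ 0 ≤ z.im} := by
  apply closure_minimal
  · intro z hz; exact ⟨hz.1.le, hz.2.le⟩
  · have h1 : IsClosed {z : ℂ | 0 ≤ s * z.re} := isClosed_le continuous_const (by fun_prop)
    have h2 : IsClosed {z : ℂ | 0 ≤ z.im} := isClosed_le continuous_const (by fun_prop)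
    exact h1.inter h2

lemma open_quad (s : ℝ) : IsOpen {z : ℂ | 0 < s * z.re ∧ 0 < z.im} := by
  have h1 : IsOpen {z : ℂ | 0 < s * z.re} := isOpen_lt continuous_const (by fun_prop)
  have h2 : IsOpen {z : ℂ | 0 < z.im} := isOpen_lt continuous_const (by fun_prop)
  exact h1.inter h2

lemma closure_hp : closure {z : ℂ | 0 < z.im} ⊆ {z : ℂ | 0 ≤ z.im} := by
  apply closure_minimal
  · intro z (hz : 0 < z.im); exact hz.le
  · exact (isClosed_le continuous_const (by fun_prop))

lemma open_hp : IsOpen {z : ℂ | 0 < z.im} := isOpen_lt continuous_const (by fun_prop)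

lemma SupM_const_mul {w : ℂ → ℝ} {z : ℂ} {c : ℝ} (hc : 0 ≤ c) (h : SupM w z) :
    SupM (fun z => c * w z) z := by
  filter_upwards [h] with r hr
  have : circleAverage (fun z => c * w z) z r = c * circleAverage w z r := by
    simp only [circleAverage_def, intervalIntegral.integral_const_mul, smul_eq_mul]; ring
  rw [this]; exact mul_le_mul_of_nonneg_left hr hc

lemma SupM_add_const {U : Set ℂ} (hU : IsOpen U) {w : ℂ → ℝ} (hw : ContinuousOn w U) {z : ℂ} (hz : z ∈ U)
    (c : ℝ) (h : SupM w z) : SupM (fun z => w z + c) z := by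
  refine SupM_add (v := fun _ => c) hU hw continuousOn_const hz h ?_
  exact Eventually.of_forall (fun r => by rw [circleAverage_const])

lemma PLquad {a : ℂ → ℝ} (ha : ContinuousOn a {z : ℂ | 0 ≤ z.im})
    (sa : ∀ z : ℂ, 0 < z.im → SupM a z) (h0 : ∀ x : ℝ, 0 ≤ a x) {C B : ℝ} (hC0 : 0 ≤ C) (hB0 : 0 ≤ B)
    (hC : ∀ z : ℂ, 0 ≤ z.im → - C * (1 + ‖z‖) ≤ a z) (hB : ∀ y : ℝ, 0 ≤ y → -B ≤ a (y * I))
    {s : ℝ} (hs : s = 1 ∨ s = -1) :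
    ∀ z ∈ {z : ℂ | 0 < s * z.re ∧ 0 < z.im}, 0 ≤ a z + B := by
  set S : Set ℂ := {z : ℂ | 0 < s * z.re ∧ 0 < z.im} with hS
  have hss : s * s = 1 := by rcases hs with h | h <;> simp [h]
  set N : ℝ := Real.exp 4
  have hNpos : 0 < N := Real.exp_pos 4
  set L : ℂ → ℂ := fun z => (1 - s * I) * (((s:ℂ) * z + N) * Complex.log ((s:ℂ) * z + N)) with hL
  have hLd : DifferentiableOn ℂ L {z | -N < s * z.re} := by
    intro z hz
    have : (s:ℂ) * z + N ∈ slitPlane := by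
      left; simp at hz ⊢; linarith
    exact DifferentiableAt.differentiableWithinAt (by fun_prop (disch := assumption))
  have hLo : IsOpen {z : ℂ | -N < s * z.re} := isOpen_lt continuous_const (by fun_prop)
  have hcl := closure_quad s
  have hsub : closure S ⊆ {z | -N < s * z.re} := fun z hz => by
    have := (hcl hz).1; simp; linarith
  have hlb : ∀ z ∈ closure S, ‖z‖ ≤ ‖(s:ℂ) * z + N‖ ∧ N ≤ ‖(s:ℂ) * z + N‖ ∧ 
      ‖(s:ℂ) * z + N‖ * (Real.log ‖(s:ℂ) * z + N‖ - 4) ≤ (L z).re := by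
    intro z hz
    obtain ⟨h1, h2⟩ := hcl hz
    have hn1 : ‖z‖ ^ 2 + N ^ 2 ≤ ‖(s:ℂ) * z + N‖ ^ 2 := by
      rw [← normSq_eq_norm_sq, ← normSq_eq_norm_sq, normSq_apply, normSq_apply]
      simp
      nlinarith [mul_nonneg h1 hNpos.le]
    have hn2 : ‖z‖ ≤ ‖(s:ℂ) * z + N‖ := by
      apply le_of_sq_le_sq _ (norm_nonneg _); nlinarith
    have hn3 : N ≤ ‖(s:ℂ) * z + N‖ := by
      apply le_of_sq_le_sq _ (norm_nonneg _); nlinarith [sq_nonneg ‖z‖]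
    refine ⟨hn2, hn3, ?_⟩
    have hLre : (L z).re = (((s:ℂ) * z + N) * Complex.log ((s:ℂ) * z + N)).re
        + s * (((s:ℂ) * z + N) * Complex.log ((s:ℂ) * z + N)).im := by
      simp only [hL]
      generalize ((s:ℂ) * z + N) * Complex.log ((s:ℂ) * z + N) = w
      simp
    have hN1 : 1 ≤ N := Real.one_le_exp (by norm_num)
    rcases hs with h | h
    · have := barrier_lb (ζ := (s:ℂ) * z + N) (by simp; linarith) (by simp [h]; linarith) (by linarith)
      refine this.trans (le_of_eq ?_)
      rw [hLre, h]; ring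
    · have := barrier_lb (ζ := conj ((s:ℂ) * z + N)) (by simp; linarith) (by simp [h]; linarith) (by rw [RCLike.norm_conj]; linarith)
      rw [RCLike.norm_conj] at this
      refine this.trans (le_of_eq ?_)
      rw [log_conj]
      · rw [← map_mul, conj_re, conj_im]
        rw [hLre, h]; ring
      · rw [Ne, arg_eq_pi_iff]
        simp; intro h'; linarith
  have hbc : ContinuousOn (fun z => (L z).re) (closure S) :=
    continuous_re.comp_continuousOn (hLd.continuousOn.mono hsub)
  have hclS : closure S ⊆ {z : ℂ | 0 ≤ z.im} := fun z hz => (hcl hz).2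
  refine PLgen (S := S) (a := fun z => a z + B) (b := fun z => (L z).re) (open_quad s) ?_ hbc ?_ ?_ ?_ ?_ ?_
  · exact (ha.mono hclS).add continuousOn_const
  · intro z hz
    exact SupM_add_const open_hp (ha.mono (fun z (hz : 0 < z.im) => hz.le)) hz.2 B (sa z hz.2)
  · intro z hz η hη
    exact SupM_const_mul hη.le (SupM_re hLo hLd (hsub (subset_closure hz)))
  · intro z hz
    have h1 := hcl (frontier_subset_closure hz)
    rw [(open_quad s).frontier_eq] at hz
    have h2 := hz.2
    simp only [S, mem_setOf_eq, not_and_or, not_lt] at h2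
    rcases h2 with h2 | h2
    · have e : z.re = 0 := by
        have : s * z.re = 0 := le_antisymm h2 h1.1
        rcases hs with h | h <;> simpa [h] using this
      have : z = (z.im : ℂ) * I := by apply Complex.ext <;> simp [e]
      have h3 := hB z.im h1.2
      rw [← this] at h3; linarith
    · have e : z.im = 0 := le_antisymm h2 h1.2
      have : z = (z.re : ℂ) := by apply Complex.ext <;> simp [e]
      have h3 := h0 z.re
      rw [← this] at h3; positivity
  · intro z hz
    obtain ⟨_, h2, h3⟩ := hlb z hz
    refine le_trans ?_ h3
    have : 4 ≤ Real.log ‖(s:ℂ) * z + N‖ := by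
      rw [Real.le_log_iff_exp_le (by linarith)]; exact h2
    apply mul_nonneg (norm_nonneg _); linarith
  · intro η hη
    refine ⟨Real.exp (4 + 2 * C / η), fun z hz hR => ?_⟩
    obtain ⟨h1, h2, h3⟩ := hlb z hz
    have hcz := hC z (hclS hz)
    have hk : 0 ≤ 2 * C / η := by positivity
    have h5 : 4 + 2 * C / η ≤ Real.log ‖(s:ℂ) * z + N‖ := by
      rw [Real.le_log_iff_exp_le (by linarith)]; linarith
    have hz1 : 1 ≤ ‖z‖ := le_trans (Real.one_le_exp (by linarith)) hR
    have h6 : ‖z‖ * (2 * C / η) ≤ (L z).re := by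
      refine le_trans ?_ h3
      apply mul_le_mul h1 (by linarith) hk (norm_nonneg _)
    have h7 : ‖z‖ * (2 * C) ≤ η * (L z).re := by
      calc ‖z‖ * (2 * C) = η * (‖z‖ * (2 * C / η)) := by field_simp
        _ ≤ _ := mul_le_mul_of_nonneg_left h6 hη.le
    nlinarith

/-- bounded below version in half plane -/
lemma PL0 {a : ℂ → ℝ} (ha : ContinuousOn a {z : ℂ | 0 ≤ z.im})
    (sa : ∀ z : ℂ, 0 < z.im → SupM a z) (h0 : ∀ x : ℝ, 0 ≤ a x) {B : ℝ}
    (hB : ∀ z : ℂ, 0 ≤ z.im → -B ≤ a z) : ∀ z : ℂ, 0 ≤ z.im → 0 ≤ a z := by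
  have hB0 : ∀ z : ℂ, z.im = 0 → 0 ≤ a z := by
    intro z hz
    have : z = (z.re : ℂ) := by apply Complex.ext <;> simp [hz]
    rw [this]; exact h0 _
  intro z hz
  rcases hz.eq_or_lt with hz | hz
  · exact hB0 z hz.symm
  set L : ℂ → ℂ := fun z => Complex.log (1 - I * z)
  have hLd : DifferentiableOn ℂ L {z | -1 < z.im} := by
    intro z hz
    have : 1 - I * z ∈ slitPlane := by
      left; simp at hz ⊢; linarith
    exact DifferentiableAt.differentiableWithinAt (by fun_prop (disch := assumption))
  have hLo : IsOpen {z : ℂ | -1 < z.im} := isOpen_lt continuous_const (by fun_prop)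
  have hsub : closure {z : ℂ | 0 < z.im} ⊆ {z | -1 < z.im} := fun z hz => by
    have := (closure_hp hz); simp at this ⊢; linarith
  have hlb : ∀ z : ℂ, 0 ≤ z.im → 1 ≤ ‖1 - I * z‖ ∧ ‖z‖ ≤ ‖1 - I * z‖ := by
    intro z hz
    have hn1 : ‖z‖ ^ 2 + 1 ≤ ‖1 - I * z‖ ^ 2 := by
      rw [← normSq_eq_norm_sq, ← normSq_eq_norm_sq, normSq_apply, normSq_apply]
      simp
      nlinarith
    constructor
    · apply le_of_sq_le_sq _ (norm_nonneg _); nlinarith [sq_nonneg ‖z‖]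
    · apply le_of_sq_le_sq _ (norm_nonneg _); nlinarith
  refine PLgen (S := {z : ℂ | 0 < z.im}) (a := a) (b := fun z => (L z).re) open_hp (ha.mono closure_hp)
    (continuous_re.comp_continuousOn (hLd.continuousOn.mono hsub)) (fun z hz => sa z hz) ?_ ?_ ?_ ?_ z hz
  · intro z hz η hη
    exact SupM_const_mul hη.le (SupM_re hLo hLd (hsub (subset_closure hz)))
  · intro z hz
    have h1 := closure_hp (frontier_subset_closure hz)
    rw [open_hp.frontier_eq] at hz
    exact hB0 z (le_antisymm (not_lt.1 hz.2) h1)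
  · intro z hz
    simp only [L, log_re]
    exact Real.log_nonneg (hlb z (closure_hp hz)).1
  · intro η hη
    refine ⟨Real.exp (|B| / η), fun z hz hR => ?_⟩
    have h1 := hlb z (closure_hp hz)
    have h5 : |B| / η ≤ (L z).re := by
      simp only [L, log_re]
      rw [Real.le_log_iff_exp_le (by linarith)]; linarith
    have h6 : |B| ≤ η * (L z).re := by
      rwa [div_le_iff₀' hη] at h5
    have := hB z (closure_hp hz)
    linarith [le_abs_self B]

theorem PLc {a : ℂ → ℝ} (ha : ContinuousOn a {z : ℂ | 0 ≤ z.im})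
    (sa : ∀ z : ℂ, 0 < z.im → SupM a z) (h0 : ∀ x : ℝ, 0 ≤ a x) {C B : ℝ}
    (hC : ∀ z : ℂ, 0 ≤ z.im → - C * (1 + ‖z‖) ≤ a z) (hB : ∀ y : ℝ, 0 ≤ y → -B ≤ a (y * I)) :
    ∀ z : ℂ, 0 ≤ z.im → 0 ≤ a z := by
  have hC' : ∀ z : ℂ, 0 ≤ z.im → - |C| * (1 + ‖z‖) ≤ a z := fun z hz =>
    le_trans (mul_le_mul_of_nonneg_right (neg_le_neg (le_abs_self C)) (by positivity)) (hC z hz)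
  have hB' : ∀ y : ℝ, 0 ≤ y → -|B| ≤ a (y * I) := fun y hy => (neg_le_neg (le_abs_self B)).trans (hB y hy)
  refine PL0 (B := |B|) ha sa h0 ?_
  intro z hz
  rcases hz.eq_or_lt with hz0 | hz0
  · have : z = (z.re : ℂ) := by apply Complex.ext <;> simp [← hz0]
    have h3 := h0 z.re
    rw [← this] at h3
    linarith [abs_nonneg B]
  · rcases lt_trichotomy z.re 0 with h | h | h
    · have := PLquad ha sa h0 (abs_nonneg C) (abs_nonneg B) hC' hB' (s := -1) (Or.inr rfl) z ⟨by linarith, hz0⟩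
      linarith
    · have : z = (z.im : ℂ) * I := by apply Complex.ext <;> simp [h]
      rw [this]; exact hB' _ hz
    · have := PLquad ha sa h0 (abs_nonneg C) (abs_nonneg B) hC' hB' (s := 1) (Or.inl rfl) z ⟨by linarith, hz0⟩
      linarith

lemma cayley_im {z ζ : ℂ} (hz : 0 < z.im) (hζ : ‖ζ‖ < 1) : 1 - ζ ≠ 0 ∧
    0 < ((z - conj z * ζ) / (1 - ζ)).im := by
  have h1 : 1 - ζ ≠ 0 := by
    intro h
    have : ζ = 1 := by linear_combination -h
    rw [this] at hζ; simp at hζ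
  refine ⟨h1, ?_⟩
  have h2 : 0 < normSq (1 - ζ) := normSq_pos.2 h1
  have h3 : ((z - conj z * ζ) / (1 - ζ)).im = z.im * (1 - normSq ζ) / normSq (1 - ζ) := by
    rw [div_im]
    field_simp
    simp [normSq_apply]
    ring
  rw [h3]
  apply div_pos (mul_pos hz _) h2
  rw [normSq_eq_norm_sq]
  nlinarith [norm_nonneg ζ]

lemma schwarz_pick {Q : ℂ → ℂ} (hQ : DifferentiableOn ℂ Q {z | 0 < z.im})
    (hp : ∀ z : ℂ, 0 < z.im → 0 ≤ (Q z).im) {z : ℂ} (hz : 0 < z.im) :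
    ‖deriv Q z‖ ≤ (Q z).im / z.im := by
  rw [le_div_iff₀ hz]
  apply le_of_forall_pos_le_add
  intro η hη
  set ψ : ℂ → ℂ := fun ζ => (z - conj z * ζ) / (1 - ζ) with hψ
  set w0 : ℂ := Q z + η * I with hw0
  have hw0i : 0 < w0.im := by simp [hw0]; linarith [hp z hz]
  set F : ℂ → ℂ := fun ζ => (Q (ψ ζ) + η * I - w0) / (Q (ψ ζ) + η * I - conj w0) with hF
  have hψ0 : ψ 0 = z := by simp [hψ]
  have hQat : ∀ w : ℂ, 0 < w.im → DifferentiableAt ℂ Q w := fun w hw =>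
    hQ.differentiableAt (open_hp.mem_nhds hw)
  have hD : ∀ ζ : ℂ, ‖ζ‖ < 1 → Q (ψ ζ) + η * I - conj w0 ≠ 0 := by
    intro ζ hζ h
    have := congrArg Complex.im h
    simp at this
    have h2 := hp (ψ ζ) (cayley_im hz hζ).2
    linarith
  have hψd : ∀ ζ : ℂ, ‖ζ‖ < 1 → DifferentiableAt ℂ ψ ζ := by
    intro ζ hζ
    have := (cayley_im hz hζ).1
    fun_prop (disch := assumption)
  have hFd : DifferentiableOn ℂ F (ball 0 1) := by
    intro ζ hζ
    rw [mem_ball_zero_iff] at hζ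
    apply DifferentiableAt.differentiableWithinAt
    have h1 : DifferentiableAt ℂ (fun ζ => Q (ψ ζ)) ζ :=
      (hQat _ (cayley_im hz hζ).2).comp ζ (hψd ζ hζ)
    exact ((h1.add_const _).sub_const _).div ((h1.add_const _).sub_const _) (hD ζ hζ)
  have hF0 : F 0 = 0 := by simp [hF, hψ0, hw0]
  have hmaps : MapsTo F (ball 0 1) (closedBall (F 0) 1) := by
    intro ζ hζ
    rw [mem_ball_zero_iff] at hζ
    rw [hF0, mem_closedBall_zero_iff]
    simp only [hF, norm_div]
    apply div_le_one_of_le₀ _ (norm_nonneg _)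
    have hq : 0 < (Q (ψ ζ) + η * I).im := by simp; linarith [hp (ψ ζ) (cayley_im hz hζ).2]
    generalize Q (ψ ζ) + η * I = w at hq ⊢
    apply le_of_sq_le_sq _ (norm_nonneg _)
    rw [← normSq_eq_norm_sq, ← normSq_eq_norm_sq, normSq_apply, normSq_apply]
    simp
    nlinarith [mul_pos hq hw0i]
  have key := norm_deriv_le_one_of_mapsTo_ball hFd hmaps one_pos
  have hψ' : HasDerivAt ψ (z - conj z) 0 := by
    have h1 : HasDerivAt (fun ζ : ℂ => z - conj z * ζ) (-(conj z * 1)) 0 :=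
      ((hasDerivAt_id (0:ℂ)).const_mul (conj z)).const_sub z
    have h2 : HasDerivAt (fun ζ : ℂ => 1 - ζ) (-1) 0 := (hasDerivAt_id (0:ℂ)).const_sub 1
    have := h1.div h2 (by simp)
    refine HasDerivAt.congr_deriv this ?_
    simp; ring
  have hQψ : HasDerivAt (fun ζ => Q (ψ ζ)) (deriv Q z * (z - conj z)) 0 := by
    apply HasDerivAt.comp (0:ℂ) _ hψ'
    rw [hψ0]; exact (hQat z hz).hasDerivAt
  have hFder : HasDerivAt F (deriv Q z * (z - conj z) / (w0 - conj w0)) 0 := by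
    have hN := (hQψ.add_const (η * I)).sub_const w0
    have hDD := (hQψ.add_const (η * I)).sub_const (conj w0)
    have := hN.div hDD (hD 0 (by simp))
    refine HasDerivAt.congr_deriv this ?_
    have hne : w0 - conj w0 ≠ 0 := by
      have := hD 0 (by simp); rwa [hψ0] at this
    rw [hψ0, ← hw0, sub_self]
    field_simp
    ring
  rw [hFder.deriv, norm_div, norm_mul, sub_conj, sub_conj, norm_mul, norm_mul] at key
  simp only [norm_I, norm_real, mul_one, Real.norm_eq_abs, abs_mul, abs_two] at key
  rw [abs_of_pos hz, abs_of_pos hw0i, div_le_one (by positivity)] at key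
  have : w0.im = (Q z).im + η := by simp [hw0]
  rw [this] at key
  linarith

lemma convex_hp : Convex ℝ {z : ℂ | 0 < z.im} := convex_halfSpace_im_gt 0

lemma exact_hp {g : ℂ → ℂ} (hg : DifferentiableOn ℂ g {z | 0 < z.im}) :
    ∃ P : ℂ → ℂ, ∀ z : ℂ, 0 < z.im → HasDerivAt P (g z) z := by
  set ψ : ℂ → ℂ := fun ζ => (I - conj I * ζ) / (1 - ζ) with hψ
  have hI : (0:ℝ) < I.im := by simp
  set ψ' : ℂ → ℂ := fun ζ => 2 * I / (1 - ζ) ^ 2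
  have hψd : ∀ ζ : ℂ, ‖ζ‖ < 1 → HasDerivAt ψ (ψ' ζ) ζ := by
    intro ζ hζ
    have hne := (cayley_im hI hζ).1
    have h1 : HasDerivAt (fun ζ : ℂ => I - conj I * ζ) (-(conj I * 1)) ζ :=
      ((hasDerivAt_id ζ).const_mul (conj I)).const_sub I
    have h2 : HasDerivAt (fun ζ : ℂ => 1 - ζ) (-1) ζ := (hasDerivAt_id ζ).const_sub 1
    have := h1.div h2 hne
    refine HasDerivAt.congr_deriv this ?_
    simp [ψ']; ring
  have hh : DifferentiableOn ℂ (fun ζ => g (ψ ζ) * ψ' ζ) (ball 0 1) := by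
    intro ζ hζ
    rw [mem_ball_zero_iff] at hζ
    have hne := (cayley_im hI hζ).1
    apply DifferentiableAt.differentiableWithinAt
    apply DifferentiableAt.mul
    · exact (hg.differentiableAt (open_hp.mem_nhds (cayley_im hI hζ).2)).comp ζ (hψd ζ hζ).differentiableAt
    · have : (1 - ζ)^2 ≠ 0 := pow_ne_zero 2 hne
      simp only [ψ']
      fun_prop (disch := assumption)
  obtain ⟨P, hP⟩ := hh.isExactOn_ball
  set φ : ℂ → ℂ := fun z => (z - I) / (z + I) with hφ
  refine ⟨fun z => P (φ z), fun z hz => ?_⟩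
  have hne : z + I ≠ 0 := by
    intro h; have := congrArg Complex.im h; simp at this; linarith
  have hφb : ‖φ z‖ < 1 := by
    simp only [hφ, norm_div]
    rw [div_lt_one (norm_pos_iff.2 hne)]
    apply lt_of_pow_lt_pow_left₀ 2 (norm_nonneg _)
    rw [← normSq_eq_norm_sq, ← normSq_eq_norm_sq, normSq_apply, normSq_apply]
    simp; nlinarith
  have h1ne := (cayley_im hI hφb).1
  have h1φ : 1 - φ z = 2 * I / (z + I) := by simp only [hφ]; field_simp; ring
  have hψφ : ψ (φ z) = z := by
    simp only [hψ, h1φ]; simp only [hφ, conj_I]; field_simp; ring_nf; 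
  have hφ' : HasDerivAt φ (2 * I / (z + I)^2) z := by
    have := ((hasDerivAt_id z).sub_const I).div ((hasDerivAt_id z).add_const I) hne
    refine HasDerivAt.congr_deriv this ?_
    simp; ring
  have := (hP (φ z) (by simpa using hφb)).comp z hφ'
  refine HasDerivAt.congr_deriv this ?_
  simp only [ψ', h1φ, hψφ]
  field_simp

lemma exists_conj {u : ℂ → ℝ} (hu : InnerProductSpace.HarmonicOnNhd u {z : ℂ | 0 < z.im}) :
    ∃ Θ : ℂ → ℂ, DifferentiableOn ℂ Θ {z : ℂ | 0 < z.im} ∧ ∀ z : ℂ, 0 < z.im → (Θ z).im = u z := by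
  let g : ℂ → ℂ := fun z => fderiv ℝ u z 1 - I * fderiv ℝ u z I
  have hg : DifferentiableOn ℂ g {z : ℂ | 0 < z.im} :=
    fun x hx ↦ (HarmonicAt.differentiableAt_complex_partial (hu x hx)).differentiableWithinAt
  obtain ⟨P, hP⟩ := exact_hp hg
  set F : ℂ → ℂ := fun z => P z - P I + u I with hFdef
  have hF : ∀ z : ℂ, 0 < z.im → HasDerivAt F (g z) z := fun z hz => ((hP z hz).sub_const _).add_const _
  have h₁F : DifferentiableOn ℂ F {z : ℂ | 0 < z.im} :=
    fun x hx ↦ (hF x hx).differentiableAt.differentiableWithinAt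
  have h₂F : DifferentiableOn ℝ F {z : ℂ | 0 < z.im} := h₁F.restrictScalars (𝕜 := ℝ) (𝕜' := ℂ)
  have heq : EqOn (reCLM ∘ F) u {z : ℂ | 0 < z.im} := by
    intro x hx
    apply convex_hp.eqOn_of_fderivWithin_eq (𝕜 := ℝ) (x := I)
    · exact reCLM.differentiable.comp_differentiableOn h₂F
    · exact fun y hy ↦ (ContDiffAt.differentiableAt (hu y hy).1 two_ne_zero).differentiableWithinAt
    · exact open_hp.uniqueDiffOn
    · intro y hy
      have h₄F := (hF y hy).differentiableAt
      have h₅F := h₄F.restrictScalars (𝕜 := ℝ) (𝕜' := ℂ)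
      rw [fderivWithin_eq_fderiv (open_hp.uniqueDiffWithinAt hy)
        (reCLM.differentiableAt.comp y h₅F), fderivWithin_eq_fderiv
        (open_hp.uniqueDiffWithinAt hy) ((hu y hy).1.differentiableAt two_ne_zero), fderiv_comp y
        (by fun_prop) h₅F, ContinuousLinearMap.fderiv, h₄F.fderiv_restrictScalars (𝕜 := ℝ)]
      ext a
      nth_rw 2 [(by simp : a = a.re • (1 : ℂ) + a.im • (I : ℂ))]
      rw [map_add, map_smul, map_smul]
      simp [HasDerivAt.deriv (hF y hy), g]
    · simp
    · simp [hFdef]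
    · exact hx
  refine ⟨fun z => I * F z, ?_, ?_⟩
  · exact h₁F.const_mul I
  · intro z hz
    have := heq hz
    simpa using this

/-- Harnack along a segment -/
lemma harnack {Q : ℂ → ℂ} (hQ : DifferentiableOn ℂ Q {z | 0 < z.im})
    (hp : ∀ z : ℂ, 0 < z.im → 0 ≤ (Q z).im) {m : ℝ} (hm : 0 < m) {z z0 : ℂ} (hz : m ≤ z.im)
    (hz0 : m ≤ z0.im) : (Q z).im ≤ (Q z0).im * Real.exp (‖z - z0‖ / m) := by
  set k := ‖z - z0‖ / m
  set γ : ℝ → ℂ := fun t => z0 + t * (z - z0)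
  have hγ : ∀ t ∈ Icc (0:ℝ) 1, m ≤ (γ t).im := by
    intro t ht
    simp only [γ, add_im, mul_im, ofReal_re, ofReal_im, sub_im, zero_mul, add_zero]
    nlinarith [ht.1, ht.2]
  have hd : ∀ t ∈ Icc (0:ℝ) 1, HasDerivAt (fun t => (Q (γ t)).im * Real.exp (-k * t))
      ((deriv Q (γ t) * (z - z0)).im * Real.exp (-k * t) + (Q (γ t)).im * (Real.exp (-k * t) * (-k))) t := by
    intro t ht
    have h1 : HasDerivAt Q (deriv Q (γ t)) (γ t) :=
      (hQ.differentiableAt (open_hp.mem_nhds (lt_of_lt_of_le hm (hγ t ht)))).hasDerivAt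
    have h2 : HasDerivAt γ (z - z0) t := by
      have := ((hasDerivAt_id t).ofReal_comp.mul_const (z - z0)).const_add z0
      exact this.congr_deriv (by simp)
    have h3 := (h1.comp t h2)
    have h4 : HasDerivAt (fun t => (Q (γ t)).im) (deriv Q (γ t) * (z - z0)).im t := by
      exact imCLM.hasFDerivAt.comp_hasDerivAt t h3
    have h5 : HasDerivAt (fun t : ℝ => Real.exp (-k * t)) (Real.exp (-k * t) * (-k)) t := by
      have := ((hasDerivAt_id t).const_mul (-k)).exp
      simpa using this
    exact h4.mul h5
  have hanti : AntitoneOn (fun t => (Q (γ t)).im * Real.exp (-k * t)) (Icc 0 1) := by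
    apply antitoneOn_of_deriv_nonpos (convex_Icc 0 1)
    · exact fun t ht => (hd t ht).continuousAt.continuousWithinAt
    · intro t ht
      rw [interior_Icc] at ht
      exact (hd t (Ioo_subset_Icc_self ht)).differentiableAt.differentiableWithinAt
    · intro t ht
      rw [interior_Icc] at ht
      have ht' := Ioo_subset_Icc_self ht
      rw [(hd t ht').deriv]
      have him := hγ t ht'
      have hpos := lt_of_lt_of_le hm him
      have h1 := schwarz_pick hQ hp hpos
      have h2 : (Q (γ t)).im / (γ t).im ≤ (Q (γ t)).im / m := by
        apply div_le_div_of_nonneg_left (hp _ hpos) hm him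
      have h3 : (deriv Q (γ t) * (z - z0)).im ≤ (Q (γ t)).im * k := by
        calc _ ≤ ‖deriv Q (γ t) * (z - z0)‖ := (le_abs_self _).trans (abs_im_le_norm _)
          _ = ‖deriv Q (γ t)‖ * ‖z - z0‖ := norm_mul _ _
          _ ≤ (Q (γ t)).im / m * ‖z - z0‖ := by gcongr; exact h1.trans h2
          _ = _ := by simp only [k]; ring
      have := mul_le_mul_of_nonneg_right h3 (Real.exp_pos (-k * t)).le
      linarith
  have := hanti (left_mem_Icc.2 zero_le_one) (right_mem_Icc.2 zero_le_one) zero_le_one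
  simp only [γ, ofReal_one, one_mul, ofReal_zero, zero_mul, add_zero, mul_zero, Real.exp_zero, mul_one,
    add_sub_cancel, Real.exp_neg] at this
  rwa [← div_eq_mul_inv, div_le_iff₀ (Real.exp_pos _)] at this

lemma hasDerivAt_vert {Q : ℂ → ℂ} (hQ : DifferentiableOn ℂ Q {z | 0 < z.im}) (x : ℝ) {y : ℝ} (hy : 0 < y) :
    HasDerivAt (fun t : ℝ => Q (x + t * I)) (deriv Q (x + y * I) * I) y := by
  have h1 : HasDerivAt Q (deriv Q (x + y * I)) (x + y * I) :=
    (hQ.differentiableAt (open_hp.mem_nhds (by simpa using hy))).hasDerivAt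
  have h2 : HasDerivAt (fun t : ℝ => (x : ℂ) + t * I) I y := by
    have := ((hasDerivAt_id y).ofReal_comp.mul_const I).const_add (x:ℂ)
    simpa using this
  exact h1.comp y h2

lemma hasDerivAt_horiz {Q : ℂ → ℂ} (hQ : DifferentiableOn ℂ Q {z | 0 < z.im}) (x : ℝ) {y : ℝ} (hy : 0 < y) :
    HasDerivAt (fun t : ℝ => Q (t + y * I)) (deriv Q (x + y * I)) x := by
  have h1 : HasDerivAt Q (deriv Q (x + y * I)) (x + y * I) :=
    (hQ.differentiableAt (open_hp.mem_nhds (by simpa using hy))).hasDerivAt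
  have h2 : HasDerivAt (fun t : ℝ => (t : ℂ) + y * I) 1 x := by
    have := ((hasDerivAt_id x).ofReal_comp).add_const ((y:ℂ) * I)
    simpa using this
  exact (h1.comp x h2).congr_deriv (by simp)

lemma hd_im {g : ℝ → ℂ} {g' : ℂ} {t : ℝ} (h : HasDerivAt g g' t) : HasDerivAt (fun t => (g t).im) g'.im t :=
  imCLM.hasFDerivAt.comp_hasDerivAt t h
lemma hd_re {g : ℝ → ℂ} {g' : ℂ} {t : ℝ} (h : HasDerivAt g g' t) : HasDerivAt (fun t => (g t).re) g'.re t :=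
  reCLM.hasFDerivAt.comp_hasDerivAt t h

/-- `y * W` is increasing and `W / y` is decreasing on vertical lines -/
lemma vert_mono {Q : ℂ → ℂ} (hQ : DifferentiableOn ℂ Q {z | 0 < z.im})
    (hp : ∀ z : ℂ, 0 < z.im → 0 ≤ (Q z).im) (x : ℝ) :
    MonotoneOn (fun y : ℝ => (Q (x + y * I)).im * y) (Ioi 0) ∧
    AntitoneOn (fun y : ℝ => (Q (x + y * I)).im / y) (Ioi 0) := by
  have hb : ∀ y : ℝ, 0 < y → |(deriv Q (x + y * I) * I).im| * y ≤ (Q (x + y * I)).im := by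
    intro y hy
    have h := schwarz_pick hQ hp (z := x + y * I) (by simpa using hy)
    rw [le_div_iff₀ (by simpa using hy)] at h
    have h2 : |(deriv Q (x + y * I) * I).im| ≤ ‖deriv Q (x + y * I)‖ := by
      refine (abs_im_le_norm _).trans ?_
      simp
    have h3 : (x + y * I : ℂ).im = y := by simp
    rw [h3] at h
    exact (mul_le_mul_of_nonneg_right h2 hy.le).trans h
  have hd : ∀ y ∈ Ioi (0:ℝ), HasDerivAt (fun y : ℝ => (Q (x + y * I)).im) (deriv Q (x + y * I) * I).im y :=
    fun y hy => hd_im (hasDerivAt_vert hQ x hy)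
  constructor
  · have hd2 : ∀ y ∈ Ioi (0:ℝ), HasDerivAt (fun y : ℝ => (Q (x + y * I)).im * y) _ y :=
      fun y hy => (hd y hy).mul (hasDerivAt_id y)
    apply monotoneOn_of_deriv_nonneg (convex_Ioi 0)
    · exact fun y hy => (hd2 y hy).continuousAt.continuousWithinAt
    · rw [interior_Ioi]
      exact fun y hy => (hd2 y hy).differentiableAt.differentiableWithinAt
    · rw [interior_Ioi]
      intro y hy
      have := hb y hy
      rw [(hd2 y hy).deriv]
      have h3 := neg_abs_le (deriv Q (x + y * I) * I).im
      have := mul_le_mul_of_nonneg_right h3 (le_of_lt hy)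
      simp only [id, mul_one]
      linarith
  · have hd2 : ∀ y ∈ Ioi (0:ℝ), HasDerivAt (fun y : ℝ => (Q (x + y * I)).im / y) _ y :=
      fun y hy => (hd y hy).div (hasDerivAt_id y) (ne_of_gt hy)
    apply antitoneOn_of_deriv_nonpos (convex_Ioi 0)
    · exact fun y hy => (hd2 y hy).continuousAt.continuousWithinAt
    · rw [interior_Ioi]
      exact fun y hy => (hd2 y hy).differentiableAt.differentiableWithinAt
    · rw [interior_Ioi]
      intro y hy
      have := hb y hy
      rw [(hd2 y hy).deriv]
      have h3 := le_abs_self (deriv Q (x + y * I) * I).im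
      have := mul_le_mul_of_nonneg_right h3 (le_of_lt hy)
      apply div_nonpos_of_nonpos_of_nonneg _ (sq_nonneg _)
      simp only [id, mul_one]
      linarith

noncomputable def PV (φ : ℝ → ℝ) (z : ℂ) : ℝ := π⁻¹ * ∫ s : ℝ, φ (z.re + z.im * s) * (1 + s ^ 2)⁻¹

lemma PV_symm (φ : ℝ → ℝ) (z : ℂ) : PV φ (conj z) = PV φ z := by
  unfold PV
  congr 1
  rw [← integral_neg_eq_self]
  simp

lemma PV_real (φ : ℝ → ℝ) (x : ℝ) : PV φ x = φ x := by
  unfold PV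
  simp only [ofReal_re, ofReal_im, zero_mul, add_zero]
  rw [integral_const_mul, integral_univ_inv_one_add_sq]
  field_simp

lemma PV_nonneg {φ : ℝ → ℝ} (h : ∀ t, 0 ≤ φ t) (z : ℂ) : 0 ≤ PV φ z := by
  unfold PV
  apply mul_nonneg (by positivity)
  apply integral_nonneg
  intro s
  exact mul_nonneg (h _) (by positivity)

lemma PV_kernel (φ : ℝ → ℝ) {z : ℂ} (hz : 0 < z.im) :
    PV φ z = π⁻¹ * ∫ t : ℝ, φ t * (z.im / ((t - z.re) ^ 2 + z.im ^ 2)) := by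
  unfold PV
  congr 1
  set g : ℝ → ℝ := fun t => φ t * (1 + ((t - z.re) / z.im) ^ 2)⁻¹ with hg
  have h1 : (fun s : ℝ => φ (z.re + z.im * s) * (1 + s ^ 2)⁻¹) = fun s => g (z.re + z.im * s) := by
    ext s; simp only [hg]; congr 3; field_simp; ring
  rw [h1, Measure.integral_comp_mul_left (fun s => g (z.re + s)) z.im, integral_add_left_eq_self g,
    abs_of_pos (inv_pos.2 hz), smul_eq_mul, ← integral_const_mul]
  congr 1
  ext t
  simp only [hg]
  have : 0 < (t - z.re) ^ 2 + z.im ^ 2 := by positivity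
  field_simp
  rw [add_comm]

lemma ker_bound {z : ℂ} {m R : ℝ} (hm : 0 < m) (h1 : m ≤ z.im) (h2 : ‖z‖ ≤ R) (t : ℝ) :
    1 + t ^ 2 ≤ (2 + (2 * R ^ 2 + 1) / m ^ 2) * ‖(t : ℂ) - z‖ ^ 2 := by
  have e1 : m ≤ ‖(t : ℂ) - z‖ := by
    have := abs_im_le_norm ((t:ℂ) - z)
    simp only [sub_im, ofReal_im, zero_sub, abs_neg] at this
    exact h1.trans ((le_abs_self _).trans this)
  have e2 : |t| ≤ ‖(t : ℂ) - z‖ + R := by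
    have := norm_add_le ((t:ℂ) - z) z
    simp only [sub_add_cancel, norm_real, Real.norm_eq_abs] at this
    linarith
  set d := ‖(t : ℂ) - z‖
  have hd : 0 ≤ d := norm_nonneg _
  have e3 : t ^ 2 ≤ 2 * d ^ 2 + 2 * R ^ 2 := by
    rw [← sq_abs t]
    nlinarith [sq_nonneg (d - R), abs_nonneg t]
  have e4 : 2 * R ^ 2 + 1 ≤ (2 * R ^ 2 + 1) / m ^ 2 * d ^ 2 := by
    rw [div_mul_eq_mul_div, le_div_iff₀ (by positivity)]
    have : m ^ 2 ≤ d ^ 2 := by gcongr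
    nlinarith [sq_nonneg R]
  nlinarith

lemma PV_conj {φ : ℝ → ℝ} (hφ : Continuous φ) (hint : Integrable (fun t => φ t / (1 + t ^ 2))) :
    ∃ Θ : ℂ → ℂ, DifferentiableOn ℂ Θ {z : ℂ | 0 < z.im} ∧ ∀ z : ℂ, 0 < z.im → (Θ z).im = PV φ z := by
  set F : ℂ → ℝ → ℂ := fun z t => φ t * (1 / ((t:ℂ) - z) - t / (1 + t ^ 2)) with hF
  set F' : ℂ → ℝ → ℂ := fun z t => φ t * (1 / ((t:ℂ) - z) ^ 2) with hF'
  have hne : ∀ z : ℂ, 0 < z.im → ∀ t : ℝ, (t:ℂ) - z ≠ 0 := by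
    intro z hz t h
    have := congrArg Complex.im h
    simp at this; linarith
  have hne2 : ∀ t : ℝ, (1 + (t:ℂ) ^ 2) ≠ 0 := by
    intro t h
    have := congrArg Complex.re h
    simp [← ofReal_pow] at this
    nlinarith [sq_nonneg t]
  have hFc : ∀ z : ℂ, 0 < z.im → Continuous (F z) := by
    intro z hz
    simp only [hF]
    refine (continuous_ofReal.comp hφ).mul (Continuous.sub ?_ ?_)
    · exact continuous_const.div (by fun_prop) (hne z hz)
    · exact continuous_ofReal.div (by fun_prop) hne2
  have hFc' : ∀ z : ℂ, 0 < z.im → Continuous (F' z) := by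
    intro z hz
    simp only [hF']
    refine (continuous_ofReal.comp hφ).mul ?_
    exact continuous_const.div (by fun_prop) (fun t => pow_ne_zero 2 (hne z hz t))
  have hFint : ∀ z : ℂ, 0 < z.im → Integrable (F z) := by
    intro z hz
    obtain ⟨K, hK⟩ : ∃ K : ℝ, ∀ t : ℝ, 1 + t ^ 2 ≤ K * ‖(t : ℂ) - z‖ ^ 2 := ⟨_, ker_bound hz le_rfl le_rfl⟩
    refine (hint.norm.const_mul ((1 + K) * (1 + ‖z‖ + ‖z‖^2))).mono' (hFc z hz).aestronglyMeasurable ?_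
    refine Eventually.of_forall (fun t => ?_)
    have hd := norm_pos_iff.2 (hne z hz t)
    have hK0 : 0 ≤ K := by
      by_contra h
      push Not at h
      nlinarith [hK t, sq_nonneg t, sq_nonneg ‖(t : ℂ) - z‖]
    have e : 1 / ((t:ℂ) - z) - t / (1 + t ^ 2) = (1 + t * z) / (((t:ℂ) - z) * (1 + t ^ 2)) := by
      have := hne z hz t; have := hne2 t
      field_simp; ring
    have e2 : ‖(1 + (t:ℂ) ^ 2)‖ = 1 + t ^ 2 := by
      have : (1 + (t:ℂ) ^ 2) = ((1 + t ^ 2 : ℝ) : ℂ) := by push_cast; ring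
      rw [this, norm_real, Real.norm_eq_abs, abs_of_pos (by positivity)]
    have e3 : ‖(1 + t * z : ℂ)‖ ≤ (1 + K) * (1 + ‖z‖ + ‖z‖ ^ 2) * ‖(t:ℂ) - z‖ := by
      set d := ‖(t:ℂ) - z‖
      have h1 : (1 + t * z : ℂ) = (1 + z ^ 2) + z * (t - z) := by ring
      have h2 : ‖(1 + t * z : ℂ)‖ ≤ (1 + ‖z‖ ^ 2) + ‖z‖ * d := by
        rw [h1]
        refine (norm_add_le _ _).trans (add_le_add ((norm_add_le _ _).trans (by simp)) (by rw [norm_mul]))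
      have h3 : 1 ≤ (1 + K) * d := by
        by_contra hlt
        push Not at hlt
        have h5 := hK t
        have h6 : d < 1 := by nlinarith
        nlinarith [sq_nonneg t]
      have hz0 := norm_nonneg z
      have h7 := mul_le_mul_of_nonneg_right h3 (show 0 ≤ 1 + ‖z‖ ^ 2 by positivity)
      nlinarith [mul_nonneg (mul_nonneg hK0 hz0) hd.le]
    simp only [hF, e, norm_mul, norm_div, norm_real, Real.norm_eq_abs, e2]
    rw [abs_of_pos (show 0 < 1 + t ^ 2 by positivity)]
    have e4 : ‖(1 + t * z : ℂ)‖ / (‖(t:ℂ) - z‖ * (1 + t ^ 2)) ≤ (1 + K) * (1 + ‖z‖ + ‖z‖ ^ 2) / (1 + t ^ 2) := by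
      rw [div_le_div_iff₀ (by positivity) (by positivity)]
      have := mul_le_mul_of_nonneg_right e3 (show 0 ≤ 1 + t ^ 2 by positivity)
      linarith
    calc |φ t| * (‖(1 + t * z : ℂ)‖ / (‖(t:ℂ) - z‖ * (1 + t ^ 2)))
        ≤ |φ t| * ((1 + K) * (1 + ‖z‖ + ‖z‖ ^ 2) / (1 + t ^ 2)) := by gcongr
      _ = _ := by ring
  have hder : ∀ z : ℂ, 0 < z.im → HasDerivAt (fun z => ∫ t, F z t) (∫ t, F' z t) z := by
    intro z hz
    set m := z.im / 2
    have hm : 0 < m := by positivity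
    set K := (2 + (2 * (‖z‖ + m) ^ 2 + 1) / m ^ 2)
    have hK0 : 0 ≤ K := by positivity
    have hball : ∀ w ∈ ball z m, m ≤ w.im ∧ ‖w‖ ≤ ‖z‖ + m := by
      intro w hw
      rw [mem_ball, Complex.dist_eq] at hw
      constructor
      · have := abs_im_le_norm (w - z)
        simp only [sub_im] at this
        have := (abs_le.1 (this.trans hw.le)).1
        simp only [m] at *; linarith
      · have := norm_add_le (w - z) z
        simp only [sub_add_cancel] at this; linarith
    refine (hasDerivAt_integral_of_dominated_loc_of_deriv_le (F' := F') (bound := fun t => K * ‖φ t / (1 + t ^ 2)‖)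
      (ball_mem_nhds z hm) ?_ (hFint z hz) (hFc' z hz).aestronglyMeasurable ?_ (hint.norm.const_mul _) ?_).2
    · filter_upwards [open_hp.mem_nhds hz] with w hw
      exact (hFc w hw).aestronglyMeasurable
    · refine Eventually.of_forall (fun t w hw => ?_)
      obtain ⟨h1, h2⟩ := hball w hw
      have hk := ker_bound hm h1 h2 t
      have hd := norm_pos_iff.2 (hne w (lt_of_lt_of_le hm h1) t)
      simp only [hF', norm_mul, norm_div, norm_one, norm_pow, norm_real, Real.norm_eq_abs]
      rw [abs_of_pos (show 0 < 1 + t ^ 2 by positivity), mul_div_assoc', mul_one, mul_div_assoc',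
        div_le_div_iff₀ (by positivity) (by positivity)]
      have := mul_le_mul_of_nonneg_left hk (abs_nonneg (φ t))
      calc |φ t| * (1 + t ^ 2) ≤ _ := this
        _ = _ := by ring
    · refine Eventually.of_forall (fun t w hw => ?_)
      obtain ⟨h1, h2⟩ := hball w hw
      have hnz := hne w (lt_of_lt_of_le hm h1) t
      have h3 : HasDerivAt (fun w => (t:ℂ) - w) (-1) w := (hasDerivAt_id w).const_sub _
      have h4 := ((((h3.fun_inv hnz).sub_const ((t:ℂ) / (1 + (t:ℂ) ^ 2))).const_mul ((φ t : ℝ):ℂ)))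
      simp only [hF, hF']
      simp only [one_div]
      refine h4.congr_deriv ?_
      simp
  refine ⟨fun z => (π⁻¹ : ℝ) * ∫ t, F z t, ?_, ?_⟩
  · intro z hz
    exact ((hder z hz).differentiableAt.const_mul _).differentiableWithinAt
  · intro z hz
    rw [PV_kernel φ hz, im_ofReal_mul]
    congr 1
    have := integral_im (hFint z hz)
    simp only [RCLike.im_eq_complex_im] at this
    rw [← this]
    congr 1
    ext t
    simp only [hF]
    rw [im_ofReal_mul]
    congr 1
    have : ((t:ℂ) / (1 + (t:ℂ) ^ 2)) = ((t / (1 + t ^ 2) : ℝ) : ℂ) := by push_cast; rfl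
    rw [sub_im, this, ofReal_im, sub_zero, one_div, inv_im, normSq_apply]
    simp
    congr 1; ring


lemma int_ker {z : ℂ} (hz : 0 < z.im) : ∫ t : ℝ, (z.im / ((t - z.re) ^ 2 + z.im ^ 2)) = π := by
  have h := PV_kernel (fun _ => 1) hz
  unfold PV at h
  simp only [one_mul, integral_univ_inv_one_add_sq] at h
  have := mul_left_cancel₀ (inv_ne_zero Real.pi_ne_zero) h
  exact this.symm

lemma integrable_ker {z : ℂ} (hz : 0 < z.im) :
    Integrable (fun t : ℝ => (z.im / ((t - z.re) ^ 2 + z.im ^ 2))) := by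
  by_contra h
  have := int_ker hz
  rw [integral_undef h] at this
  exact Real.pi_ne_zero this.symm

lemma PV_le {φ : ℝ → ℝ} {M : ℝ} (h0 : ∀ t, 0 ≤ φ t) (h : ∀ t, φ t ≤ M) (z : ℂ) : PV φ z ≤ M := by
  have hi : ∫ s : ℝ, φ (z.re + z.im * s) * (1 + s ^ 2)⁻¹ ≤ ∫ s : ℝ, M * (1 + s ^ 2)⁻¹ := by
    refine integral_mono_of_nonneg (Eventually.of_forall fun s => mul_nonneg (h0 _) (by positivity))
      (integrable_inv_one_add_sq.const_mul _) (Eventually.of_forall fun s => ?_)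
    exact mul_le_mul_of_nonneg_right (h _) (by positivity)
  rw [integral_const_mul, integral_univ_inv_one_add_sq] at hi
  unfold PV
  have := mul_le_mul_of_nonneg_left hi (inv_nonneg.2 Real.pi_pos.le)
  refine this.trans (le_of_eq ?_)
  field_simp

lemma PV_growth {φ : ℝ → ℝ} {C : ℝ} (h0 : ∀ t, 0 ≤ φ t) (h : ∀ t, φ t ≤ C * (1 + |t|))
    (hint : Integrable (fun t => φ t / (1 + t ^ 2))) :
    ∃ C', ∀ z, PV φ z ≤ C' * (1 + ‖z‖) := by
  have hC : 0 ≤ C := by have := (h0 0).trans (h 0); simpa using this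
  set J := ∫ t, φ t / (1 + t ^ 2)
  have hJ : 0 ≤ J := integral_nonneg fun t => div_nonneg (h0 t) (by positivity)
  have key : ∀ z : ℂ, 0 < z.im → PV φ z ≤ (2 * C + π⁻¹ * (8 * J)) * (1 + ‖z‖) := by
    intro z hz
    rw [PV_kernel φ hz]
    have hi : ∫ t : ℝ, φ t * (z.im / ((t - z.re) ^ 2 + z.im ^ 2)) ≤
        ∫ t : ℝ, (C * (2 + 2 * ‖z‖) * (z.im / ((t - z.re) ^ 2 + z.im ^ 2)) + 8 * z.im * (φ t / (1 + t ^ 2))) := by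
      refine integral_mono_of_nonneg (Eventually.of_forall fun s => mul_nonneg (h0 _) (by positivity))
        (((integrable_ker hz).const_mul _).add (hint.const_mul _)) (Eventually.of_forall fun t => ?_)
      have hk : 0 ≤ z.im / ((t - z.re) ^ 2 + z.im ^ 2) := by positivity
      have hz0 := norm_nonneg z
      by_cases ht : |t| ≤ 2 * ‖z‖ + 1
      · have h1 : φ t ≤ C * (2 + 2 * ‖z‖) := (h t).trans (mul_le_mul_of_nonneg_left (by linarith) hC)
        have h2 : 0 ≤ 8 * z.im * (φ t / (1 + t ^ 2)) := mul_nonneg (by positivity) (div_nonneg (h0 t) (by positivity))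
        have := mul_le_mul_of_nonneg_right h1 hk
        simp only; linarith
      · push Not at ht
        have h3 : 0 ≤ C * (2 + 2 * ‖z‖) * (z.im / ((t - z.re) ^ 2 + z.im ^ 2)) := by positivity
        have h4 : z.im / ((t - z.re) ^ 2 + z.im ^ 2) ≤ 8 * z.im / (1 + t ^ 2) := by
          rw [div_le_div_iff₀ (by positivity) (by positivity)]
          have h5 : |z.re| ≤ |t| / 2 := by
            have := abs_re_le_norm z
            linarith
          have h6 : |t| / 2 ≤ |t - z.re| := by
            have := abs_sub_abs_le_abs_sub t z.re
            linarith
          have h7 : t ^ 2 / 4 ≤ (t - z.re) ^ 2 := by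
            rw [← sq_abs t, ← sq_abs (t - z.re)]
            nlinarith [abs_nonneg t]
          have h8 : 1 ≤ t ^ 2 := by rw [← sq_abs t]; nlinarith
          nlinarith [sq_nonneg z.im]
        have := mul_le_mul_of_nonneg_left h4 (h0 t)
        have e : φ t * (8 * z.im / (1 + t ^ 2)) = 8 * z.im * (φ t / (1 + t ^ 2)) := by ring
        simp only; linarith
    rw [integral_add ((integrable_ker hz).const_mul _) (hint.const_mul _), integral_const_mul, integral_const_mul,
      int_ker hz] at hi
    have := mul_le_mul_of_nonneg_left hi (inv_nonneg.2 Real.pi_pos.le)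
    refine this.trans ?_
    have e : π⁻¹ * (C * (2 + 2 * ‖z‖) * π + 8 * z.im * J) = 2 * C * (1 + ‖z‖) + π⁻¹ * (8 * J) * z.im := by
      field_simp
    change π⁻¹ * (C * (2 + 2 * ‖z‖) * π + 8 * z.im * J) ≤ _
    rw [e, add_mul]
    have h9 : z.im ≤ 1 + ‖z‖ := by have := (le_abs_self _).trans (abs_im_le_norm z); linarith
    gcongr
  refine ⟨2 * C + π⁻¹ * (8 * J), fun z => ?_⟩
  rcases lt_trichotomy z.im 0 with h1 | h1 | h1
  · rw [← PV_symm, ← norm_conj z]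
    exact key _ (by simpa using h1)
  · have : z = (z.re : ℂ) := by apply Complex.ext <;> simp [h1]
    rw [this, PV_real, norm_real]
    refine (h _).trans ?_
    rw [Real.norm_eq_abs]
    gcongr
    have : 0 ≤ π⁻¹ * (8 * J) := by positivity
    linarith
  · exact key z h1

lemma PV_cont_bdd {φ : ℝ → ℝ} {M : ℝ} (hφ : Continuous φ) (h : ∀ t, |φ t| ≤ M) : Continuous (PV φ) := by
  unfold PV
  refine continuous_const.mul (continuous_of_dominated (bound := fun s => M * (1 + s ^ 2)⁻¹) ?_ ?_
    (integrable_inv_one_add_sq.const_mul _) ?_)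
  · intro z
    have : Continuous fun s : ℝ => φ (z.re + z.im * s) * (1 + s ^ 2)⁻¹ :=
      (by fun_prop : Continuous fun s : ℝ => φ (z.re + z.im * s)).mul
        (Continuous.inv₀ (by fun_prop) (fun s => by positivity))
    exact this.aestronglyMeasurable
  · refine fun z => Eventually.of_forall fun s => ?_
    rw [norm_mul, Real.norm_eq_abs, Real.norm_eq_abs, abs_of_pos (show (0:ℝ) < (1 + s ^ 2)⁻¹ by positivity)]
    exact mul_le_mul_of_nonneg_right (h _) (by positivity)
  · exact Eventually.of_forall fun s => by fun_prop

lemma PV_int {φ : ℝ → ℝ} (hφ : Continuous φ) (hint : Integrable (fun t => φ t / (1 + t ^ 2)))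
    {z : ℂ} (hz : 0 < z.im) : Integrable (fun t => φ t * (z.im / ((t - z.re) ^ 2 + z.im ^ 2))) := by
  obtain ⟨K, hK⟩ : ∃ K : ℝ, ∀ t : ℝ, 1 + t ^ 2 ≤ K * ‖(t : ℂ) - z‖ ^ 2 := ⟨_, ker_bound hz le_rfl le_rfl⟩
  have e : ∀ t : ℝ, ‖(t : ℂ) - z‖ ^ 2 = (t - z.re) ^ 2 + z.im ^ 2 := by
    intro t; rw [← normSq_eq_norm_sq, normSq_apply]; simp; ring
  have hc : Continuous (fun t => φ t * (z.im / ((t - z.re) ^ 2 + z.im ^ 2))) :=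
    hφ.mul (continuous_const.div (by fun_prop) (fun t => by positivity))
  refine (hint.norm.const_mul (K * z.im)).mono' hc.aestronglyMeasurable (Eventually.of_forall fun t => ?_)
  have h := hK t
  rw [e] at h
  have hp : 0 < (t - z.re) ^ 2 + z.im ^ 2 := by positivity
  rw [norm_mul, norm_div, Real.norm_eq_abs, Real.norm_eq_abs, Real.norm_eq_abs, Real.norm_eq_abs, abs_of_pos hz,
    abs_of_pos hp, abs_div, abs_of_pos (show 0 < 1 + t ^ 2 by positivity), mul_div_assoc', mul_div_assoc',
    div_le_div_iff₀ hp (by positivity)]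
  have := mul_le_mul_of_nonneg_left h (show 0 ≤ |φ t| * z.im by positivity)
  linarith

noncomputable def chi (n t : ℝ) : ℝ := max 0 (min 1 (n + 1 - |t|))

lemma chi_cont (n : ℝ) : Continuous (chi n) := by unfold chi; fun_prop
lemma chi_nonneg (n t : ℝ) : 0 ≤ chi n t := le_max_left _ _
lemma chi_le (n t : ℝ) : chi n t ≤ 1 := max_le (by norm_num) (min_le_left _ _)
lemma chi_one {n t : ℝ} (h : |t| ≤ n) : chi n t = 1 := by
  unfold chi; rw [min_eq_left (by linarith)]; norm_num
lemma chi_zero {n t : ℝ} (h : n + 1 ≤ |t|) : chi n t = 0 := by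
  unfold chi; rw [max_eq_left]; exact (min_le_right _ _).trans (by linarith)

lemma chi_bdd {φ : ℝ → ℝ} (hφ : Continuous φ) (n : ℝ) : ∃ M, ∀ t, |φ t * chi n t| ≤ M := by
  obtain ⟨M, hM⟩ := (isCompact_Icc (a := -(n+1)) (b := n+1)).exists_bound_of_continuousOn hφ.continuousOn
  refine ⟨max M 0, fun t => ?_⟩
  rw [abs_mul, abs_of_nonneg (chi_nonneg _ _)]
  by_cases h : |t| ≤ n + 1
  · have := hM t ⟨by linarith [(abs_le.1 h).1], (abs_le.1 h).2⟩
    rw [Real.norm_eq_abs] at this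
    calc _ ≤ |φ t| * 1 := by gcongr; exact chi_le _ _
      _ ≤ _ := by rw [mul_one]; exact this.trans (le_max_left _ _)
  · rw [chi_zero (by push Not at h; exact h.le)]; simp

lemma PV_cont {φ : ℝ → ℝ} (hφ : Continuous φ) (hint : Integrable (fun t => φ t / (1 + t ^ 2))) :
    Continuous (PV φ) := by
  rw [continuous_iff_continuousAt]
  intro z0
  set R := ‖z0‖ + 1
  have hR : 1 ≤ R := by have := norm_nonneg z0; simp only [R]; linarith
  set φ1 : ℝ → ℝ := fun t => φ t * chi (2 * R) t
  set φ2 : ℝ → ℝ := fun t => φ t * (1 - chi (2 * R) t)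
  have h1c : Continuous φ1 := hφ.mul (chi_cont _)
  have h2c : Continuous φ2 := hφ.mul (continuous_const.sub (chi_cont _))
  obtain ⟨M, hM⟩ := chi_bdd hφ (2 * R)
  have hle2 : ∀ t, |φ2 t| ≤ |φ t| := by
    intro t
    simp only [φ2, abs_mul]
    have : |1 - chi (2 * R) t| ≤ 1 := by
      rw [abs_le]; constructor <;> linarith [chi_nonneg (2*R) t, chi_le (2*R) t]
    calc _ ≤ |φ t| * 1 := by gcongr
      _ = _ := mul_one _
  have hle1 : ∀ t, |φ1 t| ≤ |φ t| := by
    intro t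
    simp only [φ1, abs_mul, abs_of_nonneg (chi_nonneg _ _)]
    calc _ ≤ |φ t| * 1 := by gcongr; exact chi_le _ _
      _ = _ := mul_one _
  have hi : ∀ ψ : ℝ → ℝ, Continuous ψ → (∀ t, |ψ t| ≤ |φ t|) → Integrable (fun t => ψ t / (1 + t ^ 2)) := by
    intro ψ hc h
    refine hint.norm.mono' (hc.div (by fun_prop) (fun t => by positivity)).aestronglyMeasurable
      (Eventually.of_forall fun t => ?_)
    rw [norm_div, norm_div]
    gcongr
    exact h t
  have hi1 := hi _ h1c hle1
  have hi2 := hi _ h2c hle2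
  have hvan : ∀ t, |t| ≤ 2 * R → φ2 t = 0 := by
    intro t ht; simp only [φ2, chi_one ht]; ring
  have hplus : ∀ z : ℂ, 0 < z.im → PV φ z = PV φ1 z + PV φ2 z := by
    intro z hz
    rw [PV_kernel _ hz, PV_kernel _ hz, PV_kernel _ hz, ← mul_add,
      ← integral_add (PV_int h1c hi1 hz) (PV_int h2c hi2 hz)]
    congr 2; ext t; simp only [φ1, φ2]; ring
  have hrest : ∀ z : ℂ, ‖z‖ ≤ R → PV φ z = PV φ1 z + π⁻¹ * ∫ t, φ2 t * (|z.im| / ((t - z.re) ^ 2 + z.im ^ 2)) := by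
    have hpos : ∀ z : ℂ, 0 < z.im → PV φ z = PV φ1 z + π⁻¹ * ∫ t, φ2 t * (|z.im| / ((t - z.re) ^ 2 + z.im ^ 2)) := by
      intro z hz
      rw [hplus z hz, PV_kernel φ2 hz, abs_of_pos hz]
    intro z hzR
    rcases lt_trichotomy z.im 0 with h1 | h1 | h1
    · have := hpos (conj z) (by simpa using h1)
      simpa [PV_symm] using this
    · have : z = (z.re : ℂ) := by apply Complex.ext <;> simp [h1]
      rw [h1, this, PV_real, PV_real]
      simp only [abs_zero, zero_div, mul_zero, integral_zero, add_zero, φ1, ofReal_re]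
      rw [chi_one, mul_one]
      have := abs_re_le_norm z
      linarith
    · exact hpos z h1
  have hnear : ∀ᶠ z in 𝓝 z0, ‖z‖ < R := by
    refine (isOpen_lt continuous_norm continuous_const).mem_nhds ?_
    simp [R]
  have heq : PV φ =ᶠ[𝓝 z0] fun z => PV φ1 z + π⁻¹ * ∫ t, φ2 t * (|z.im| / ((t - z.re) ^ 2 + z.im ^ 2)) :=
    hnear.mono fun z hz => hrest z hz.le
  refine ContinuousAt.congr ?_ heq.symm
  refine (PV_cont_bdd h1c hM).continuousAt.add (continuousAt_const.mul ?_)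
  have hden : ∀ z : ℂ, ‖z‖ < R → ∀ t : ℝ, 2 * R < |t| → (1 + t ^ 2) / 8 ≤ (t - z.re) ^ 2 + z.im ^ 2 := by
    intro z hz t ht
    have h5 : |z.re| ≤ |t| / 2 := by
      have := abs_re_le_norm z
      linarith
    have h6 : |t| / 2 ≤ |t - z.re| := by
      have := abs_sub_abs_le_abs_sub t z.re
      linarith
    have h7 : t ^ 2 / 4 ≤ (t - z.re) ^ 2 := by
      rw [← sq_abs t, ← sq_abs (t - z.re)]
      nlinarith [abs_nonneg t]
    have h8 : 1 ≤ t ^ 2 := by rw [← sq_abs t]; nlinarith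
    nlinarith [sq_nonneg z.im]
  refine continuousAt_of_dominated (bound := fun t => 8 * R * ‖φ t / (1 + t ^ 2)‖) ?_ ?_ (hint.norm.const_mul _) ?_
  · refine Eventually.of_forall fun z => ?_
    refine (h2c.measurable.mul ?_).aestronglyMeasurable
    fun_prop
  · filter_upwards [hnear] with z hz
    refine Eventually.of_forall fun t => ?_
    by_cases ht : |t| ≤ 2 * R
    · rw [hvan t ht]; simp; positivity
    · push Not at ht
      have hd := hden z hz t ht
      have hd0 : 0 < (t - z.re) ^ 2 + z.im ^ 2 := lt_of_lt_of_le (by positivity) hd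
      rw [norm_mul, norm_div, norm_div, Real.norm_eq_abs, Real.norm_eq_abs, Real.norm_eq_abs, Real.norm_eq_abs, abs_abs,
        abs_of_pos hd0, Real.norm_eq_abs, abs_of_pos (show 0 < 1 + t ^ 2 by positivity)]
      have h9 : |z.im| ≤ R := (abs_im_le_norm z).trans hz.le
      have h10 : |z.im| / ((t - z.re) ^ 2 + z.im ^ 2) ≤ 8 * R / (1 + t ^ 2) := by
        rw [div_le_div_iff₀ hd0 (by positivity)]
        nlinarith [abs_nonneg z.im]
      calc _ ≤ |φ t| * (8 * R / (1 + t ^ 2)) := mul_le_mul (hle2 t) h10 (by positivity) (abs_nonneg _)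
        _ = _ := by ring
  · refine Eventually.of_forall fun t => ?_
    by_cases ht : |t| ≤ 2 * R
    · simp only [hvan t ht, zero_mul]; exact continuousAt_const
    · push Not at ht
      have hd := hden z0 (by simp [R]) t ht
      have hd0 : 0 < (t - z0.re) ^ 2 + z0.im ^ 2 := lt_of_lt_of_le (by positivity) hd
      refine continuousAt_const.mul (ContinuousAt.div (by fun_prop) (by fun_prop) hd0.ne')

lemma avg_conj (f : ℂ → ℝ) (c : ℂ) (r : ℝ) :
    circleAverage (fun z => f (conj z)) c r = circleAverage f (conj c) r := by
  rw [circleAverage_def, circleAverage_def]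
  congr 1
  have h : ∀ θ : ℝ, conj (circleMap c r θ) = circleMap (conj c) r (-θ) := by
    intro θ
    simp only [circleMap, map_add, map_mul, conj_ofReal, ← exp_conj, conj_I]
    congr 2; push_cast; ring_nf
  simp only [h]
  rw [intervalIntegral.integral_comp_neg (fun θ => f (circleMap (conj c) r θ))]
  have hp : Function.Periodic (fun θ => f (circleMap (conj c) r θ)) (2 * π) := fun θ => by
    simp only [periodic_circleMap (conj c) r θ]
  have := hp.intervalIntegral_add_eq (-(2*π)) 0
  simpa using this

lemma SubM_conj {w : ℂ → ℝ} {z : ℂ} (h : SubM w z) : SubM (fun z => w (conj z)) (conj z) := by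
  filter_upwards [h] with r hr
  rw [avg_conj]; simpa using hr

structure GW (W : ℂ → ℝ) (Θ : ℂ → ℂ) (A : ℝ) : Prop where
  cont : Continuous W
  nonneg : ∀ z, 0 ≤ W z
  symm : ∀ z, W (conj z) = W z
  gr : ∀ z, W z ≤ A * (1 + ‖z‖)
  diff : DifferentiableOn ℂ Θ {z | 0 < z.im}
  im : ∀ z : ℂ, 0 < z.im → (Θ z).im = W z
  sub : ∀ z, SubM W z

lemma sub_of_real {W : ℂ → ℝ} {Θ : ℂ → ℂ} (symm : ∀ z, W (conj z) = W z)
    (diff : DifferentiableOn ℂ Θ {z | 0 < z.im}) (im : ∀ z : ℂ, 0 < z.im → (Θ z).im = W z)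
    (hr : ∀ x : ℝ, SubM W x) (z : ℂ) : SubM W z := by
  have hp : ∀ z : ℂ, 0 < z.im → SubM W z := by
    intro z hz
    refine SubM_congr ?_ (SubM_im open_hp diff hz)
    filter_upwards [open_hp.mem_nhds hz] with w hw using im w hw
  rcases lt_trichotomy z.im 0 with h1 | h1 | h1
  · have := SubM_conj (hp (conj z) (by simpa using h1))
    simpa [symm] using this
  · have : z = (z.re : ℂ) := by apply Complex.ext <;> simp [h1]
    rw [this]; exact hr _
  · exact hp z h1

lemma logPlus_eq (t : ℝ) : logPlus t = Real.posLog t := by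
  unfold logPlus; rw [posLog_apply, max_comm]

lemma logPlus_cont : Continuous logPlus := by
  have : logPlus = Real.posLog := funext logPlus_eq
  rw [this]; exact continuous_posLog

lemma logPlus_nonneg (t : ℝ) : 0 ≤ logPlus t := le_max_right _ _

lemma v_sub {f : ℂ → ℂ} (hf : Differentiable ℂ f) (z : ℂ) : SubM (fun z => logPlus ‖f z‖) z := by
  by_cases h : 1 < ‖f z‖
  · have hU : IsOpen {w : ℂ | 1 < ‖f w‖} := isOpen_lt continuous_const hf.continuous.norm
    have hh : InnerProductSpace.HarmonicOnNhd (fun z => Real.log ‖f z‖) {w : ℂ | 1 < ‖f w‖} := by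
      intro w hw
      refine AnalyticAt.harmonicAt_log_norm (hf.analyticAt w) ?_
      intro h0
      have hw' : 1 < ‖f w‖ := hw
      rw [h0] at hw'; simp at hw'; linarith
    have : SubM (fun z => Real.log ‖f z‖) z := by
      filter_upwards [ball_ev hU h] with r hr
      rw [InnerProductSpace.HarmonicOnNhd.circleAverage_eq]
      rw [abs_of_pos hr.1]
      exact hh.mono hr.2
    refine SubM_congr ?_ this
    filter_upwards [hU.mem_nhds h] with w hw
    unfold logPlus
    rw [max_eq_left]
    exact Real.log_nonneg (le_of_lt hw)
  · have h0 : logPlus ‖f z‖ = 0 := by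
      unfold logPlus
      exact max_eq_right (Real.log_nonpos (norm_nonneg _) (not_lt.1 h))
    refine Eventually.of_forall fun r => ?_
    simp only [h0]
    exact circleAverage_nonneg_of_nonneg fun _ _ => logPlus_nonneg _

lemma V_ge {f : ℂ → ℂ} (hf : Differentiable ℂ f) {A B : ℝ} (hA : 0 ≤ A)
    (hgr : ∀ z, logPlus ‖f z‖ ≤ A * ‖z‖ + B)
    (hint : Integrable (fun x : ℝ => logPlus ‖f (x : ℂ)‖ / (1 + x ^ 2))) :
    ∀ z : ℂ, 0 ≤ z.im → logPlus ‖f z‖ ≤ A * |z.im| + PV (fun x : ℝ => logPlus ‖f (x : ℂ)‖) z := by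
  set φ : ℝ → ℝ := fun x : ℝ => logPlus ‖f (x : ℂ)‖
  have hφ : Continuous φ := logPlus_cont.comp (hf.continuous.norm.comp continuous_ofReal)
  have hv : Continuous fun z => logPlus ‖f z‖ := logPlus_cont.comp hf.continuous.norm
  have hφ0 : ∀ t, 0 ≤ φ t := fun t => logPlus_nonneg _
  obtain ⟨Θ, hΘ, hΘi⟩ := PV_conj hφ hint
  have hPc := PV_cont hφ hint
  have key := PLc (a := fun z => (A * |z.im| + PV φ z) + - logPlus ‖f z‖) (C := A + |B|) (B := |B|) ?_ ?_ ?_ ?_ ?_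
  · intro z hz; have := key z hz; linarith
  · exact (((continuous_const.mul (continuous_abs.comp continuous_im)).add hPc).add hv.neg).continuousOn
  · intro z hz
    refine SupM_add isOpen_univ (((continuous_const.mul (continuous_abs.comp continuous_im)).add hPc)).continuousOn
      hv.neg.continuousOn (mem_univ _) ?_ (SupM_neg (v_sub hf z))
    have hd : DifferentiableOn ℂ (fun z => A * z + Θ z) {z : ℂ | 0 < z.im} := by fun_prop
    refine SupM_congr ?_ (SupM_im open_hp hd hz)
    filter_upwards [open_hp.mem_nhds hz] with w hw
    simp [hΘi w hw, abs_of_pos (show 0 < w.im from hw)]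
  · intro x; simp [PV_real, φ]
  · intro z hz
    have h1 := hgr z
    have h2 := PV_nonneg hφ0 z
    have h3 : 0 ≤ A * |z.im| := by positivity
    have h4 := mul_nonneg (abs_nonneg B) (norm_nonneg z)
    have := le_abs_self B
    nlinarith
  · intro y hy
    have h1 := hgr (y * I)
    have h2 := PV_nonneg hφ0 (y * I)
    simp [abs_of_nonneg hy] at h1 ⊢
    have := le_abs_self B
    linarith

lemma exists_V {f : ℂ → ℂ} (hf : Differentiable ℂ f)
    (hf_growth : ∃ A B : ℝ, ∀ z : ℂ, Real.log ‖f z‖ ≤ A * ‖z‖ + B)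
    (hint : Integrable (fun x : ℝ => logPlus ‖f (x : ℂ)‖ / (1 + x ^ 2))) :
    ∃ V Θ A, GW V Θ A ∧ ∀ z, logPlus ‖f z‖ ≤ V z := by
  obtain ⟨A, B, hAB⟩ := hf_growth
  have hgr : ∀ z, logPlus ‖f z‖ ≤ |A| * ‖z‖ + |B| := by
    intro z
    refine max_le ((hAB z).trans ?_) (by positivity)
    gcongr <;> exact le_abs_self _
  set φ : ℝ → ℝ := fun x : ℝ => logPlus ‖f (x : ℂ)‖ with hφd
  have hφ : Continuous φ := logPlus_cont.comp (hf.continuous.norm.comp continuous_ofReal)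
  have hv : Continuous fun z => logPlus ‖f z‖ := logPlus_cont.comp hf.continuous.norm
  have hφ0 : ∀ t, 0 ≤ φ t := fun t => logPlus_nonneg _
  obtain ⟨Θ, hΘ, hΘi⟩ := PV_conj hφ hint
  have hPc := PV_cont hφ hint
  obtain ⟨C', hC'⟩ := PV_growth (φ := φ) (C := |A| + |B|) hφ0 (by
    intro t
    refine (hgr t).trans ?_
    rw [norm_real, Real.norm_eq_abs]
    nlinarith [mul_nonneg (abs_nonneg B) (abs_nonneg t), abs_nonneg A]) hint
  have hup := V_ge hf (abs_nonneg A) hgr hint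
  set g : ℂ → ℂ := fun z => conj (f (conj z)) with hg
  have hgd : Differentiable ℂ g := fun z => by
    have := (hf (conj z)).conj_conj
    rw [starRingEnd_self_apply] at this
    exact this
  have hgn : ∀ z, ‖g z‖ = ‖f (conj z)‖ := fun z => by simp [hg]
  have hdn := V_ge hgd (abs_nonneg A) (B := |B|) (fun z => by rw [hgn]; simpa using hgr (conj z)) (by
    simpa [hgn] using hint)
  have hcont : Continuous fun z : ℂ => |A| * |z.im| + PV φ z :=
    ((continuous_const.mul (continuous_abs.comp continuous_im)).add hPc)
  have hge : ∀ z, logPlus ‖f z‖ ≤ |A| * |z.im| + PV φ z := by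
    intro z
    by_cases hz : 0 ≤ z.im
    · exact hup z hz
    · have := hdn (conj z) (by simp; linarith)
      simpa [hgn, PV_symm] using this
  have hsymm : ∀ z : ℂ, |A| * |(conj z).im| + PV φ (conj z) = |A| * |z.im| + PV φ z := fun z => by simp [PV_symm]
  have hd : DifferentiableOn ℂ (fun z => |A| * z + Θ z) {z : ℂ | 0 < z.im} := by fun_prop
  have him : ∀ z : ℂ, 0 < z.im → (|A| * z + Θ z : ℂ).im = |A| * |z.im| + PV φ z := fun z hz => by
    simp [hΘi z hz, abs_of_pos hz]
  refine ⟨fun z => |A| * |z.im| + PV φ z, fun z => |A| * z + Θ z, |A| + C', ⟨hcont, ?_, hsymm, ?_, hd, him, ?_⟩, hge⟩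
  · intro z; have := PV_nonneg hφ0 z; positivity
  · intro z
    have := hC' z
    have h2 := mul_le_mul_of_nonneg_left (abs_im_le_norm z) (abs_nonneg A)
    nlinarith [abs_nonneg A]
  · refine sub_of_real hsymm hd him fun x => ?_
    refine SubM_of_le isOpen_univ hcont.continuousOn hv.continuousOn (mem_univ _) (v_sub hf x) (fun z _ => hge z) ?_
    simp [PV_real, φ]

lemma GW.add {u V : ℂ → ℝ} {Θ Ψ : ℂ → ℂ} {A B : ℝ} (h1 : GW u Θ A) (h2 : GW V Ψ B) :
    GW (fun z => u z + V z) (fun z => Θ z + Ψ z) (A + B) where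
  cont := h1.cont.add h2.cont
  nonneg z := add_nonneg (h1.nonneg z) (h2.nonneg z)
  symm z := by rw [h1.symm, h2.symm]
  gr z := by have := h1.gr z; have := h2.gr z; linarith
  diff := h1.diff.add h2.diff
  im z hz := by simp [h1.im z hz, h2.im z hz]
  sub z := SubM_add isOpen_univ h1.cont.continuousOn h2.cont.continuousOn (mem_univ _) (h1.sub z) (h2.sub z)

lemma harm_iff {h : ℂ → ℝ} {U : Set ℂ} (hU : IsOpen U) :
    HarmonicOn h U ↔ InnerProductSpace.HarmonicOnNhd h U := by
  have key : ∀ z ∈ U, iteratedFDerivWithin ℝ 2 h U z ![1, 1] +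
      iteratedFDerivWithin ℝ 2 h U z ![Complex.I, Complex.I] = Laplacian.laplacian h z := by
    intro z hz
    rw [InnerProductSpace.laplacian_eq_iteratedFDeriv_complexPlane, iteratedFDerivWithin_of_isOpen 2 hU hz]
  constructor
  · rintro ⟨h1, h2⟩ z hz
    refine ⟨h1.contDiffAt (hU.mem_nhds hz), ?_⟩
    filter_upwards [hU.mem_nhds hz] with w hw
    rw [← key w hw, h2 w hw]; rfl
  · intro hh
    refine ⟨fun z hz => (hh z hz).1.contDiffWithinAt, fun z hz => ?_⟩
    rw [key z hz]
    exact (hh z hz).2.eq_of_nhds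

lemma cplx_closed {E : Set ℝ} (hE : IsClosed E) : IsClosed (cplx E) :=
  Complex.isometry_ofReal.isClosedEmbedding.isClosedMap E hE

lemma GWu {E : Set ℝ} (hEcl : IsClosed E)
    {u : ℂ → ℝ} (hu_cont : Continuous u) (hu_zero : ∀ x ∈ E, u (x : ℂ) = 0)
    (hu_pos : ∀ z ∈ (cplx E)ᶜ, 0 < u z)
    (hu_harm : InnerProductSpace.HarmonicOnNhd u (cplx E)ᶜ)
    (hu_symm : ∀ z : ℂ, u (starRingEnd ℂ z) = u z)
    {A : ℝ} (hA : ∀ z : ℂ, u z ≤ A * (1 + ‖z‖)) : ∃ Θ, GW u Θ A := by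
  have hsub : {z : ℂ | 0 < z.im} ⊆ (cplx E)ᶜ := by
    rintro z hz ⟨x, _, rfl⟩
    simp at hz
  have h0 : ∀ z, 0 ≤ u z := by
    intro z
    by_cases hz : z ∈ cplx E
    · obtain ⟨x, hx, rfl⟩ := hz; exact (hu_zero x hx).ge
    · exact (hu_pos z hz).le
  obtain ⟨Θ, h1, h2⟩ := exists_conj (hu_harm.mono hsub)
  refine ⟨Θ, hu_cont, h0, hu_symm, hA, h1, h2, fun z => ?_⟩
  by_cases hz : z ∈ cplx E
  · have : u z = 0 := by obtain ⟨x, hx, rfl⟩ := hz; exact (hu_zero x hx)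
    refine Eventually.of_forall fun r => ?_
    rw [this]
    exact circleAverage_nonneg_of_nonneg fun _ _ => h0 _
  · filter_upwards [ball_ev (cplx_closed hEcl).isOpen_compl hz] with r hr
    rw [InnerProductSpace.HarmonicOnNhd.circleAverage_eq]
    rw [abs_of_pos hr.1]
    exact hu_harm.mono hr.2

lemma avg_add (f : ℂ → ℝ) (c a : ℂ) (r : ℝ) :
    circleAverage (fun z => f (z + a)) c r = circleAverage f (c + a) r := by
  rw [circleAverage_def, circleAverage_def]
  congr 2; ext θ
  simp only [circleMap]; congr 1; ring

lemma SubM_trans {w : ℂ → ℝ} {z a : ℂ} (h : SubM w (z + a)) : SubM (fun z => w (z + a)) z := by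
  filter_upwards [h] with r hr
  rw [avg_add]; exact hr

lemma GW.A_nonneg {W : ℂ → ℝ} {Θ : ℂ → ℂ} {A : ℝ} (h : GW W Θ A) : 0 ≤ A := by
  have := (h.nonneg 0).trans (h.gr 0); simpa using this

lemma GW.imp {W : ℂ → ℝ} {Θ : ℂ → ℂ} {A : ℝ} (h : GW W Θ A) : ∀ z : ℂ, 0 < z.im → 0 ≤ (Θ z).im := by
  intro z hz; rw [h.im z hz]; exact h.nonneg z

theorem GW.mono {W : ℂ → ℝ} {Θ : ℂ → ℂ} {A : ℝ} (h : GW W Θ A) (x : ℝ) {y1 y2 : ℝ} (hy : |y1| ≤ y2) :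
    W (x + y1 * I) ≤ W (x + y2 * I) := by
  have hA := h.A_nonneg
  obtain ⟨s, hs⟩ : ∃ s, s = (y1 + y2) / 2 := ⟨_, rfl⟩
  have hs0 : 0 ≤ s := by have := (abs_le.1 hy).1; rw [hs]; linarith
  rcases hs0.eq_or_lt with h0 | hs0
  · have e : (x + y1 * I : ℂ) = conj (x + y2 * I : ℂ) := by
      have : y1 = - y2 := by linarith
      rw [this]; simp
    rw [e, h.symm]
  have key := PLc (a := fun z => W (z + s * I) + - W (conj z + s * I)) (C := A * (1 + s)) (B := 2 * A * (1 + s))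
    ?_ ?_ ?_ ?_ ?_
  · have h2 := key (x + (y2 - s : ℝ) * I) (by have := le_abs_self y1; simp; linarith)
    have e1 : (x + (y2 - s : ℝ) * I + s * I : ℂ) = x + y2 * I := by push_cast; ring
    have e2 : (conj (x + (y2 - s : ℝ) * I : ℂ) + s * I : ℂ) = x + y1 * I := by
      have : y1 = 2 * s - y2 := by linarith
      rw [this]
      simp only [map_add, map_mul, conj_ofReal, conj_I]; push_cast; ring
    simp only [e1, e2] at h2
    linarith
  · have := h.cont
    exact Continuous.continuousOn (by fun_prop)
  · intro z hz
    have hc := h.cont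
    have hc1 : Continuous fun z : ℂ => W (z + s * I) := by fun_prop
    have hc2 : Continuous fun z : ℂ => - W (conj z + s * I) := by fun_prop
    refine SupM_add isOpen_univ hc1.continuousOn hc2.continuousOn (mem_univ _) ?_ ?_
    · have hd : DifferentiableOn ℂ (fun z => Θ (z + s * I)) {z : ℂ | 0 < z.im} := by
        refine h.diff.comp (by fun_prop) ?_
        intro z hz
        simp at hz ⊢; linarith
      refine SupM_congr ?_ (SupM_im open_hp hd hz)
      filter_upwards [open_hp.mem_nhds hz] with w hw
      refine h.im _ ?_
      simp at hw ⊢; linarith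
    · have h3 : SubM (fun z => W (z + s * I)) (conj z) := SubM_trans (h.sub _)
      have := SupM_neg (SubM_conj h3)
      simpa using this
  · intro x; simp
  · intro z hz
    have h1 := h.nonneg (z + s * I)
    have h2 := h.gr (conj z + s * I)
    have h3 : ‖conj z + s * I‖ ≤ ‖z‖ + s := by
      refine (norm_add_le _ _).trans (by simp [abs_of_pos hs0])
    have h4 : A * (1 + ‖conj z + s * I‖) ≤ A * (1 + s) * (1 + ‖z‖) := by
      rw [mul_assoc]
      refine mul_le_mul_of_nonneg_left ?_ hA
      nlinarith [norm_nonneg z]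
    linarith
  · intro y hy0
    have e1 : (y * I + s * I : ℂ) = (0:ℝ) + (y + s : ℝ) * I := by push_cast; ring
    have e2 : (conj (y * I) + s * I : ℂ) = (0:ℝ) + (s - y : ℝ) * I := by simp; ring
    simp only [e1, e2]
    have h1 := h.nonneg ((0:ℝ) + (y + s : ℝ) * I)
    by_cases hys : y ≤ s
    · have h2 := h.gr ((0:ℝ) + (s - y : ℝ) * I)
      have h3 : ‖((0:ℝ) + (s - y : ℝ) * I : ℂ)‖ ≤ s := by
        rw [ofReal_zero, zero_add, norm_mul, norm_real, norm_I, mul_one, Real.norm_eq_abs, abs_of_nonneg (by linarith)]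
        linarith
      have h4 : A * (1 + ‖((0:ℝ) + (s - y : ℝ) * I : ℂ)‖) ≤ A * (1 + s) := by gcongr
      have : 0 ≤ A * (1 + s) := by positivity
      linarith
    · push Not at hys
      have e3 : ((0:ℝ) + (s - y : ℝ) * I : ℂ) = conj ((0:ℝ) + (y - s : ℝ) * I : ℂ) := by simp; ring
      rw [e3, h.symm]
      have hm := (vert_mono h.diff h.imp 0).1 (show y - s ∈ Ioi 0 by simp; linarith)
        (show y + s ∈ Ioi 0 by simp; linarith) (by linarith)
      simp only at hm
      rw [h.im _ (by simp; linarith), h.im _ (by simp; linarith)] at hm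
      have h2 := h.gr ((0:ℝ) + (y - s : ℝ) * I)
      have h3 : ‖((0:ℝ) + (y - s : ℝ) * I : ℂ)‖ = y - s := by
        rw [ofReal_zero, zero_add, norm_mul, norm_real, norm_I, mul_one, Real.norm_eq_abs, abs_of_nonneg (by linarith)]
      rw [h3] at h2
      set p := W ((0:ℝ) + (y - s : ℝ) * I)
      set q := W ((0:ℝ) + (y + s : ℝ) * I)
      have hp : 0 ≤ p := h.nonneg _
      have hp2 : p * (2 * s) ≤ 2 * A * (1 + s) * (y + s) := by
        have : p * (2 * s) ≤ A * (1 + (y - s)) * (2 * s) := mul_le_mul_of_nonneg_right h2 (by linarith)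
        refine this.trans ?_
        have : (1 + (y - s)) * (2 * s) ≤ 2 * (1 + s) * (y + s) := by nlinarith
        nlinarith
      by_contra hcon
      push Not at hcon
      have : (q + -p) * (y + s) < -(2 * A * (1 + s)) * (y + s) := mul_lt_mul_of_pos_right hcon (by linarith)
      nlinarith

section
variable {W : ℂ → ℝ} {Θ : ℂ → ℂ} {A : ℝ}

lemma eqxy (z : ℂ) : (z.re + z.im * I : ℂ) = z := re_add_im z

lemma GW.deriv_re (h : GW W Θ A) {z : ℂ} (hz : 0 < z.im) : 0 ≤ (deriv Θ z).re := by
  have hd := hd_im (hasDerivAt_vert h.diff z.re hz)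
  rw [eqxy] at hd
  have hm : ∀ᶠ t in 𝓝[>] z.im, 0 ≤ slope (fun t : ℝ => (Θ (z.re + t * I)).im) z.im t := by
    filter_upwards [self_mem_nhdsWithin] with t ht
    have ht : z.im < t := ht
    rw [slope_def_field]
    refine div_nonneg (sub_nonneg.2 ?_) (by linarith)
    rw [h.im _ (by simpa using hz), h.im _ (by simp; linarith)]
    exact h.mono z.re (by rw [abs_of_pos hz]; exact ht.le)
  have h1 := (hasDerivAt_iff_tendsto_slope.1 hd).mono_left (nhdsWithin_mono _ (show Ioi z.im ⊆ {z.im}ᶜ from fun t ht => ne_of_gt ht))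
  have := ge_of_tendsto h1 hm
  simpa using this

lemma GW.tau_mono (h : GW W Θ A) {y : ℝ} (hy : 0 < y) : Monotone fun t : ℝ => (Θ (t + y * I)).re := by
  have hd : ∀ t : ℝ, HasDerivAt (fun t : ℝ => (Θ (t + y * I)).re) (deriv Θ (t + y * I)).re t :=
    fun t => hd_re (hasDerivAt_horiz h.diff t hy)
  refine monotone_of_deriv_nonneg (fun t => (hd t).differentiableAt) fun t => ?_
  rw [(hd t).deriv]
  exact h.deriv_re (by simpa using hy)

lemma GW.cont_on (h : GW W Θ A) : ContinuousOn Θ {z | 0 < z.im} := h.diff.continuousOn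

lemma GW.rect (h : GW W Θ A) (a b : ℝ) {y Y : ℝ} (hy : 0 < y) (hyY : y ≤ Y) :
    (∫ t in a..b, (Θ (t + y * I)).re) = (∫ t in a..b, (Θ (t + Y * I)).re)
      + ((∫ s in y..Y, W (b + s * I)) - ∫ s in y..Y, W (a + s * I)) := by
  have hY : 0 < Y := hy.trans_le hyY
  have hr := Complex.integral_boundary_rect_eq_zero_of_differentiableOn Θ (a + y * I) (b + Y * I) (by
    refine h.diff.mono ?_
    intro z hz
    rw [mem_reProdIm] at hz
    have := hz.2
    simp [uIcc_of_le hyY] at this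
    exact hy.trans_le this.1)
  simp only [add_re, ofReal_re, mul_re, I_re, mul_zero, ofReal_im, I_im, mul_one, sub_self, add_zero,
    add_im, mul_im, zero_add] at hr
  have hh : ∀ v : ℝ, 0 < v → Continuous fun t : ℝ => Θ (t + v * I) := by
    intro v hv
    rw [continuous_iff_continuousAt]
    exact fun t => (hasDerivAt_horiz h.diff t hv).continuousAt
  have hv : ∀ x : ℝ, IntervalIntegrable (fun s : ℝ => Θ (x + s * I)) volume y Y := by
    intro x
    refine ContinuousOn.intervalIntegrable fun s hs => ?_
    rw [uIcc_of_le hyY] at hs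
    exact (hasDerivAt_vert h.diff x (hy.trans_le hs.1)).continuousAt.continuousWithinAt
  have e1 : ∀ v : ℝ, 0 < v → (∫ t in a..b, Θ (t + v * I)).re = ∫ t in a..b, (Θ (t + v * I)).re := by
    intro v hv
    exact (reCLM.intervalIntegral_comp_comm ((hh v hv).intervalIntegrable a b)).symm
  have e2 : ∀ x : ℝ, (∫ s in y..Y, Θ (x + s * I)).im = ∫ s in y..Y, W (x + s * I) := by
    intro x
    rw [← imCLM_apply, ← (imCLM.intervalIntegral_comp_comm (hv x))]
    refine intervalIntegral.integral_congr fun s hs => ?_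
    rw [uIcc_of_le hyY] at hs
    exact h.im _ (by simpa using hy.trans_le hs.1)
  have := congrArg Complex.re hr
  simp only [sub_re, add_re, smul_eq_mul, mul_re, I_re, I_im, zero_mul, one_mul, zero_sub, zero_re] at this
  rw [e1 y hy, e1 Y hY, e2, e2] at this
  linarith

lemma GW.int_le (h : GW W Θ A) {x y Y : ℝ} (hy : 0 < y) (hyY : y ≤ Y) :
    (∫ s in y..Y, W (x + s * I)) ≤ Y * (A * (1 + |x| + Y)) ∧ 0 ≤ ∫ s in y..Y, W (x + s * I) := by
  have hA := h.A_nonneg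
  constructor
  · have hc : Continuous fun s : ℝ => W (x + s * I) := by have := h.cont; fun_prop
    have : (∫ s in y..Y, W (x + s * I)) ≤ ∫ s in y..Y, A * (1 + |x| + Y) := by
      refine intervalIntegral.integral_mono_on hyY (hc.intervalIntegrable _ _) (by simp) fun s hs => ?_
      refine (h.gr _).trans (mul_le_mul_of_nonneg_left ?_ hA)
      have : ‖(x + s * I : ℂ)‖ ≤ |x| + s := by
        refine (norm_add_le _ _).trans ?_
        rw [norm_mul, norm_real, norm_real, norm_I, mul_one, Real.norm_eq_abs, Real.norm_eq_abs, abs_of_pos (hy.trans_le hs.1)]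
      linarith [hs.2]
    rw [intervalIntegral.integral_const, smul_eq_mul] at this
    refine this.trans (mul_le_mul_of_nonneg_right (by linarith) ?_)
    have := abs_nonneg x
    have : 0 ≤ 1 + |x| + Y := by linarith
    positivity
  · exact intervalIntegral.integral_nonneg hyY fun s _ => h.nonneg _

lemma GW.tau_int (h : GW W Θ A) {a b y : ℝ} (hab : a < b) (hy : 0 < y) :
    (b - a) * (Θ (a + y * I)).re ≤ (∫ t in a..b, (Θ (t + y * I)).re) ∧
    (∫ t in a..b, (Θ (t + y * I)).re) ≤ (b - a) * (Θ (b + y * I)).re := by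
  have hm := h.tau_mono hy
  have hi : IntervalIntegrable (fun t : ℝ => (Θ (t + y * I)).re) volume a b := hm.intervalIntegrable
  constructor
  · have : ∫ t in a..b, (Θ (a + y * I)).re ≤ ∫ t in a..b, (Θ (t + y * I)).re :=
      intervalIntegral.integral_mono_on hab.le (by simp) hi fun t ht => hm ht.1
    simpa using this
  · have : ∫ t in a..b, (Θ (t + y * I)).re ≤ ∫ t in a..b, (Θ (b + y * I)).re :=
      intervalIntegral.integral_mono_on hab.le hi (by simp) fun t ht => hm ht.2
    simpa using this

lemma GW.tau_up (h : GW W Θ A) {a b y Y : ℝ} (hab : a < b) (hy : 0 < y) (hyY : y ≤ Y) :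
    (Θ (a + y * I)).re ≤ (Θ (b + Y * I)).re + Y * (A * (1 + |b| + Y)) / (b - a) := by
  have h1 := (h.tau_int hab hy).1
  have h2 := (h.tau_int hab (hy.trans_le hyY)).2
  have h3 := h.rect a b hy hyY
  have h4 := (h.int_le (x := b) hy hyY).1
  have h5 := (h.int_le (x := a) hy hyY).2
  have hba : 0 < b - a := by linarith
  rw [← sub_le_iff_le_add', le_div_iff₀ hba]
  linarith

lemma GW.tau_dn (h : GW W Θ A) {a b y Y : ℝ} (hab : a < b) (hy : 0 < y) (hyY : y ≤ Y) :
    (Θ (a + Y * I)).re - Y * (A * (1 + |a| + Y)) / (b - a) ≤ (Θ (b + y * I)).re := by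
  have h1 := (h.tau_int hab hy).2
  have h2 := (h.tau_int hab (hy.trans_le hyY)).1
  have h3 := h.rect a b hy hyY
  have h4 := (h.int_le (x := a) hy hyY).1
  have h5 := (h.int_le (x := b) hy hyY).2
  have hba : 0 < b - a := by linarith
  rw [sub_le_comm, le_div_iff₀ hba]
  linarith

/-- cone estimate -/
lemma GW.cone (h : GW W Θ A) : ∃ c : ℝ, 0 ≤ c ∧ (∀ z : ℂ, 0 < z.im → c * z.im ≤ W z) ∧
    ∀ κ η : ℝ, 0 < κ → κ ≤ 1 → 0 < η → ∃ R : ℝ, 1 ≤ R ∧ ∀ z : ℂ, κ * ‖z‖ ≤ z.im → R ≤ ‖z‖ → ‖Θ z - c * z‖ ≤ η * ‖z‖ := by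
  set S : Set ℝ := (fun z : ℂ => W z / z.im) '' {z : ℂ | 0 < z.im}
  have hSne : S.Nonempty := ⟨_, I, by simp, rfl⟩
  have hSb : BddBelow S := ⟨0, by rintro _ ⟨z, hz, rfl⟩; exact div_nonneg (h.nonneg z) (le_of_lt hz)⟩
  set c := sInf S
  have hc0 : 0 ≤ c := le_csInf hSne (by rintro _ ⟨z, hz, rfl⟩; exact div_nonneg (h.nonneg z) (le_of_lt hz))
  have hc : ∀ z : ℂ, 0 < z.im → c * z.im ≤ W z := by
    intro z hz
    rw [← le_div_iff₀ hz]
    exact csInf_le hSb ⟨z, hz, rfl⟩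
  refine ⟨c, hc0, hc, ?_⟩
  intro κ η hκ hκ1 hη
  set Q : ℂ → ℂ := fun z => Θ z - c * z with hQdef
  have hQ : DifferentiableOn ℂ Q {z | 0 < z.im} := h.diff.sub (by fun_prop)
  have hQim : ∀ z : ℂ, 0 < z.im → (Q z).im = W z - c * z.im := by
    intro z hz; simp [hQdef, h.im z hz]
  have hQp : ∀ z : ℂ, 0 < z.im → 0 ≤ (Q z).im := by
    intro z hz; rw [hQim z hz]; linarith [hc z hz]
  set ε := η / 2 * κ / Real.exp (3 / κ) with hε
  have hε0 : 0 < ε := by positivity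
  obtain ⟨_, ⟨z0, hz0, rfl⟩, hlt⟩ := exists_lt_of_csInf_lt hSne (show c < c + ε by linarith)
  have hz0 : 0 < z0.im := hz0
  have hder : ∀ z : ℂ, κ * ‖z‖ ≤ z.im → ‖z0‖ ≤ ‖z‖ → 0 < ‖z‖ → ‖deriv Q z‖ ≤ η / 2 := by
    intro z hz hzz hzp
    have hzi : 0 < z.im := lt_of_lt_of_le (by positivity) hz
    refine (schwarz_pick hQ hQp hzi).trans ?_
    have h1 : (Q (z0.re + ‖z‖ * I)).im ≤ ε * ‖z‖ := by
      have := (vert_mono hQ hQp z0.re).2 (show z0.im ∈ Ioi 0 from hz0) (show ‖z‖ ∈ Ioi 0 from hzp)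
        ((le_abs_self _).trans ((abs_im_le_norm z0).trans hzz))
      simp only [eqxy] at this
      rw [← div_le_iff₀ hzp]
      refine this.trans ?_
      rw [hQim z0 hz0, sub_div, mul_div_assoc, div_self hz0.ne']
      linarith
    have h2 := harnack hQ hQp (m := κ * ‖z‖) (by positivity) hz (z0 := z0.re + ‖z‖ * I) (by simp; nlinarith)
    have h3 : ‖z - (z0.re + ‖z‖ * I)‖ / (κ * ‖z‖) ≤ 3 / κ := by
      have : ‖z - (z0.re + ‖z‖ * I)‖ ≤ 3 * ‖z‖ := by
        refine (norm_sub_le _ _).trans ?_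
        have : ‖(z0.re + ‖z‖ * I : ℂ)‖ ≤ |z0.re| + ‖z‖ := (norm_add_le _ _).trans (by simp)
        have := abs_re_le_norm z0
        linarith
      rw [div_le_div_iff₀ (by positivity) hκ]
      nlinarith
    have h4 : (Q z).im ≤ ε * ‖z‖ * Real.exp (3 / κ) :=
      h2.trans (mul_le_mul h1 (Real.exp_le_exp.2 h3) (Real.exp_pos _).le (by positivity))
    have h5 : ε * ‖z‖ * Real.exp (3 / κ) = η / 2 * (κ * ‖z‖) := by
      rw [hε]; field_simp
    rw [div_le_iff₀ hzi]
    calc _ ≤ _ := h4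
      _ = _ := h5
      _ ≤ _ := by gcongr
  set R0 := ‖z0‖ + 1
  have hR0 : 1 ≤ R0 := by have := norm_nonneg z0; simp only [R0]; linarith
  have hK : IsCompact {z : ℂ | κ * ‖z‖ ≤ z.im ∧ ‖z‖ = R0} := by
    refine Metric.isCompact_of_isClosed_isBounded ?_ ?_
    · have i1 : IsClosed {z : ℂ | κ * ‖z‖ ≤ z.im} := isClosed_le (by fun_prop) continuous_im
      have i2 : IsClosed {z : ℂ | ‖z‖ = R0} := isClosed_eq (by fun_prop) continuous_const
      exact i1.inter i2
    · refine (Metric.isBounded_closedBall (x := (0:ℂ)) (r := R0)).subset ?_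
      rintro z ⟨_, hz⟩; simp [hz]
  obtain ⟨M, hM⟩ := hK.exists_bound_of_continuousOn (f := Q) (hQ.continuousOn.mono (by
    rintro z ⟨h1, h2⟩
    rw [h2] at h1
    exact lt_of_lt_of_le (by positivity) h1))
  refine ⟨max R0 (|M| / (η / 2)), hR0.trans (le_max_left _ _), ?_⟩
  intro z hz hzR
  have hz1 : R0 ≤ ‖z‖ := (le_max_left _ _).trans hzR
  have hz2 : |M| / (η / 2) ≤ ‖z‖ := (le_max_right _ _).trans hzR
  have hzp : 0 < ‖z‖ := by linarith
  set z1 : ℂ := (R0 / ‖z‖ : ℝ) * z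
  have hz1n : ‖z1‖ = R0 := by
    simp only [z1, norm_mul, norm_real, Real.norm_eq_abs, abs_of_pos (show 0 < R0 / ‖z‖ by positivity)]
    field_simp
  have hcone : ∀ t : ℝ, 0 ≤ t → κ * ‖(t * z : ℂ)‖ ≤ (t * z : ℂ).im := by
    intro t ht
    rw [norm_mul, norm_real, Real.norm_eq_abs, abs_of_nonneg ht, im_ofReal_mul]
    nlinarith
  have hMz := hM z1 ⟨hcone _ (by positivity), hz1n⟩
  have hseg : ∀ w ∈ segment ℝ z1 z, κ * ‖w‖ ≤ w.im ∧ R0 ≤ ‖w‖ := by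
    rintro w ⟨a, b, ha, hb, hab, rfl⟩
    have e : a • z1 + b • z = ((a * (R0 / ‖z‖) + b : ℝ) : ℂ) * z := by
      simp only [z1, real_smul]; push_cast; ring
    have hpos : 0 ≤ a * (R0 / ‖z‖) + b := by positivity
    rw [e]
    refine ⟨hcone _ hpos, ?_⟩
    rw [norm_mul, norm_real, Real.norm_eq_abs, abs_of_nonneg hpos]
    have : (a * (R0 / ‖z‖) + b) * ‖z‖ = a * R0 + b * ‖z‖ := by field_simp
    rw [this]
    nlinarith
  have hmv := Convex.norm_image_sub_le_of_norm_hasDerivWithin_le (f := Q) (f' := deriv Q) (C := η / 2)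
    (s := segment ℝ z1 z) (x := z1) (y := z) (fun w hw => by
      have hw' := hseg w hw
      have : 0 < w.im := lt_of_lt_of_le (mul_pos hκ (by linarith [hw'.2])) hw'.1
      exact (hQ.differentiableAt (open_hp.mem_nhds this)).hasDerivAt.hasDerivWithinAt)
    (fun w hw => by
      have hw' := hseg w hw
      refine hder w hw'.1 (by simp only [R0] at hw'; linarith [hw'.2]) (by linarith [hw'.2]))
    (convex_segment _ _) (left_mem_segment _ _ _) (right_mem_segment _ _ _)
  have hdist : ‖z - z1‖ ≤ ‖z‖ - R0 := by
    have e : z - z1 = ((1 - R0 / ‖z‖ : ℝ) : ℂ) * z := by simp only [z1]; push_cast; ring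
    have hle : R0 / ‖z‖ ≤ 1 := (div_le_one hzp).2 hz1
    rw [e, norm_mul, norm_real, Real.norm_eq_abs, abs_of_nonneg (by linarith)]
    apply le_of_eq; field_simp
  have h6 : ‖Q z‖ ≤ ‖Q z1‖ + ‖Q z - Q z1‖ := by
    have := norm_add_le (Q z1) (Q z - Q z1); simpa using this
  have h7 : |M| ≤ ‖z‖ * (η / 2) := (div_le_iff₀ (by positivity)).1 hz2
  have h8 := le_abs_self M
  have h9 : η / 2 * ‖z - z1‖ ≤ η / 2 * ‖z‖ := by gcongr; linarith
  change ‖Q z‖ ≤ _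
  linarith

theorem GW.lemT (h : GW W Θ A) : ∃ c : ℝ, 0 ≤ c ∧ (∀ z : ℂ, 0 < z.im → c * z.im ≤ W z) ∧
    (∀ δ : ℝ, 0 < δ → ∃ R : ℝ, 1 ≤ R ∧ ∀ z : ℂ, 0 < z.im → R ≤ ‖z‖ → |(Θ z).re - c * z.re| ≤ δ * ‖z‖) ∧
    Tendsto (fun y : ℝ => W (y * I) / y) atTop (𝓝 c) := by
  obtain ⟨c, hc0, hc, hcone⟩ := h.cone
  have hA := h.A_nonneg
  refine ⟨c, hc0, hc, ?_, ?_⟩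
  · intro δ hδ
    set lam := min 1 (δ / (4 * (c + 1))) with hlam
    have hlam0 : 0 < lam := by positivity
    have hlam1 : lam ≤ 1 := min_le_left _ _
    have hlam2 : c * lam ≤ δ / 4 := by
      have : lam ≤ δ / (4 * (c + 1)) := min_le_right _ _
      rw [le_div_iff₀ (by positivity)] at this
      nlinarith
    set κ := min (1/4) (δ * lam / (64 * (A + 1))) with hκd
    have hκ0 : 0 < κ := by positivity
    have hκ1 : κ ≤ 1 / 4 := min_le_left _ _
    have hκ2 : 16 * κ * A ≤ δ / 4 * lam := by
      have : κ ≤ δ * lam / (64 * (A + 1)) := min_le_right _ _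
      rw [le_div_iff₀ (by positivity)] at this
      nlinarith
    obtain ⟨R, hR1, hR⟩ := hcone κ (δ / 12) hκ0 (by linarith) (by positivity)
    refine ⟨R / (4 * κ), ?_, ?_⟩
    · rw [le_div_iff₀ (by positivity)]; linarith
    intro z hz hzR
    rw [div_le_iff₀ (by positivity)] at hzR
    have hρ1 : 1 ≤ ‖z‖ := by nlinarith
    have habs : ∀ w : ℂ, ‖Θ w - c * w‖ ≤ δ / 12 * ‖w‖ → |(Θ w).re - c * w.re| ≤ δ / 12 * ‖w‖ := by
      intro w hw
      have := abs_re_le_norm (Θ w - c * w)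
      simp only [sub_re, re_ofReal_mul] at this
      exact this.trans hw
    by_cases hin : κ * ‖z‖ ≤ z.im
    · refine (habs z (hR z hin ?_)).trans ?_
      · nlinarith
      · gcongr; linarith
    push Not at hin
    obtain ⟨ρ, hρ⟩ : ∃ ρ, ρ = ‖z‖ := ⟨_, rfl⟩
    have hx : |z.re| ≤ ρ := hρ ▸ abs_re_le_norm z
    rw [← hρ] at hρ1 hin hzR ⊢
    have hlρ : 0 < lam * ρ := by positivity
    have hlρ1 : lam * ρ ≤ ρ := by nlinarith
    have hY : z.im ≤ 4 * κ * ρ := by nlinarith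
    have gen : ∀ x' : ℝ, |x'| ≤ 2 * ρ → |(Θ (x' + (4 * κ * ρ : ℝ) * I)).re - c * x'| ≤ δ / 4 * ρ := by
      intro x' hx'
      have hκρ : 0 ≤ 4 * κ * ρ := by positivity
      have hn : ‖(x' + (4 * κ * ρ : ℝ) * I : ℂ)‖ ≤ 3 * ρ := by
        refine (norm_add_le _ _).trans ?_
        rw [norm_mul, norm_real, norm_real, norm_I, mul_one, Real.norm_eq_abs, Real.norm_eq_abs, abs_of_nonneg hκρ]
        nlinarith
      have hn2 : 4 * κ * ρ ≤ ‖(x' + (4 * κ * ρ : ℝ) * I : ℂ)‖ := by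
        have := (le_abs_self _).trans (abs_im_le_norm (x' + (4 * κ * ρ : ℝ) * I : ℂ))
        simpa using this
      have := habs _ (hR (x' + (4 * κ * ρ : ℝ) * I) (by simp at hn ⊢; nlinarith) (by linarith))
      simp only [add_re, ofReal_re, mul_re, I_re, mul_zero, ofReal_im, I_im, mul_one, sub_self, add_zero] at this
      refine this.trans ?_
      nlinarith
    have hfrac : ∀ x' : ℝ, |x'| ≤ 2 * ρ → 4 * κ * ρ * (A * (1 + |x'| + 4 * κ * ρ)) / (lam * ρ) ≤ δ / 4 * ρ := by
      intro x' hx'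
      rw [div_le_iff₀ hlρ]
      have h1 : 1 + |x'| + 4 * κ * ρ ≤ 4 * ρ := by nlinarith
      have h2 : 4 * κ * ρ * (A * (1 + |x'| + 4 * κ * ρ)) ≤ 4 * κ * ρ * (A * (4 * ρ)) := by gcongr
      have h3 := mul_le_mul_of_nonneg_right hκ2 (show 0 ≤ ρ * ρ by positivity)
      nlinarith
    have hb1 : |z.re + lam * ρ| ≤ 2 * ρ := (abs_add_le _ _).trans (by rw [abs_of_pos hlρ]; linarith)
    have ha1 : |z.re - lam * ρ| ≤ 2 * ρ := (abs_sub _ _).trans (by rw [abs_of_pos hlρ]; linarith)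
    have up := h.tau_up (a := z.re) (b := z.re + lam * ρ) (by linarith) hz hY
    have dn := h.tau_dn (a := z.re - lam * ρ) (b := z.re) (by linarith) hz hY
    rw [eqxy] at up dn
    rw [add_sub_cancel_left] at up
    rw [sub_sub_cancel] at dn
    have g1 := abs_le.1 (gen _ hb1)
    have g2 := abs_le.1 (gen _ ha1)
    have f1 := hfrac _ hb1
    have f2 := hfrac _ ha1
    have := mul_le_mul_of_nonneg_right hlam2 (show 0 ≤ ρ by linarith)
    rw [abs_le]
    constructor
    · nlinarith [g2.1, g2.2]
    · nlinarith [g1.1, g1.2]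
  · rw [Metric.tendsto_atTop]
    intro ε hε
    obtain ⟨R, hR1, hR⟩ := hcone 1 (ε / 2) one_pos le_rfl (by positivity)
    refine ⟨R, fun y hy => ?_⟩
    have hy0 : 0 < y := by linarith
    have hn : ‖(y * I : ℂ)‖ = y := by simp [abs_of_pos hy0]
    have h1 := hR (y * I) (by rw [hn]; simp) (by rw [hn]; exact hy)
    have h2 := (abs_im_le_norm _).trans h1
    rw [sub_im, h.im _ (by simpa using hy0), hn] at h2
    simp only [im_ofReal_mul, I_im, mul_one] at h2
    rw [Real.dist_eq]
    have e : W (y * I) / y - c = (W (y * I) - c * y) / y := by field_simp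
    rw [e, abs_div, abs_of_pos hy0, div_lt_iff₀ hy0]
    nlinarith

theorem GW.theta_bd (h : GW W Θ A) : ∃ C : ℝ, 0 ≤ C ∧ ∀ z : ℂ, 0 < z.im → ‖Θ z‖ ≤ C * (1 + ‖z‖) := by
  obtain ⟨c, hc0, hc, hT, _⟩ := h.lemT
  have hA := h.A_nonneg
  obtain ⟨R, hR1, hR⟩ := hT 1 one_pos
  have key : ∀ z : ℂ, 0 < z.im → |(Θ z).re| ≤ ((c + 1) * 3 + 4 * A) * (R + 1 + ‖z‖) := by
    intro z hz
    set K := R + 1 + ‖z‖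
    have hn0 := norm_nonneg z
    have hK1 : 1 ≤ K := by simp only [K]; linarith
    have hK0 : 0 < K := by linarith
    have hx : |z.re| ≤ K := (abs_re_le_norm z).trans (by simp only [K]; linarith)
    have hy : z.im ≤ K := ((le_abs_self _).trans (abs_im_le_norm z)).trans (by simp only [K]; linarith)
    have gen : ∀ x' : ℝ, |x'| ≤ 2 * K → |(Θ (x' + K * I)).re| ≤ (c + 1) * 3 * K := by
      intro x' hx'
      have hn : ‖(x' + K * I : ℂ)‖ ≤ 3 * K := by
        refine (norm_add_le _ _).trans ?_
        rw [norm_mul, norm_real, norm_real, norm_I, mul_one, Real.norm_eq_abs, Real.norm_eq_abs, abs_of_pos hK0]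
        linarith
      have hn2 : K ≤ ‖(x' + K * I : ℂ)‖ := by
        have := (le_abs_self _).trans (abs_im_le_norm (x' + K * I : ℂ))
        simpa using this
      have := hR (x' + K * I) (by simpa using hK0) (by simp only [K] at *; linarith)
      simp only [add_re, ofReal_re, mul_re, I_re, mul_zero, ofReal_im, I_im, mul_one, sub_self, add_zero, one_mul] at this
      have h2 : |(Θ (x' + K * I)).re| ≤ |(Θ (x' + K * I)).re - c * x'| + |c * x'| := by
        have := abs_add_le ((Θ (x' + K * I)).re - c * x') (c * x'); simpa using this
      rw [abs_mul, abs_of_nonneg hc0] at h2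
      nlinarith [abs_nonneg x']
    have hfrac : ∀ x' : ℝ, |x'| ≤ 2 * K → K * (A * (1 + |x'| + K)) / K ≤ 4 * A * K := by
      intro x' hx'
      rw [mul_div_assoc, mul_div_cancel₀ _ hK0.ne']
      nlinarith
    have hb1 : |z.re + K| ≤ 2 * K := (abs_add_le _ _).trans (by rw [abs_of_pos hK0]; linarith)
    have ha1 : |z.re - K| ≤ 2 * K := (abs_sub _ _).trans (by rw [abs_of_pos hK0]; linarith)
    have up := h.tau_up (a := z.re) (b := z.re + K) (by linarith) hz hy
    have dn := h.tau_dn (a := z.re - K) (b := z.re) (by linarith) hz hy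
    rw [eqxy] at up dn
    rw [add_sub_cancel_left] at up
    rw [sub_sub_cancel] at dn
    have g1 := abs_le.1 (gen _ hb1)
    have g2 := abs_le.1 (gen _ ha1)
    have f1 := hfrac _ hb1
    have f2 := hfrac _ ha1
    rw [abs_le]
    constructor
    · linarith [g2.1, g2.2]
    · linarith [g1.1, g1.2]
  refine ⟨((c + 1) * 3 + 4 * A) * (R + 1) + A, by positivity, fun z hz => ?_⟩
  have h1 := key z hz
  have h2 := h.gr z
  have h3 : ‖Θ z‖ ≤ |(Θ z).re| + |(Θ z).im| := norm_le_abs_re_add_abs_im _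
  rw [h.im z hz, abs_of_nonneg (h.nonneg z)] at h3
  have h4 : ((c + 1) * 3 + 4 * A) * (R + 1 + ‖z‖) ≤ ((c + 1) * 3 + 4 * A) * ((R + 1) * (1 + ‖z‖)) := by
    gcongr
    nlinarith [norm_nonneg z]
  linarith
end

lemma PV_fub {φ : ℝ → ℝ} {M : ℝ} (hφ : Continuous φ) (h0 : ∀ t, 0 ≤ φ t) (hM : ∀ t, φ t ≤ M) (y : ℝ) :
    ∫⁻ x : ℝ, ENNReal.ofReal (PV φ (x + y * I)) = ∫⁻ t : ℝ, ENNReal.ofReal (φ t) := by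
  have h1 : ∀ x : ℝ, ENNReal.ofReal (PV φ (x + y * I)) =
      ∫⁻ s : ℝ, ENNReal.ofReal (φ (x + y * s)) * ENNReal.ofReal (π⁻¹ * (1 + s ^ 2)⁻¹) := by
    intro x
    unfold PV
    rw [← integral_const_mul, ofReal_integral_eq_lintegral_ofReal]
    · congr 1; ext s
      rw [← ENNReal.ofReal_mul (h0 _)]
      simp; congr 1; ring
    · refine Integrable.const_mul ?_ _
      refine (integrable_inv_one_add_sq.const_mul M).mono' ?_ ?_
      · exact Continuous.aestronglyMeasurable ((by fun_prop : Continuous fun s : ℝ => φ ((x + y * I : ℂ).re + (x + y * I : ℂ).im * s)).mul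
          (Continuous.inv₀ (by fun_prop) (fun s => by positivity)))
      · refine Eventually.of_forall fun s => ?_
        rw [Real.norm_eq_abs, abs_of_nonneg (mul_nonneg (h0 _) (by positivity))]
        exact mul_le_mul_of_nonneg_right (hM _) (by positivity)
    · exact Eventually.of_forall fun s => mul_nonneg (by positivity) (mul_nonneg (h0 _) (by positivity))
  simp only [h1]
  rw [lintegral_lintegral_swap]
  · have h2 : ∀ s : ℝ, ∫⁻ x : ℝ, ENNReal.ofReal (φ (x + y * s)) * ENNReal.ofReal (π⁻¹ * (1 + s ^ 2)⁻¹) =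
        (∫⁻ t : ℝ, ENNReal.ofReal (φ t)) * ENNReal.ofReal (π⁻¹ * (1 + s ^ 2)⁻¹) := by
      intro s
      rw [lintegral_mul_const _ (by fun_prop), lintegral_add_right_eq_self (fun x => ENNReal.ofReal (φ x))]
    simp only [h2]
    rw [lintegral_const_mul _ (by fun_prop)]
    have h3 : ∫⁻ s : ℝ, ENNReal.ofReal (π⁻¹ * (1 + s ^ 2)⁻¹) = 1 := by
      rw [← ofReal_integral_eq_lintegral_ofReal (integrable_inv_one_add_sq.const_mul _)
        (Eventually.of_forall fun s => by positivity), integral_const_mul, integral_univ_inv_one_add_sq]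
      simp [Real.pi_ne_zero]
    rw [h3, mul_one]
  · have : Measurable fun p : ℝ × ℝ => ENNReal.ofReal (φ (p.1 + y * p.2)) * ENNReal.ofReal (π⁻¹ * (1 + p.2 ^ 2)⁻¹) := by
      fun_prop
    exact this.aemeasurable

lemma sq_sub {g : ℂ → ℂ} {U : Set ℂ} (hU : IsOpen U) (hg : DifferentiableOn ℂ g U) {z : ℂ} (hz : z ∈ U) :
    SubM (fun z => ‖g z‖ ^ 2) z := by
  filter_upwards [ball_ev hU hz] with r hr
  have h1 := avg_re (hg.pow 2) hr.1 hr.2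
  have h2 : ‖circleAverage (g ^ 2) z r‖ ≤ circleAverage (fun z => ‖g z‖ ^ 2) z r := by
    rw [circleAverage_def, circleAverage_def, norm_smul, smul_eq_mul, Real.norm_eq_abs,
      abs_of_pos (show 0 < (2 * π)⁻¹ by positivity)]
    refine mul_le_mul_of_nonneg_left ?_ (by positivity)
    refine (intervalIntegral.norm_integral_le_integral_norm (by positivity)).trans (le_of_eq ?_)
    simp
  rw [h1] at h2
  simpa using h2

lemma N_le {g : ℂ → ℂ} (hg : DifferentiableOn ℂ g {z | 0 < z.im}) {M : ℝ}
    (hM : ∀ z : ℂ, 1 ≤ z.im → ‖g z‖ ^ 2 ≤ M) (hi : Integrable fun x : ℝ => ‖g (x + 1 * I)‖ ^ 2) {y : ℝ} (hy : 1 ≤ y) :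
    ∫ x : ℝ, ‖g (x + y * I)‖ ^ 2 ≤ ∫ x : ℝ, ‖g (x + 1 * I)‖ ^ 2 := by
  set φ : ℝ → ℝ := fun x => ‖g (x + 1 * I)‖ ^ 2
  have hgc := hg.continuousOn
  have hφ : Continuous φ := by
    refine (Continuous.norm ?_).pow 2
    refine hgc.comp_continuous (by fun_prop) (fun x => by simp)
  have h0 : ∀ t, 0 ≤ φ t := fun t => by positivity
  have hφM : ∀ t, φ t ≤ M := fun t => hM _ (by simp)
  have hint : Integrable (fun t => φ t / (1 + t ^ 2)) := by
    refine hi.mono' (hφ.div (by fun_prop) fun t => by positivity).aestronglyMeasurable (Eventually.of_forall fun t => ?_)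
    rw [Real.norm_eq_abs, abs_of_nonneg (div_nonneg (h0 t) (by positivity))]
    exact div_le_self (h0 t) (by nlinarith [sq_nonneg t])
  obtain ⟨Ψ, hΨ, hΨi⟩ := PV_conj hφ hint
  have key : ∀ z : ℂ, 0 ≤ z.im → ‖g (z + I)‖ ^ 2 ≤ PV φ z := by
    have := PL0 (a := fun z => PV φ z + - ‖g (z + I)‖ ^ 2) (B := M) ?_ ?_ ?_ ?_
    · intro z hz; have := this z hz; linarith
    · refine (PV_cont hφ hint).continuousOn.add (ContinuousOn.neg (ContinuousOn.pow (ContinuousOn.norm ?_) 2))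
      refine hgc.comp (by fun_prop) ?_
      intro z hz; simp at hz ⊢; linarith
    · intro z hz
      have hd : DifferentiableOn ℂ (fun z => g (z + I)) {z : ℂ | 0 < z.im} := by
        refine hg.comp (by fun_prop) ?_
        intro z hz; simp at hz ⊢; linarith
      refine SupM_add open_hp (PV_cont hφ hint).continuousOn ?_ hz ?_ (SupM_neg (sq_sub open_hp hd hz))
      · exact (hd.continuousOn.norm.pow 2).neg
      · refine SupM_congr ?_ (SupM_im open_hp hΨ hz)
        filter_upwards [open_hp.mem_nhds hz] with w hw using hΨi w hw
    · intro x; simp [PV_real, φ]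
    · intro z hz
      have h1 := PV_nonneg h0 z
      have h2 := hM (z + I) (by simpa using hz)
      linarith
  have hle : ∫⁻ x : ℝ, ENNReal.ofReal (‖g (x + y * I)‖ ^ 2) ≤ ENNReal.ofReal (∫ x, φ x) := by
    rw [ofReal_integral_eq_lintegral_ofReal hi (Eventually.of_forall h0), ← PV_fub hφ h0 hφM (y - 1)]
    refine lintegral_mono fun x => ENNReal.ofReal_le_ofReal ?_
    have := key (x + (y - 1 : ℝ) * I) (by simpa using hy)
    have e : (x + (y - 1 : ℝ) * I + I : ℂ) = x + y * I := by push_cast; ring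
    rwa [e] at this
  have hcy : Continuous fun x : ℝ => ‖g (x + y * I)‖ ^ 2 := by
    refine (Continuous.norm ?_).pow 2
    refine hgc.comp_continuous (by fun_prop) (fun x => by simp; linarith)
  rw [integral_eq_lintegral_of_nonneg_ae (Eventually.of_forall fun x => by positivity) hcy.aestronglyMeasurable]
  have := ENNReal.toReal_mono ENNReal.ofReal_ne_top hle
  rwa [ENNReal.toReal_ofReal (integral_nonneg h0)] at this

section
variable {W : ℂ → ℝ} {Θ : ℂ → ℂ} {A : ℝ}

lemma int_of_bdd {p : ℝ → ℝ} (hp : Continuous p) (h0 : ∀ t, 0 ≤ p t) {C : ℝ}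
    (h : ∀ n : ℕ, 0 < n → ∫ t in (-(n:ℝ))..n, p t ≤ C) : Integrable p := by
  refine integrable_of_intervalIntegral_norm_bounded (l := atTop) (a := fun n : ℕ => -(n:ℝ)) (b := fun n : ℕ => (n:ℝ)) C
    (fun n => hp.integrableOn_Ioc) (tendsto_neg_atTop_atBot.comp tendsto_natCast_atTop_atTop) tendsto_natCast_atTop_atTop ?_
  filter_upwards [eventually_gt_atTop 0] with n hn
  refine le_trans (le_of_eq ?_) (h n hn)
  refine intervalIntegral.integral_congr fun t _ => ?_
  simp [abs_of_nonneg (h0 t)]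

lemma GW.int1 (h : GW W Θ A) : Integrable fun t : ℝ => W (t + 1 * I) / (1 + t ^ 2) := by
  have hWc : Continuous fun t : ℝ => W (t + 1 * I) := by have := h.cont; fun_prop
  have hc : Continuous fun t : ℝ => W (t + 1 * I) / (1 + t ^ 2) :=
    hWc.div (by fun_prop) (fun t => by positivity)
  refine int_of_bdd (C := π * W (2 * I)) hc (fun t => div_nonneg (h.nonneg _) (by positivity)) fun n hn => ?_
  set φ : ℝ → ℝ := fun t => W (t + 1 * I) * chi n t
  have hφ : Continuous φ := hWc.mul (chi_cont _)
  obtain ⟨M, hM⟩ := chi_bdd hWc n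
  have h0 : ∀ t, 0 ≤ φ t := fun t => mul_nonneg (h.nonneg _) (chi_nonneg _ _)
  have hφM : ∀ t, φ t ≤ M := fun t => (le_abs_self _).trans (hM t)
  have hint : Integrable (fun t => φ t / (1 + t ^ 2)) := by
    refine (integrable_inv_one_add_sq.const_mul M).mono' (hφ.div (by fun_prop) fun t => by positivity).aestronglyMeasurable
      (Eventually.of_forall fun t => ?_)
    rw [Real.norm_eq_abs, abs_of_nonneg (div_nonneg (h0 t) (by positivity)), div_eq_mul_inv]
    exact mul_le_mul_of_nonneg_right (hφM t) (by positivity)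
  obtain ⟨Ψ, hΨ, hΨi⟩ := PV_conj hφ hint
  have key := PL0 (a := fun z => (W (z + I)) + - PV φ z) (B := M) ?_ ?_ ?_ ?_
  · have k := key I (by simp)
    rw [PV_kernel φ (by simp)] at k
    simp only [I_re, I_im, sub_zero, one_pow] at k
    have e : (I + I : ℂ) = 2 * I := by ring
    rw [e] at k
    have k2 : ∫ t in (-(n:ℝ))..n, W (t + 1 * I) / (1 + t ^ 2) ≤ ∫ t : ℝ, φ t * (1 / (t ^ 2 + 1)) := by
      have hint' : Integrable fun t : ℝ => φ t * (1 / (t ^ 2 + 1)) := by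
        refine hint.congr (Eventually.of_forall fun t => ?_)
        show φ t / (1 + t ^ 2) = φ t * (1 / (t ^ 2 + 1))
        rw [mul_one_div, add_comm]
      rw [intervalIntegral.integral_of_le (by simp)]
      refine le_trans (le_of_eq ?_) (setIntegral_le_integral hint' (Eventually.of_forall fun t => mul_nonneg (h0 t) (by positivity)) (s := Ioc (-(n:ℝ)) n))
      refine setIntegral_congr_fun measurableSet_Ioc fun t ht => ?_
      simp only [φ]
      rw [chi_one (abs_le.2 ⟨ht.1.le, ht.2⟩), mul_one, mul_one_div, add_comm (t ^ 2) 1]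
    have k3 : π⁻¹ * ∫ t : ℝ, φ t * (1 / (t ^ 2 + 1)) ≤ W (2 * I) := by linarith
    rw [inv_mul_le_iff₀ Real.pi_pos] at k3
    linarith
  · have := h.cont
    have := PV_cont hφ hint
    exact Continuous.continuousOn (by fun_prop)
  · intro z hz
    have hd : DifferentiableOn ℂ (fun z => Θ (z + I) - Ψ z) {z : ℂ | 0 < z.im} := by
      refine DifferentiableOn.sub (h.diff.comp (by fun_prop) ?_) hΨ
      intro z hz; simp at hz ⊢; linarith
    refine SupM_congr ?_ (SupM_im open_hp hd hz)
    filter_upwards [open_hp.mem_nhds hz] with w hw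
    have hw : 0 < w.im := hw
    rw [sub_im, h.im _ (by simp; linarith), hΨi w hw]; ring
  · intro x
    rw [PV_real]
    simp only [φ, one_mul]
    have := mul_le_mul_of_nonneg_left (chi_le n x) (h.nonneg (x + I))
    linarith
  · intro z hz
    have h1 := PV_le h0 hφM z
    have h2 := h.nonneg (z + I)
    linarith
end

lemma nsq_ge (x : ℝ) {y : ℝ} (hy : 1 / 2 ≤ y) : (1 + x ^ 2) / 4 ≤ ‖(x + y * I : ℂ)‖ ^ 2 := by
  rw [← Complex.normSq_eq_norm_sq, normSq_apply]
  simp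
  nlinarith [sq_nonneg x]

lemma dN_le {g : ℂ → ℂ} (hg : DifferentiableOn ℂ g {z | 0 < z.im}) {B : ℝ} (hB : 0 ≤ B)
    (hb : ∀ z : ℂ, 1 / 2 ≤ z.im → ‖g z‖ ≤ B / ‖z‖) (hb' : ∀ z : ℂ, 1 / 2 ≤ z.im → ‖deriv g z‖ ≤ B / ‖z‖) :
    Integrable (fun x : ℝ => -2 * (conj (g (x + 1 * I)) * deriv g (x + 1 * I)).im) ∧
    ∫ x : ℝ, -2 * (conj (g (x + 1 * I)) * deriv g (x + 1 * I)).im ≤ 0 := by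
  have hgd : DifferentiableOn ℂ (deriv g) {z | 0 < z.im} := hg.deriv open_hp
  have hc : ∀ y : ℝ, 0 < y → Continuous fun x : ℝ => g (x + y * I) := fun y hy =>
    hg.continuousOn.comp_continuous (by fun_prop) (fun x => by simpa using hy)
  have hc' : ∀ y : ℝ, 0 < y → Continuous fun x : ℝ => deriv g (x + y * I) := fun y hy =>
    hgd.continuousOn.comp_continuous (by fun_prop) (fun x => by simpa using hy)
  have hbq : ∀ (x y : ℝ), 1 / 2 ≤ y → (B / ‖(x + y * I : ℂ)‖) * (B / ‖(x + y * I : ℂ)‖) ≤ 4 * B ^ 2 * (1 + x ^ 2)⁻¹ := by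
    intro x y hy
    have := nsq_ge x hy
    have h2 : 0 < (1 + x ^ 2) / 4 := by positivity
    calc _ = B ^ 2 / ‖(x + y * I : ℂ)‖ ^ 2 := by ring
      _ ≤ B ^ 2 / ((1 + x ^ 2) / 4) := div_le_div_of_nonneg_left (by positivity) h2 this
      _ = _ := by field_simp
  have hint : Integrable fun x : ℝ => ‖g (x + 1 * I)‖ ^ 2 := by
    have h1 := hc 1 one_pos
    simp only [ofReal_one] at h1
    refine (integrable_inv_one_add_sq.const_mul (4 * B ^ 2)).mono' (h1.norm.pow 2).aestronglyMeasurable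
      (Eventually.of_forall fun x => ?_)
    rw [Real.norm_eq_abs, abs_of_nonneg (by positivity), sq]
    have h2 := hbq x 1 (by norm_num)
    have h3 := hb (x + 1 * I) (by simp; norm_num)
    simp only [ofReal_one] at h2
    exact (mul_le_mul h3 h3 (norm_nonneg _) (by positivity)).trans h2
  have hder := hasDerivAt_integral_of_dominated_loc_of_deriv_le (μ := volume) (𝕜 := ℝ) (x₀ := (1:ℝ)) (s := Ioi (1 / 2))
    (F := fun (y x : ℝ) => ‖g (x + (y:ℝ) * I)‖ ^ 2)
    (F' := fun (y x : ℝ) => -2 * (conj (g (x + (y:ℝ) * I)) * deriv g (x + y * I)).im)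
    (bound := fun x : ℝ => 2 * (4 * B ^ 2 * (1 + x ^ 2)⁻¹)) (Ioi_mem_nhds (by norm_num)) ?_ ?_ ?_ ?_ ?_ ?_
  · have e : ((1:ℝ):ℂ) = 1 := ofReal_one
    refine ⟨by simpa only [e] using hder.1, ?_⟩
    have h2 := hder.2
    simp only [e] at h2
    have ht := h2.tendsto_slope
    have ht' := ht.mono_left (nhdsWithin_mono (1:ℝ) (show Ioi (1:ℝ) ⊆ {1}ᶜ from fun t ht => (ne_of_gt ht)))
    refine le_of_tendsto ht' ?_
    filter_upwards [self_mem_nhdsWithin] with y hy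
    have hy : 1 < y := hy
    rw [slope_def_field]
    refine div_nonpos_of_nonpos_of_nonneg ?_ (by linarith)
    have := N_le hg (M := (2 * B) ^ 2) ?_ hint hy.le
    · simp only [e]; linarith
    · intro z hz
      have h1 := hb z (by linarith)
      have h2 : 1 ≤ ‖z‖ := hz.trans ((le_abs_self _).trans (abs_im_le_norm z))
      have h3 : B / ‖z‖ ≤ B := div_le_self hB h2
      have := norm_nonneg (g z)
      gcongr
      linarith
  · filter_upwards [Ioi_mem_nhds (show (0:ℝ) < 1 by norm_num)] with y hy
    exact ((hc y hy).norm.pow 2).aestronglyMeasurable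
  · simpa using hint
  · have h1 := hc 1 one_pos
    have h2 := hc' 1 one_pos
    refine Continuous.aestronglyMeasurable ?_
    refine continuous_const.mul (Complex.continuous_im.comp ((Complex.continuous_conj.comp h1).mul h2))
  · refine Eventually.of_forall fun x y hy => ?_
    have hy : 1 / 2 < y := hy
    rw [norm_mul]
    have h3 := hb (x + y * I) (by simp; linarith)
    have h4 := hb' (x + y * I) (by simp; linarith)
    have h5 := hbq x y hy.le
    have h6 : ‖(conj (g (x + (y:ℝ) * I)) * deriv g (x + y * I)).im‖ ≤ ‖g (x + (y:ℝ) * I)‖ * ‖deriv g (x + y * I)‖ := by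
      refine (abs_im_le_norm _).trans ?_
      rw [norm_mul, RCLike.norm_conj]
    have h7 := mul_le_mul h3 h4 (norm_nonneg _) (by positivity)
    have h8 : ‖(-2:ℝ)‖ = 2 := by norm_num
    rw [h8]
    linarith
  · exact (integrable_inv_one_add_sq.const_mul _).const_mul 2
  · refine Eventually.of_forall fun x y hy => ?_
    have hy : 1 / 2 < y := hy
    have hv := hasDerivAt_vert hg x (show 0 < y by linarith)
    have h1 := ((hd_re hv).pow 2).add ((hd_im hv).pow 2)
    refine (h1.congr_deriv ?_).congr_of_eventuallyEq (Eventually.of_forall fun t => ?_)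
    · simp
      ring
    · simp only [← Complex.normSq_eq_norm_sq, normSq_apply, Pi.add_apply, Pi.pow_apply]
      ring

section
variable {W : ℂ → ℝ} {Θ : ℂ → ℂ} {A : ℝ}

lemma en_b {ε : ℝ} (h0 : 0 < ε) {z : ℂ} (hz : 0 < z.im) :
    1 ≤ ‖1 - ε * I * z‖ ∧ ε * ‖z‖ ≤ ‖1 - ε * I * z‖ := by
  have h1 : (1 - ε * I * z).re = 1 + ε * z.im := by simp
  have h2 : (1 - ε * I * z).im = - (ε * z.re) := by simp
  constructor
  · refine le_trans ?_ ((le_abs_self _).trans (abs_re_le_norm _))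
    rw [h1]; nlinarith
  · rw [← pow_le_pow_iff_left₀ (by positivity) (norm_nonneg _) two_ne_zero]
    rw [mul_pow, ← Complex.normSq_eq_norm_sq, ← Complex.normSq_eq_norm_sq, normSq_apply, normSq_apply, h1, h2]
    nlinarith [mul_pos h0 hz]

lemma en_g (h : GW W Θ A) {C : ℝ} (hC0 : 0 ≤ C) (hC : ∀ z : ℂ, 0 < z.im → ‖Θ z‖ ≤ C * (1 + ‖z‖))
    {ε : ℝ} (h0 : 0 < ε) (h1 : ε ≤ 1) (g : ℂ → ℂ) (hgdef : g = fun z => Θ z * (z * (1 - ε * I * z))⁻¹) :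
    DifferentiableOn ℂ g {z | 0 < z.im} ∧
    (∀ z : ℂ, 0 < z.im → deriv g z = (z * (1 - ε * I * z))⁻¹ * (deriv Θ z + Θ z * (- z⁻¹ + ε * I * (1 - ε * I * z)⁻¹))) ∧
    (∀ z : ℂ, 1 / 2 ≤ z.im → ‖g z‖ ≤ 15 * C / ε / ‖z‖) ∧ (∀ z : ℂ, 1 / 2 ≤ z.im → ‖deriv g z‖ ≤ 15 * C / ε / ‖z‖) := by
  have hz0 : ∀ z : ℂ, 0 < z.im → z ≠ 0 := fun z hz hh => by simp [hh] at hz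
  have hb0 : ∀ z : ℂ, 0 < z.im → (1 - ε * I * z) ≠ 0 := fun z hz hh => by
    have := (en_b h0 hz).1; rw [hh] at this; simp at this; linarith
  have hd : ∀ z : ℂ, 0 < z.im → HasDerivAt g ((z * (1 - ε * I * z))⁻¹ * (deriv Θ z + Θ z * (- z⁻¹ + ε * I * (1 - ε * I * z)⁻¹))) z := by
    intro z hz
    have e1 : HasDerivAt Θ (deriv Θ z) z := (h.diff.differentiableAt (open_hp.mem_nhds hz)).hasDerivAt
    have e2 : HasDerivAt (fun z : ℂ => z * (1 - ε * I * z)) (1 * (1 - ε * I * z) + z * (0 - ε * I * 1)) z :=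
      (hasDerivAt_id z).mul ((hasDerivAt_const z (1:ℂ)).sub ((hasDerivAt_id z).const_mul (ε * I)))
    have e3 := e1.mul (e2.inv (mul_ne_zero (hz0 z hz) (hb0 z hz)))
    rw [hgdef]
    refine HasDerivAt.congr_deriv e3 ?_
    have t1 := hz0 z hz
    have t2 := hb0 z hz
    simp only [Pi.inv_apply]
    generalize (1 - ε * I * z) = b at t2
    field_simp
    ring
  have hs : ∀ z : ℂ, 1 / 2 ≤ z.im → ‖(z * (1 - ε * I * z))⁻¹‖ * (C * (1 + ‖z‖)) ≤ 3 * C / ε / ‖z‖ := by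
    intro z hz
    have hn : 1 / 2 ≤ ‖z‖ := hz.trans ((le_abs_self _).trans (abs_im_le_norm z))
    have hzp : 0 < ‖z‖ := by linarith
    have hb := (en_b h0 (show 0 < z.im by linarith)).2
    rw [norm_inv, norm_mul]
    calc _ ≤ (‖z‖ * (ε * ‖z‖))⁻¹ * (C * (3 * ‖z‖)) := by
          gcongr; linarith
      _ = _ := by field_simp
  refine ⟨fun z hz => (hd z hz).differentiableAt.differentiableWithinAt, fun z hz => (hd z hz).deriv, fun z hz => ?_, fun z hz => ?_⟩
  · have hp : 0 < z.im := by linarith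
    have k := hs z hz
    rw [hgdef]
    show ‖Θ z * (z * (1 - ε * I * z))⁻¹‖ ≤ _
    rw [norm_mul]
    have : ‖Θ z‖ * ‖(z * (1 - ε * I * z))⁻¹‖ ≤ ‖(z * (1 - ε * I * z))⁻¹‖ * (C * (1 + ‖z‖)) := by
      rw [mul_comm]; gcongr; exact hC z hp
    have h3 : 3 * C / ε / ‖z‖ ≤ 15 * C / ε / ‖z‖ := by gcongr; norm_num
    linarith
  · have hp : 0 < z.im := by linarith
    rw [(hd z hp).deriv]
    have hn : 1 / 2 ≤ ‖z‖ := hz.trans ((le_abs_self _).trans (abs_im_le_norm z))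
    have d1 : ‖deriv Θ z‖ ≤ 2 * (C * (1 + ‖z‖)) := by
      refine (schwarz_pick h.diff h.imp hp).trans ?_
      rw [div_le_iff₀ hp]
      have a1 : (Θ z).im ≤ C * (1 + ‖z‖) := ((le_abs_self _).trans (abs_im_le_norm _)).trans (hC z hp)
      have a2 := h.imp z hp
      nlinarith
    have d2 : ‖(- z⁻¹ + ε * I * (1 - ε * I * z)⁻¹)‖ ≤ 3 := by
      refine (norm_add_le _ _).trans ?_
      have b1 : ‖-z⁻¹‖ ≤ 2 := by
        rw [norm_neg, norm_inv, inv_le_comm₀ (by linarith) (by norm_num)]; linarith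
      have b2 : ‖(ε * I * (1 - ε * I * z)⁻¹ : ℂ)‖ ≤ 1 := by
        rw [norm_mul, norm_inv, norm_mul, norm_I, mul_one, norm_real, Real.norm_eq_abs, abs_of_pos h0]
        have := (en_b h0 hp).1
        rw [← div_eq_mul_inv, div_le_one (by linarith)]; linarith
      linarith
    have d3 : ‖deriv Θ z + Θ z * (- z⁻¹ + ε * I * (1 - ε * I * z)⁻¹)‖ ≤ 5 * (C * (1 + ‖z‖)) := by
      refine (norm_add_le _ _).trans ?_
      rw [norm_mul]
      have := mul_le_mul (hC z hp) d2 (norm_nonneg _) (by positivity)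
      linarith
    rw [norm_mul]
    have k := hs z hz
    have := mul_le_mul_of_nonneg_left d3 (norm_nonneg (z * (1 - ε * I * z))⁻¹)
    have e : 15 * C / ε / ‖z‖ = 5 * (3 * C / ε / ‖z‖) := by ring
    rw [e]
    linarith

lemma en_D {θ θ' : ℂ} {ε x : ℝ} (h0 : 0 < ε) (z : ℂ) (hz : z = x + 1 * I) :
    -2 * (conj (θ * (z * (1 - ε * I * z))⁻¹) * ((z * (1 - ε * I * z))⁻¹ * (θ' + θ * (- z⁻¹ + ε * I * (1 - ε * I * z)⁻¹)))).im
    = ((x ^ 2 + 1) * ((1 + ε) ^ 2 + ε ^ 2 * x ^ 2))⁻¹ * (2 * (θ.im * θ'.re - θ.re * θ'.im)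
      - 2 * ‖θ‖ ^ 2 * (1 / (x ^ 2 + 1) + ε * (1 + ε) / ((1 + ε) ^ 2 + ε ^ 2 * x ^ 2))) := by
  set s := (z * (1 - ε * I * z))⁻¹ with hs
  set l := (- z⁻¹ + ε * I * (1 - ε * I * z)⁻¹)
  have n1 : normSq z = x ^ 2 + 1 := by rw [hz, normSq_apply]; simp; ring
  have n2 : normSq (1 - ε * I * z) = (1 + ε) ^ 2 + ε ^ 2 * x ^ 2 := by rw [hz, normSq_apply]; simp; ring
  have n3 : normSq s = ((x ^ 2 + 1) * ((1 + ε) ^ 2 + ε ^ 2 * x ^ 2))⁻¹ := by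
    rw [hs, normSq_inv, normSq_mul, n1, n2]
  have n4 : l.im = 1 / (x ^ 2 + 1) + ε * (1 + ε) / ((1 + ε) ^ 2 + ε ^ 2 * x ^ 2) := by
    simp only [l, add_im, neg_im, inv_im, n1, mul_im, n2, inv_re]
    simp [hz]
    ring
  have e : conj (θ * s) * (s * (θ' + θ * l)) = (normSq s : ℂ) * (conj θ * θ' + (normSq θ : ℂ) * l) := by
    rw [← mul_conj s, ← mul_conj θ, map_mul]; ring
  rw [e, im_ofReal_mul, add_im, im_ofReal_mul, n3, n4, ← Complex.normSq_eq_norm_sq]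
  simp
  ring
end

section
variable {W : ℂ → ℝ} {Θ : ℂ → ℂ} {A : ℝ}

lemma tend_inv : Tendsto (fun x : ℝ => (1 + x ^ 2)⁻¹) atTop (𝓝 0) ∧ Tendsto (fun x : ℝ => (1 + x ^ 2)⁻¹) atBot (𝓝 0) := by
  have h : ∀ l : Filter ℝ, Tendsto (fun x : ℝ => x ^ 2) l atTop → Tendsto (fun x : ℝ => (1 + x ^ 2)⁻¹) l (𝓝 0) :=
    fun l hl => tendsto_inv_atTop_zero.comp (tendsto_atTop_add_const_left _ _ hl)
  exact ⟨h _ (tendsto_pow_atTop two_ne_zero), h _ (by simpa [Function.comp_def] using (tendsto_pow_atTop (α := ℝ) two_ne_zero).comp tendsto_neg_atBot_atTop)⟩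

lemma en_main (h : GW W Θ A) {C : ℝ} (hC0 : 0 ≤ C) (hC : ∀ z : ℂ, 0 < z.im → ‖Θ z‖ ≤ C * (1 + ‖z‖))
    {ε : ℝ} (h0 : 0 < ε) (h1 : ε ≤ 1) :
    Integrable (fun x : ℝ => 4 * (((x ^ 2 + 1) * ((1 + ε) ^ 2 + ε ^ 2 * x ^ 2))⁻¹ * (W (x + 1 * I) * (deriv Θ (x + 1 * I)).re))) ∧
    ∫ x : ℝ, 4 * (((x ^ 2 + 1) * ((1 + ε) ^ 2 + ε ^ 2 * x ^ 2))⁻¹ * (W (x + 1 * I) * (deriv Θ (x + 1 * I)).re)) ≤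
      24 * C ^ 2 * π + 16 * C * ∫ x : ℝ, W (x + 1 * I) / (1 + x ^ 2) := by
  set K : ℝ → ℝ := fun x => ((x ^ 2 + 1) * ((1 + ε) ^ 2 + ε ^ 2 * x ^ 2))⁻¹ with hK
  set K' : ℝ → ℝ := fun x => - (2 * x * ((1 + ε) ^ 2 + ε ^ 2 * x ^ 2) + (x ^ 2 + 1) * (ε ^ 2 * (2 * x))) / ((x ^ 2 + 1) * ((1 + ε) ^ 2 + ε ^ 2 * x ^ 2)) ^ 2 with hK'
  set g : ℂ → ℂ := fun z => Θ z * (z * (1 - ε * I * z))⁻¹ with hg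
  obtain ⟨hgd, hgder, hb, hb'⟩ := en_g h hC0 hC h0 h1 g hg
  obtain ⟨hDi, hD⟩ := dN_le hgd (by positivity) hb hb'
  set D : ℝ → ℝ := fun x => -2 * (conj (g (x + 1 * I)) * deriv g (x + 1 * I)).im with hDdef
  have hpos : ∀ x : ℝ, (0:ℝ) < (x + 1 * I : ℂ).im := fun x => by simp
  have hDe : ∀ x : ℝ, D x = K x * (2 * ((Θ (x + 1 * I)).im * (deriv Θ (x + 1 * I)).re - (Θ (x + 1 * I)).re * (deriv Θ (x + 1 * I)).im)
      - 2 * ‖Θ (x + 1 * I)‖ ^ 2 * (1 / (x ^ 2 + 1) + ε * (1 + ε) / ((1 + ε) ^ 2 + ε ^ 2 * x ^ 2))) := by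
    intro x
    simp only [hDdef, hgder _ (hpos x)]
    exact en_D h0 (x + 1 * I) rfl
  set m : ℝ → ℝ := fun x => K x * ((Θ (x + 1 * I)).re * (Θ (x + 1 * I)).im) with hm
  set m' : ℝ → ℝ := fun x => K' x * ((Θ (x + 1 * I)).re * (Θ (x + 1 * I)).im) +
    K x * ((deriv Θ (x + 1 * I)).re * (Θ (x + 1 * I)).im + (Θ (x + 1 * I)).re * (deriv Θ (x + 1 * I)).im) with hm'
  have hq : ∀ x : ℝ, 0 < (1 + ε) ^ 2 + ε ^ 2 * x ^ 2 := fun x => by positivity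
  have hKd : ∀ x, HasDerivAt K (K' x) x := by
    intro x
    have e1 : HasDerivAt (fun x : ℝ => x ^ 2 + 1) (2 * x) x := by
      simpa using ((hasDerivAt_id x).pow 2).add_const 1
    have e2 : HasDerivAt (fun x : ℝ => (1 + ε) ^ 2 + ε ^ 2 * x ^ 2) (ε ^ 2 * (2 * x)) x := by
      simpa using (((hasDerivAt_id x).pow 2).const_mul (ε ^ 2)).const_add ((1 + ε) ^ 2)
    exact (e1.mul e2).inv (mul_pos (by positivity) (hq x)).ne'
  have hmd : ∀ x, HasDerivAt m (m' x) x := by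
    intro x
    have hh := hasDerivAt_horiz h.diff x one_pos
    simp only [ofReal_one] at hh
    exact (hKd x).mul ((hd_re hh).mul (hd_im hh))
  have hK0 : ∀ x, 0 < K x := fun x => by have := hq x; positivity
  have hK1 : ∀ x, K x * (x ^ 2 + 1) ≤ ε⁻¹ ^ 2 * (1 + x ^ 2)⁻¹ := by
    intro x
    have : K x * (x ^ 2 + 1) = ((1 + ε) ^ 2 + ε ^ 2 * x ^ 2)⁻¹ := by
      have := hq x
      simp only [hK]; field_simp
    rw [this, inv_pow, ← mul_inv]
    refine inv_anti₀ (by positivity) ?_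
    nlinarith
  have hK2 : ∀ x, K x * (x ^ 2 + 1) ≤ 1 ∧ K x * (x ^ 2 + 1) ≤ (1 + (ε * x) ^ 2)⁻¹ := by
    intro x
    have : K x * (x ^ 2 + 1) = ((1 + ε) ^ 2 + ε ^ 2 * x ^ 2)⁻¹ := by
      have := hq x
      simp only [hK]; field_simp
    rw [this]
    have : ((1 + ε) ^ 2 + ε ^ 2 * x ^ 2)⁻¹ ≤ (1 + (ε * x) ^ 2)⁻¹ := inv_anti₀ (by positivity) (by nlinarith)
    refine ⟨this.trans (inv_le_one_of_one_le₀ (by nlinarith [sq_nonneg (ε * x)])), this⟩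
  have hKK : ∀ x, |K' x| ≤ 4 * |x| * K x / (x ^ 2 + 1) := by
    intro x
    have hqx := hq x
    have e : 4 * |x| * K x / (x ^ 2 + 1) = (4 * |x| * ((1 + ε) ^ 2 + ε ^ 2 * x ^ 2)) / ((x ^ 2 + 1) * ((1 + ε) ^ 2 + ε ^ 2 * x ^ 2)) ^ 2 := by
      simp only [hK]; field_simp
    rw [e]
    simp only [hK']
    rw [abs_div, abs_of_nonneg (show 0 ≤ ((x ^ 2 + 1) * ((1 + ε) ^ 2 + ε ^ 2 * x ^ 2)) ^ 2 by positivity), abs_neg]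
    gcongr
    have : 2 * x * ((1 + ε) ^ 2 + ε ^ 2 * x ^ 2) + (x ^ 2 + 1) * (ε ^ 2 * (2 * x)) = x * (2 * ((1 + ε) ^ 2 + ε ^ 2 * x ^ 2) + 2 * ε ^ 2 * (x ^ 2 + 1)) := by ring
    rw [this, abs_mul, abs_of_nonneg (show 0 ≤ (2 * ((1 + ε) ^ 2 + ε ^ 2 * x ^ 2) + 2 * ε ^ 2 * (x ^ 2 + 1)) by positivity)]
    nlinarith [abs_nonneg x, mul_nonneg (abs_nonneg x) (show 0 ≤ (1 + 2 * ε) by positivity)]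
  have hn1 : ∀ x : ℝ, ‖(x + 1 * I : ℂ)‖ ^ 2 = x ^ 2 + 1 := by
    intro x; rw [← Complex.normSq_eq_norm_sq, normSq_apply]; simp; ring
  have hn2 : ∀ x : ℝ, 1 ≤ ‖(x + 1 * I : ℂ)‖ := by
    intro x
    refine le_trans ?_ ((le_abs_self _).trans (abs_im_le_norm _)); simp
  have hT : ∀ x : ℝ, ‖Θ (x + 1 * I)‖ ≤ 2 * C * ‖(x + 1 * I : ℂ)‖ := by
    intro x
    refine (hC _ (hpos x)).trans ?_
    have := hn2 x
    nlinarith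
  have hT2 : ∀ x : ℝ, ‖deriv Θ (x + 1 * I)‖ ≤ 2 * C * ‖(x + 1 * I : ℂ)‖ := by
    intro x
    refine ((schwarz_pick h.diff h.imp (hpos x)).trans ?_).trans (hT x)
    refine le_trans (le_of_eq ?_) ((le_abs_self _).trans (abs_im_le_norm _))
    simp
  have hQ : ∀ (x : ℝ) (a b : ℝ), |a| ≤ 2 * C * ‖(x + 1 * I : ℂ)‖ → |b| ≤ 2 * C * ‖(x + 1 * I : ℂ)‖ → |a * b| ≤ 4 * C ^ 2 * (x ^ 2 + 1) := by
    intro x a b ha hb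
    rw [abs_mul, ← hn1]
    refine (mul_le_mul ha hb (abs_nonneg _) (by positivity)).trans (le_of_eq (by ring))
  have r1 := fun x : ℝ => (abs_re_le_norm _).trans (hT x)
  have r2 := fun x : ℝ => (abs_im_le_norm _).trans (hT x)
  have r3 := fun x : ℝ => (abs_re_le_norm _).trans (hT2 x)
  have r4 := fun x : ℝ => (abs_im_le_norm _).trans (hT2 x)
  have hmb : ∀ x, |m x| ≤ 4 * C ^ 2 * ε⁻¹ ^ 2 * (1 + x ^ 2)⁻¹ := by
    intro x
    simp only [hm]
    rw [abs_mul, abs_of_pos (hK0 x)]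
    have a1 := mul_le_mul_of_nonneg_left (hQ x _ _ (r1 x) (r2 x)) (hK0 x).le
    have a2 := mul_le_mul_of_nonneg_left (hK1 x) (show 0 ≤ 4 * C ^ 2 by positivity)
    nlinarith
  have hmb' : ∀ x, |m' x| ≤ 24 * C ^ 2 * ε⁻¹ ^ 2 * (1 + x ^ 2)⁻¹ := by
    intro x
    have a0 : |K' x| ≤ 4 * K x := by
      refine (hKK x).trans ?_
      rw [div_le_iff₀ (by positivity)]
      have : |x| ≤ x ^ 2 + 1 := by rw [← sq_abs]; nlinarith [sq_nonneg (|x| - 1), abs_nonneg x]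
      nlinarith [hK0 x]
    have a1 : |K' x * ((Θ (x + 1 * I)).re * (Θ (x + 1 * I)).im)| ≤ 4 * K x * (4 * C ^ 2 * (x ^ 2 + 1)) := by
      rw [abs_mul]
      exact mul_le_mul a0 (hQ x _ _ (r1 x) (r2 x)) (abs_nonneg _) (by have := hK0 x; positivity)
    have a2 : |K x * ((deriv Θ (x + 1 * I)).re * (Θ (x + 1 * I)).im + (Θ (x + 1 * I)).re * (deriv Θ (x + 1 * I)).im)| ≤ K x * (8 * C ^ 2 * (x ^ 2 + 1)) := by
      rw [abs_mul, abs_of_pos (hK0 x)]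
      refine mul_le_mul_of_nonneg_left ((abs_add_le _ _).trans ?_) (hK0 x).le
      have := hQ x _ _ (r3 x) (r2 x)
      have := hQ x _ _ (r1 x) (r4 x)
      linarith
    have a3 := mul_le_mul_of_nonneg_left (hK1 x) (show 0 ≤ 24 * C ^ 2 by positivity)
    refine (abs_add_le _ _).trans ?_
    nlinarith
  have hcΘ : Continuous fun x : ℝ => Θ (x + 1 * I) := h.cont_on.comp_continuous (by fun_prop) hpos
  have hcΘ' : Continuous fun x : ℝ => deriv Θ (x + 1 * I) := (h.diff.deriv open_hp).continuousOn.comp_continuous (by fun_prop) hpos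
  have hKc : Continuous K := continuous_iff_continuousAt.2 fun x => (hKd x).continuousAt
  have hKc' : Continuous K' := by
    refine Continuous.div (by fun_prop) (by fun_prop) fun x => ?_
    have := hq x; positivity
  have q1 := Complex.continuous_re.comp hcΘ
  have q2 := Complex.continuous_im.comp hcΘ
  have q3 := Complex.continuous_re.comp hcΘ'
  have q4 := Complex.continuous_im.comp hcΘ'
  simp only [Function.comp_def] at q1 q2 q3 q4
  have hmi : Integrable m' := by
    refine (integrable_inv_one_add_sq.const_mul (24 * C ^ 2 * ε⁻¹ ^ 2)).mono'
      (Continuous.aestronglyMeasurable ((hKc'.mul (q1.mul q2)).add (hKc.mul ((q3.mul q2).add (q1.mul q4))))) (Eventually.of_forall fun x => ?_)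
    exact hmb' x
  have hm0 : ∫ x, m' x = 0 := by
    have tz : ∀ l : Filter ℝ, Tendsto (fun x : ℝ => (1 + x ^ 2)⁻¹) l (𝓝 0) → Tendsto m l (𝓝 0) := by
      intro l hl
      refine squeeze_zero_norm (a := fun x => 4 * C ^ 2 * ε⁻¹ ^ 2 * (1 + x ^ 2)⁻¹) hmb ?_
      have := hl.const_mul (4 * C ^ 2 * ε⁻¹ ^ 2)
      rwa [mul_zero] at this
    have := integral_of_hasDerivAt_of_tendsto hmd hmi (tz _ tend_inv.2) (tz _ tend_inv.1)
    simpa using this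
  set Rb : ℝ → ℝ := fun x => 8 * C ^ 2 * (1 + x ^ 2)⁻¹ + 16 * C ^ 2 * (ε * (1 + (ε * x) ^ 2)⁻¹) + 16 * C * (W (x + 1 * I) / (1 + x ^ 2)) with hRb
  have hi1 : Integrable fun x : ℝ => 8 * C ^ 2 * (1 + x ^ 2)⁻¹ := integrable_inv_one_add_sq.const_mul _
  have hi2 : Integrable fun x : ℝ => 16 * C ^ 2 * (ε * (1 + (ε * x) ^ 2)⁻¹) :=
    ((integrable_inv_one_add_sq.comp_mul_left' h0.ne').const_mul _).const_mul _
  have hi3 : Integrable fun x : ℝ => 16 * C * (W (x + 1 * I) / (1 + x ^ 2)) := h.int1.const_mul _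
  have hle : ∀ x : ℝ, 4 * (K x * (W (x + 1 * I) * (deriv Θ (x + 1 * I)).re)) ≤ D x + 2 * m' x + Rb x := by
    intro x
    have e1 : D x + 2 * m' x = 4 * (K x * (W (x + 1 * I) * (deriv Θ (x + 1 * I)).re))
       - 2 * (K x * ‖Θ (x + 1 * I)‖ ^ 2) * (1 / (x ^ 2 + 1)) - 2 * (K x * ‖Θ (x + 1 * I)‖ ^ 2) * (ε * (1 + ε) / ((1 + ε) ^ 2 + ε ^ 2 * x ^ 2))
       + 2 * (K' x * ((Θ (x + 1 * I)).re * (Θ (x + 1 * I)).im)) := by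
      rw [hDe, ← h.im _ (hpos x)]
      simp only [hm']
      ring
    have b0 : K x * ‖Θ (x + 1 * I)‖ ^ 2 ≤ 4 * C ^ 2 := by
      have : ‖Θ (x + 1 * I)‖ ^ 2 ≤ 4 * C ^ 2 * (x ^ 2 + 1) := by
        rw [← hn1]
        refine (pow_le_pow_left₀ (norm_nonneg _) (hT x) 2).trans (le_of_eq (by ring))
      have a1 := mul_le_mul_of_nonneg_left this (hK0 x).le
      have a2 := mul_le_mul_of_nonneg_left (hK2 x).1 (show 0 ≤ 4 * C ^ 2 by positivity)
      nlinarith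
    have b1 : 2 * (K x * ‖Θ (x + 1 * I)‖ ^ 2) * (1 / (x ^ 2 + 1)) ≤ 8 * C ^ 2 * (1 + x ^ 2)⁻¹ := by
      rw [one_div, add_comm (x ^ 2)]
      exact mul_le_mul_of_nonneg_right (by linarith) (by positivity)
    have b2 : 2 * (K x * ‖Θ (x + 1 * I)‖ ^ 2) * (ε * (1 + ε) / ((1 + ε) ^ 2 + ε ^ 2 * x ^ 2)) ≤ 16 * C ^ 2 * (ε * (1 + (ε * x) ^ 2)⁻¹) := by
      have : ε * (1 + ε) / ((1 + ε) ^ 2 + ε ^ 2 * x ^ 2) ≤ 2 * (ε * (1 + (ε * x) ^ 2)⁻¹) := by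
        rw [div_eq_mul_inv]
        have : ((1 + ε) ^ 2 + ε ^ 2 * x ^ 2)⁻¹ ≤ (1 + (ε * x) ^ 2)⁻¹ := inv_anti₀ (by positivity) (by nlinarith)
        calc _ ≤ ε * 2 * (1 + (ε * x) ^ 2)⁻¹ := mul_le_mul (by nlinarith) this (by positivity) (by positivity)
          _ = _ := by ring
      have t := mul_le_mul (show 2 * (K x * ‖Θ (x + 1 * I)‖ ^ 2) ≤ 8 * C ^ 2 by linarith) this (by have := hq x; positivity) (by positivity)
      linarith
    have b3 : |K' x * ((Θ (x + 1 * I)).re * (Θ (x + 1 * I)).im)| ≤ 8 * C * (W (x + 1 * I) / (1 + x ^ 2)) := by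
      have hW : (Θ (x + 1 * I)).im = W (x + 1 * I) := h.im _ (hpos x)
      have hW0 := h.nonneg (x + 1 * I)
      rw [hW, abs_mul, abs_mul, abs_of_nonneg hW0]
      have hx : |x| ≤ ‖(x + 1 * I : ℂ)‖ := by
        have := abs_re_le_norm (x + 1 * I : ℂ); simpa using this
      have c1 : |x| * |(Θ (x + 1 * I)).re| ≤ 2 * C * (x ^ 2 + 1) := by
        rw [← hn1]
        refine (mul_le_mul hx (r1 x) (abs_nonneg _) (norm_nonneg _)).trans (le_of_eq (by ring))
      calc _ ≤ 4 * |x| * K x / (x ^ 2 + 1) * (|(Θ (x + 1 * I)).re| * W (x + 1 * I)) := by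
            gcongr; exact hKK x
        _ = 4 * (|x| * |(Θ (x + 1 * I)).re|) * (K x * (W (x + 1 * I) / (1 + x ^ 2))) := by rw [add_comm (x ^ 2)]; ring
        _ ≤ 4 * (2 * C * (x ^ 2 + 1)) * (K x * (W (x + 1 * I) / (1 + x ^ 2))) := by
            have := hK0 x
            gcongr
        _ = 8 * C * (W (x + 1 * I) / (1 + x ^ 2)) * (K x * (x ^ 2 + 1)) := by ring
        _ ≤ 8 * C * (W (x + 1 * I) / (1 + x ^ 2)) * 1 := by gcongr; exact (hK2 x).1
        _ = _ := by ring
    rw [e1]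
    simp only [hRb]
    have := neg_abs_le (K' x * ((Θ (x + 1 * I)).re * (Θ (x + 1 * I)).im))
    linarith
  have hRi : Integrable Rb := (hi1.add hi2).add hi3
  have hSi : Integrable (fun x => D x + 2 * m' x + Rb x) := (hDi.add (hmi.const_mul 2)).add hRi
  have hcW : Continuous fun x : ℝ => W (x + 1 * I) := by have := h.cont; fun_prop
  have hres : Integrable (fun x : ℝ => 4 * (K x * (W (x + 1 * I) * (deriv Θ (x + 1 * I)).re))) := by
    refine hSi.mono' (Continuous.aestronglyMeasurable (continuous_const.mul (hKc.mul (hcW.mul q3)))) (Eventually.of_forall fun x => ?_)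
    rw [Real.norm_eq_abs, abs_of_nonneg]
    · exact hle x
    · have := hK0 x
      have := h.nonneg (x + 1 * I)
      have := h.deriv_re (hpos x)
      positivity
  refine ⟨hres, (integral_mono hres hSi hle).trans ?_⟩
  have hj1 : Integrable (fun x => D x + 2 * m' x) := hDi.add (hmi.const_mul 2)
  have hj2 : Integrable (fun x : ℝ => 8 * C ^ 2 * (1 + x ^ 2)⁻¹ + 16 * C ^ 2 * (ε * (1 + (ε * x) ^ 2)⁻¹)) := hi1.add hi2
  rw [integral_add hj1 hRi, integral_add hDi (hmi.const_mul 2), integral_const_mul 2 m', hm0]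
  simp only [hRb]
  rw [integral_add hj2 hi3, integral_add hi1 hi2, integral_const_mul (8 * C ^ 2), integral_const_mul (16 * C ^ 2), integral_const_mul ε, integral_const_mul (16 * C),
    integral_univ_inv_one_add_sq, Measure.integral_comp_mul_left (fun y => (1 + y ^ 2)⁻¹), integral_univ_inv_one_add_sq, abs_of_pos (inv_pos.2 h0), smul_eq_mul]
  have : ε * (ε⁻¹ * π) = π := by field_simp
  rw [this]
  linarith

theorem GW.energy (h : GW W Θ A) : Integrable fun x : ℝ => W (x + 1 * I) * (deriv Θ (x + 1 * I)).re / (1 + x ^ 2) := by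
  obtain ⟨C, hC0, hC⟩ := h.theta_bd
  have hpos : ∀ x : ℝ, (0:ℝ) < (x + 1 * I : ℂ).im := fun x => by simp
  have hcΘ' : Continuous fun x : ℝ => deriv Θ (x + 1 * I) := (h.diff.deriv open_hp).continuousOn.comp_continuous (by fun_prop) hpos
  have hcW : Continuous fun x : ℝ => W (x + 1 * I) := by have := h.cont; fun_prop
  have h0 : ∀ x : ℝ, 0 ≤ W (x + 1 * I) * (deriv Θ (x + 1 * I)).re := fun x => mul_nonneg (h.nonneg _) (h.deriv_re (hpos x))
  have hc : Continuous fun x : ℝ => W (x + 1 * I) * (deriv Θ (x + 1 * I)).re / (1 + x ^ 2) :=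
    (hcW.mul (Complex.continuous_re.comp hcΘ')).div (by fun_prop) (fun x => by positivity)
  refine int_of_bdd (C := 2 * (24 * C ^ 2 * π + 16 * C * ∫ x : ℝ, W (x + 1 * I) / (1 + x ^ 2))) hc (fun x => div_nonneg (h0 x) (by positivity)) fun n hn => ?_
  have hn1 : (1:ℝ) ≤ n := by exact_mod_cast hn
  have hε0 : 0 < (n:ℝ)⁻¹ := by positivity
  have hε1 : (n:ℝ)⁻¹ ≤ 1 := inv_le_one_of_one_le₀ hn1
  obtain ⟨e1, e2⟩ := en_main h hC0 hC hε0 hε1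
  rw [intervalIntegral.integral_of_le (by linarith)]
  refine le_trans ?_ (mul_le_mul_of_nonneg_left e2 (by norm_num))
  rw [← integral_const_mul]
  refine le_trans ?_ (setIntegral_le_integral (e1.const_mul 2) (Eventually.of_forall fun x => ?_) (s := Ioc (-(n:ℝ)) n))
  · refine setIntegral_mono_on hc.integrableOn_Ioc (e1.const_mul 2).integrableOn measurableSet_Ioc fun x hx => ?_
    have hx2 : ((n:ℝ)⁻¹) ^ 2 * x ^ 2 ≤ 1 := by
      have : x ^ 2 ≤ n ^ 2 := sq_le_sq' hx.1.le hx.2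
      rw [inv_pow, inv_mul_le_iff₀ (by positivity)]; linarith
    have hx3 : (1 + x ^ 2)⁻¹ ≤ 8 * ((x ^ 2 + 1) * ((1 + (n:ℝ)⁻¹) ^ 2 + ((n:ℝ)⁻¹) ^ 2 * x ^ 2))⁻¹ := by
      rw [mul_inv, add_comm (x ^ 2)]
      have : 1 ≤ 8 * ((1 + (n:ℝ)⁻¹) ^ 2 + ((n:ℝ)⁻¹) ^ 2 * x ^ 2)⁻¹ := by
        rw [← div_eq_mul_inv, le_div_iff₀ (by positivity)]; nlinarith
      have h2 : 0 ≤ (1 + x ^ 2)⁻¹ := by positivity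
      nlinarith
    rw [div_eq_mul_inv]
    have := mul_le_mul_of_nonneg_left hx3 (h0 x)
    linarith
  · have := h0 x
    show (0:ℝ) ≤ _
    positivity
end

noncomputable def PI (w : ℂ → ℝ) (c : ℂ) (R : ℝ) (z : ℂ) : ℝ := circleAverage (poissonKernel c z • w) c R

lemma PI_an {w : ℂ → ℝ} {c : ℂ} {R : ℝ} (hw : CircleIntegrable w c R) :
    ∃ F : ℂ → ℂ, AnalyticOnNhd ℂ F (ball c R) ∧ ∀ z ∈ ball c R, (F z).re = PI w c R z := by
  have hci : CircleIntegrable (fun ζ => w (ζ + c)) 0 R := by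
    have : ∀ θ, circleMap 0 R θ + c = circleMap c R θ := fun θ => by simp [circleMap, add_comm]
    simpa only [CircleIntegrable, this] using hw
  have hcic : CircleIntegrable (fun ζ => (w (ζ + c) : ℂ)) 0 R :=
    ⟨hci.1.ofReal, hci.2.ofReal⟩
  refine ⟨fun z => circleAverage (fun ζ ↦ herglotzRieszKernel 0 (z - c) ζ • (w (ζ + c) : ℂ)) 0 R, ?_, ?_⟩
  · have h1 := differentiableOn_circleAverage_herglotzRieszKernel_smul hcic
    refine DifferentiableOn.analyticOnNhd (h1.comp (by fun_prop) (t := ball 0 R) (f := fun z => z - c) ?_) isOpen_ball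
    intro z hz
    simpa [mem_ball, Complex.dist_eq] using hz
  · intro z hz
    have hz' : z - c ∈ ball 0 R := by simpa [mem_ball, Complex.dist_eq] using hz
    rw [re_circleAverage_herglotzRieszKernel_smul hci hz', PI, ← circleAverage_map_add_const (c := c)]
    congr 1
    ext ζ
    simp [poissonKernel_eq_re_herglotzRieszKernel, herglotzRieszKernel_add_const]

lemma PI_harm {w : ℂ → ℝ} {c : ℂ} {R : ℝ} (hw : CircleIntegrable w c R) :
    InnerProductSpace.HarmonicOnNhd (PI w c R) (ball c R) := by
  obtain ⟨F, hF, hFe⟩ := PI_an hw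
  intro z hz
  have := (hF z hz).harmonicAt_re
  refine (InnerProductSpace.harmonicAt_congr_nhds ?_).1 this
  filter_upwards [isOpen_ball.mem_nhds hz] with x hx using hFe x hx

lemma pk_cont (c : ℂ) {R : ℝ} {z : ℂ} (hz : z ∈ ball c R) : ContinuousOn (poissonKernel c z) (sphere c R) := by
  unfold poissonKernel
  refine ContinuousOn.div (by fun_prop) (by fun_prop) fun ζ hζ => ?_
  refine pow_ne_zero 2 (norm_ne_zero_iff.2 fun h => ?_)
  have : ζ = z := by linear_combination h
  rw [this] at hζ
  have h1 : dist z c = R := hζ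
  have h2 : dist z c < R := hz
  linarith

lemma pk_nonneg (c : ℂ) {R : ℝ} {z ζ : ℂ} (hz : z ∈ ball c R) (hζ : ζ ∈ sphere c R) : 0 ≤ poissonKernel c z ζ := by
  unfold poissonKernel
  have h1 : ‖ζ - c‖ = R := by rw [← Complex.dist_eq]; exact hζ
  have h2 : ‖z - c‖ < R := by rw [← Complex.dist_eq]; exact hz
  have := norm_nonneg (z - c)
  refine div_nonneg ?_ (by positivity)
  rw [h1]; nlinarith

lemma PI_ci {w : ℂ → ℝ} (hw : Continuous w) (c : ℂ) {R : ℝ} (hR : 0 < R) {z : ℂ} (hz : z ∈ ball c R) :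
    CircleIntegrable (poissonKernel c z • w) c R := ci_of_cont hR.le ((pk_cont c hz).mul hw.continuousOn)

lemma PI_mono {w v : ℂ → ℝ} (hw : Continuous w) (hv : Continuous v) (c : ℂ) {R : ℝ} (hR : 0 < R) {z : ℂ} (hz : z ∈ ball c R)
    (h : ∀ ζ ∈ sphere c R, w ζ ≤ v ζ) : PI w c R z ≤ PI v c R z := by
  refine circleAverage_mono (PI_ci hw c hR hz) (PI_ci hv c hR hz) fun ζ hζ => ?_
  rw [abs_of_pos hR] at hζ
  exact mul_le_mul_of_nonneg_left (h ζ hζ) (pk_nonneg c hz hζ)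

lemma PI_re {F : ℂ → ℂ} (hF : Differentiable ℂ F) (c : ℂ) {R : ℝ} {z : ℂ} (hz : z ∈ ball c R) :
    PI (fun z => (F z).re) c R z = (F z).re := by
  unfold PI
  refine InnerProductSpace.HarmonicOnNhd.circleAverage_poissonKernel_smul ?_ hz
  intro x _
  exact (hF.analyticAt x).harmonicAt_re

lemma PI_center (w : ℂ → ℝ) (c : ℂ) {R : ℝ} (hR : 0 < R) : PI w c R c = circleAverage w c R := by
  unfold PI
  refine circleAverage_congr_sphere fun ζ hζ => ?_
  rw [abs_of_pos hR] at hζ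
  have h1 : ‖ζ - c‖ = R := by rw [← Complex.dist_eq]; exact hζ
  simp [poissonKernel, h1, hR.ne']

lemma PI_bd {w : ℂ → ℝ} (hw : Continuous w) (c : ℂ) {R : ℝ} (hR : 0 < R) {ζ : ℂ} (hζ : ζ ∈ sphere c R) {ε : ℝ} (hε : 0 < ε) :
    ∃ C : ℝ, ∀ z ∈ ball c R, |PI w c R z - w ζ| ≤ ε + C * (2 * R ^ 2 - 2 * (conj (ζ - c) * (z - c)).re) := by
  obtain ⟨δ, hδ, hd⟩ := Metric.continuous_iff.1 hw ζ ε hε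
  obtain ⟨M, hM⟩ := (isCompact_sphere c R).exists_bound_of_continuousOn hw.continuousOn
  have hM0 : 0 ≤ M := (norm_nonneg _).trans (hM ζ hζ)
  have hn : ∀ x ∈ sphere c R, ‖x - c‖ = R := fun x hx => by rw [← Complex.dist_eq]; exact hx
  set C := 2 * M / δ ^ 2
  have hC : 0 ≤ C := by positivity
  have key : ∀ x ∈ sphere c R, |w x - w ζ| ≤ ε + C * (2 * R ^ 2 - 2 * (conj (ζ - c) * (x - c)).re) := by
    intro x hx
    have e : 2 * R ^ 2 - 2 * (conj (ζ - c) * (x - c)).re = ‖x - ζ‖ ^ 2 := by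
      have e1 : ‖x - c‖ ^ 2 = R ^ 2 := by rw [hn x hx]
      have e2 : ‖ζ - c‖ ^ 2 = R ^ 2 := by rw [hn ζ hζ]
      rw [← Complex.normSq_eq_norm_sq, normSq_apply] at e1 e2 ⊢
      simp at e1 e2 ⊢
      linarith
    rw [e]
    by_cases hx2 : dist x ζ < δ
    · have := hd x hx2
      rw [Real.dist_eq] at this
      have : 0 ≤ C * ‖x - ζ‖ ^ 2 := by positivity
      linarith
    · push Not at hx2
      rw [Complex.dist_eq] at hx2
      have h1 : |w x - w ζ| ≤ 2 * M := by
        have a1 := hM x hx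
        have a2 := hM ζ hζ
        have := abs_sub (w x) (w ζ)
        rw [Real.norm_eq_abs] at a1 a2
        linarith
      have h2 : 2 * M ≤ C * ‖x - ζ‖ ^ 2 := by
        have : 2 * M = C * δ ^ 2 := by simp only [C]; field_simp
        rw [this]; gcongr
      linarith
  refine ⟨C, fun z hz => ?_⟩
  have up := PI_mono (v := fun x => (((w ζ + ε + C * (2 * R ^ 2) : ℝ) : ℂ) - (2 * C) * (conj (ζ - c) * (x - c))).re) hw (by fun_prop) c hR hz
    (fun x hx => by
      have := (abs_le.1 (key x hx)).2
      have e : (2 * C * (conj (ζ - c) * (x - c)) : ℂ) = ((2 * C : ℝ) : ℂ) * (conj (ζ - c) * (x - c)) := by push_cast; ring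
      rw [e, sub_re, ofReal_re, re_ofReal_mul]
      linarith)
  have dn := PI_mono (w := fun x => (((w ζ - ε - C * (2 * R ^ 2) : ℝ) : ℂ) + (2 * C) * (conj (ζ - c) * (x - c))).re) (by fun_prop) hw c hR hz
    (fun x hx => by
      have := (abs_le.1 (key x hx)).1
      have e : (2 * C * (conj (ζ - c) * (x - c)) : ℂ) = ((2 * C : ℝ) : ℂ) * (conj (ζ - c) * (x - c)) := by push_cast; ring
      rw [e, add_re, ofReal_re, re_ofReal_mul]
      linarith)
  rw [PI_re (by fun_prop) c hz] at up dn
  have e : (2 * C * (conj (ζ - c) * (z - c)) : ℂ) = ((2 * C : ℝ) : ℂ) * (conj (ζ - c) * (z - c)) := by push_cast; ring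
  rw [e, sub_re, ofReal_re, re_ofReal_mul] at up
  rw [e, add_re, ofReal_re, re_ofReal_mul] at dn
  rw [abs_le]
  constructor <;> linarith

open Classical in
noncomputable def PM (w : ℂ → ℝ) (c : ℂ) (R : ℝ) (z : ℂ) : ℝ := if z ∈ ball c R then PI w c R z else w z

lemma PM_in {w : ℂ → ℝ} {c : ℂ} {R : ℝ} {z : ℂ} (hz : z ∈ ball c R) : PM w c R z = PI w c R z := by simp only [PM, if_pos hz]
lemma PM_out {w : ℂ → ℝ} {c : ℂ} {R : ℝ} {z : ℂ} (hz : z ∉ ball c R) : PM w c R z = w z := by simp only [PM, if_neg hz]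

lemma PM_cont {w : ℂ → ℝ} (hw : Continuous w) (c : ℂ) {R : ℝ} (hR : 0 < R) : Continuous (PM w c R) := by
  rw [continuous_iff_continuousAt]
  intro ζ
  rcases lt_trichotomy (dist ζ c) R with h | h | h
  · have h1 : ContinuousAt (PI w c R) ζ := (PI_harm (ci_of_cont hR.le hw.continuousOn) ζ h).1.continuousAt
    refine h1.congr ?_
    filter_upwards [isOpen_ball.mem_nhds (show ζ ∈ ball c R from h)] with x hx using (PM_in hx).symm
  · rw [Metric.continuousAt_iff]
    intro ε hε
    obtain ⟨C, hC⟩ := PI_bd hw c hR (show ζ ∈ sphere c R from h) (half_pos hε)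
    have hz : ζ ∉ ball c R := by simp [h]
    have hlim : Tendsto (fun z => ε / 2 + C * (2 * R ^ 2 - 2 * (conj (ζ - c) * (z - c)).re)) (𝓝 ζ) (𝓝 (ε / 2)) := by
      have hc : Continuous fun z => ε / 2 + C * (2 * R ^ 2 - 2 * (conj (ζ - c) * (z - c)).re) := by fun_prop
      have := hc.tendsto ζ
      have e : (conj (ζ - c) * (ζ - c)).re = R ^ 2 := by
        have e2 : ‖ζ - c‖ ^ 2 = R ^ 2 := by rw [← Complex.dist_eq, h]
        rw [← Complex.normSq_eq_norm_sq, normSq_apply] at e2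
        simp at e2 ⊢
        linarith
      simp only [e, sub_self, mul_zero, add_zero] at this
      exact this
    have h2 := (hlim.eventually (gt_mem_nhds (half_lt_self hε))).and (Metric.continuousAt_iff'.1 hw.continuousAt ε hε)
    obtain ⟨δ, hδ, hd⟩ := Metric.eventually_nhds_iff.1 h2
    refine ⟨δ, hδ, fun {x} hx => ?_⟩
    have := hd hx
    rw [PM_out hz]
    by_cases hxb : x ∈ ball c R
    · rw [PM_in hxb, Real.dist_eq]
      exact (hC x hxb).trans_lt this.1
    · rw [PM_out hxb]
      exact this.2
  · refine hw.continuousAt.congr ?_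
    have : IsOpen {z : ℂ | R < dist z c} := isOpen_lt continuous_const (by fun_prop)
    filter_upwards [this.mem_nhds h] with x hx
    have hx : R < dist x c := hx
    exact (PM_out (by simp; linarith)).symm

lemma SubM_PI {w : ℂ → ℝ} (hw : Continuous w) (c : ℂ) {R : ℝ} (hR : 0 < R) {z : ℂ} (hz : z ∈ ball c R) :
    SubM (PM w c R) z ∧ SupM (PM w c R) z := by
  obtain ⟨F, hF, hFe⟩ := PI_an (ci_of_cont hR.le hw.continuousOn)
  have h : (fun z => (I * F z).im) =ᶠ[𝓝 z] PM w c R := by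
    filter_upwards [isOpen_ball.mem_nhds hz] with x hx
    rw [PM_in hx, ← hFe x hx]; simp
  have hd : DifferentiableOn ℂ (fun z => I * F z) (ball c R) := hF.differentiableOn.const_mul I
  exact ⟨SubM_congr h (SubM_im isOpen_ball hd hz), SupM_congr h (SupM_im isOpen_ball hd hz)⟩

lemma le_PM {w : ℂ → ℝ} (hw : Continuous w) (c : ℂ) {R : ℝ} (hR : 0 < R) (hs : ∀ z ∈ ball c R, SubM w z) (z : ℂ) :
    w z ≤ PM w c R z := by
  by_cases hz : z ∈ ball c R
  · have hc := PM_cont hw c hR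
    have := min_principle' isOpen_ball isBounded_ball (w := fun z => PM w c R z + - w z) (by fun_prop)
      (fun x hx => SupM_add isOpen_ball hc.continuousOn hw.neg.continuousOn hx (SubM_PI hw c hR hx).2 (SupM_neg (hs x hx)))
      (fun ζ hζ => by
        rw [frontier_ball c hR.ne'] at hζ
        rw [PM_out (by rw [mem_ball, mem_sphere.1 hζ]; simp)]; simp) z hz
    linarith
  · rw [PM_out hz]

lemma le_avg {w : ℂ → ℝ} (hw : Continuous w) {c : ℂ} {R : ℝ} (hR : 0 < R) (hs : ∀ z ∈ ball c R, SubM w z) :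
    w c ≤ circleAverage w c R := by
  have := le_PM hw c hR hs c
  rwa [PM_in (mem_ball_self hR), PI_center w c hR] at this

lemma ge_avg {w : ℂ → ℝ} (hw : Continuous w) {c : ℂ} {R : ℝ} (hR : 0 < R) (hs : ∀ z ∈ ball c R, SupM w z) :
    circleAverage w c R ≤ w c := by
  have := le_avg (w := fun z => - w z) hw.neg hR (fun z hz => SubM_neg (hs z hz))
  have e : circleAverage (fun z => - w z) c R = - circleAverage w c R := by
    simp only [circleAverage, intervalIntegral.integral_neg, smul_neg]
  linarith

lemma PM_sub {w : ℂ → ℝ} (hw : Continuous w) (c : ℂ) {R : ℝ} (hR : 0 < R) (hs : ∀ z ∈ ball c R, SubM w z)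
    {z : ℂ} (hz : SubM w z) : SubM (PM w c R) z := by
  by_cases h : z ∈ ball c R
  · exact (SubM_PI hw c hR h).1
  · exact SubM_of_le isOpen_univ (PM_cont hw c hR).continuousOn hw.continuousOn (mem_univ z) hz
      (fun x _ => le_PM hw c hR hs x) (PM_out h)

noncomputable def GT (Θ : ℂ → ℂ) (α β T : ℝ) (z : ℂ) : ℂ := dslope (fun z => Θ z - (α + β * z)) (T * I) z / (z + T * I)

open Classical in
noncomputable def Ph (u : ℂ → ℝ) (Θ : ℂ → ℂ) (α β T : ℝ) (z : ℂ) : ℝ :=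
  if 0 < z.im then (GT Θ α β T z).im else u z / (z.re ^ 2 + T ^ 2)

section
variable {u : ℂ → ℝ} {Θ : ℂ → ℂ} {A α β T : ℝ}

lemma GT_diff (h : GW u Θ A) (hT : 0 < T) : DifferentiableOn ℂ (GT Θ α β T) {z | 0 < z.im} := by
  have h1 : DifferentiableOn ℂ (fun z => Θ z - (α + β * z)) {z | 0 < z.im} := h.diff.sub (by fun_prop)
  have h2 : DifferentiableOn ℂ (dslope (fun z => Θ z - (α + β * z)) (T * I)) {z | 0 < z.im} :=
    (Complex.differentiableOn_dslope (open_hp.mem_nhds (by simpa using hT))).2 h1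
  refine h2.div (by fun_prop) fun z hz h0 => ?_
  have := congrArg Complex.im h0
  simp at this
  have hz : 0 < z.im := hz
  linarith

lemma GT_eq (hΘ : Θ (T * I) = α + β * (T * I)) {z : ℂ} (h1 : z ≠ T * I) :
    GT Θ α β T z = (Θ z - (α + β * z)) * (z ^ 2 + T ^ 2)⁻¹ := by
  unfold GT
  rw [dslope_of_ne _ h1, slope_def_field, hΘ, sub_self, sub_zero, div_div, div_eq_mul_inv]
  congr 2
  ring_nf
  simp

lemma s_im (z : ℂ) : ((z ^ 2 + (T:ℂ) ^ 2)⁻¹).im = - (2 * z.re * z.im) / normSq (z ^ 2 + (T:ℂ) ^ 2) := by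
  rw [inv_im]
  congr 1
  rw [← ofReal_pow]
  simp [sq]
  ring

lemma s_norm (hT : 1 ≤ T) {z : ℂ} (hz : |z.im| ≤ 1 / 4) : (z.re ^ 2 + 1) / 2 ≤ ‖z ^ 2 + (T:ℂ) ^ 2‖ := by
  refine le_trans ?_ ((le_abs_self _).trans (abs_re_le_norm _))
  rw [← ofReal_pow]
  simp [sq]
  have : z.im ^ 2 ≤ 1 / 16 := by rw [← sq_abs]; nlinarith [abs_nonneg z.im]
  nlinarith [sq_nonneg z.re]

lemma near (h : GW u Θ A) {C : ℝ} (hC0 : 0 ≤ C) (hC : ∀ z : ℂ, 0 < z.im → ‖Θ z‖ ≤ C * (1 + ‖z‖)) (hT : 1 ≤ T)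
    (hΘ : Θ (T * I) = α + β * (T * I)) : ∃ C3 : ℝ, 0 ≤ C3 ∧ ∀ z : ℂ, 0 ≤ z.im → z.im ≤ 1 / 4 →
      |Ph u Θ α β T z - u z * ((z ^ 2 + (T:ℂ) ^ 2)⁻¹).re| ≤ C3 * z.im / (z.re ^ 2 + 1) := by
  refine ⟨2 * |β| + 16 * (2 * C + |α| + |β|), by positivity, fun z hz0 hz1 => ?_⟩
  rcases hz0.eq_or_lt with hz | hz
  · have hz' : ¬ (0 < z.im) := by rw [← hz]; simp
    have e : (z ^ 2 + (T:ℂ) ^ 2) = ((z.re ^ 2 + T ^ 2 : ℝ) : ℂ) := by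
      apply Complex.ext <;> rw [← ofReal_pow] <;> simp [sq, ← hz]
    rw [Ph, if_neg hz', e, ← ofReal_inv, ofReal_re, ← hz, div_eq_mul_inv]
    simp
  · rw [Ph, if_pos hz, GT_eq hΘ]
    swap
    · intro hh
      have := congrArg Complex.im hh
      simp at this
      linarith
    set s := (z ^ 2 + (T:ℂ) ^ 2)⁻¹ with hs
    have hn := s_norm hT (z := z) (by rw [abs_of_pos hz]; exact hz1)
    have hp : 0 < (z.re ^ 2 + 1) / 2 := by positivity
    have hsn : ‖s‖ ≤ 2 / (z.re ^ 2 + 1) := by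
      rw [hs, norm_inv]
      refine (inv_anti₀ hp hn).trans (le_of_eq (by field_simp))
    have hsim : |s.im| ≤ 8 * |z.re| * z.im / (z.re ^ 2 + 1) ^ 2 := by
      rw [hs, s_im, abs_div, abs_neg, abs_mul, abs_mul, abs_of_pos hz, Complex.normSq_eq_norm_sq, abs_of_nonneg (show 0 ≤ ‖z ^ 2 + (T:ℂ) ^ 2‖ ^ 2 by positivity)]
      calc _ ≤ |2| * |z.re| * z.im / ((z.re ^ 2 + 1) / 2) ^ 2 := by gcongr
        _ = _ := by rw [abs_of_pos (by norm_num : (0:ℝ) < 2)]; field_simp; ring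
    have e : ((Θ z - (α + β * z)) * s).im - u z * s.re = - (β * z.im) * s.re + ((Θ z).re - α - β * z.re) * s.im := by
      rw [mul_im, sub_im, sub_re, h.im z hz]
      simp
      ring
    rw [e]
    have hzn : ‖z‖ ≤ |z.re| + 1 := by
      have := norm_le_abs_re_add_abs_im z
      rw [abs_of_pos hz] at this
      linarith
    have k1 : |(Θ z).re - α - β * z.re| ≤ (2 * C + |α| + |β|) * (1 + |z.re|) := by
      have a1 := (abs_re_le_norm (Θ z)).trans (hC z hz)
      have a2 := abs_sub ((Θ z).re - α) (β * z.re)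
      have a3 := abs_sub (Θ z).re α
      rw [abs_mul] at a2
      nlinarith [abs_nonneg α, abs_nonneg β, abs_nonneg z.re, mul_nonneg (abs_nonneg α) (abs_nonneg z.re), mul_nonneg hC0 (abs_nonneg z.re)]
    have k2 : |(β * z.im) * s.re| ≤ |β| * z.im * (2 / (z.re ^ 2 + 1)) := by
      rw [abs_mul, abs_mul, abs_of_pos hz]
      gcongr
      exact (abs_re_le_norm s).trans hsn
    have k3 : |((Θ z).re - α - β * z.re) * s.im| ≤ 16 * (2 * C + |α| + |β|) * z.im / (z.re ^ 2 + 1) := by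
      rw [abs_mul]
      calc _ ≤ ((2 * C + |α| + |β|) * (1 + |z.re|)) * (8 * |z.re| * z.im / (z.re ^ 2 + 1) ^ 2) := by gcongr
        _ = (8 * (2 * C + |α| + |β|) * z.im / (z.re ^ 2 + 1)) * (((1 + |z.re|) * |z.re|) / (z.re ^ 2 + 1)) := by
            field_simp
        _ ≤ (8 * (2 * C + |α| + |β|) * z.im / (z.re ^ 2 + 1)) * 2 := by
            gcongr
            rw [div_le_iff₀ (by positivity), ← sq_abs]
            nlinarith [sq_nonneg (|z.re| - 1)]
        _ = _ := by ring
    refine (abs_add_le _ _).trans ?_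
    rw [neg_mul, abs_neg]
    refine (add_le_add k2 k3).trans (le_of_eq ?_)
    ring

lemma Ph_cont (h : GW u Θ A) {C : ℝ} (hC0 : 0 ≤ C) (hC : ∀ z : ℂ, 0 < z.im → ‖Θ z‖ ≤ C * (1 + ‖z‖)) (hT : 1 ≤ T)
    (hΘ : Θ (T * I) = α + β * (T * I)) : ContinuousOn (Ph u Θ α β T) {z | 0 ≤ z.im} := by
  intro z0 hz0
  have hz0 : 0 ≤ z0.im := hz0
  rcases hz0.eq_or_lt with hz | hz
  · obtain ⟨C3, h3, hn⟩ := near h hC0 hC hT hΘ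
    have hz' : ¬ (0 < z0.im) := by rw [← hz]; simp
    have hne : z0 ^ 2 + (T:ℂ) ^ 2 ≠ 0 := by
      have := s_norm hT (z := z0) (by rw [← hz]; simp)
      intro hh
      rw [hh, norm_zero] at this
      nlinarith [sq_nonneg z0.re]
    have hc1 : ContinuousAt (fun z : ℂ => u z * ((z ^ 2 + (T:ℂ) ^ 2)⁻¹).re) z0 := by
      refine h.cont.continuousAt.mul (Complex.continuous_re.continuousAt.comp ?_)
      exact ContinuousAt.inv₀ (by fun_prop) hne
    have hc2 : Tendsto (fun z : ℂ => Ph u Θ α β T z - u z * ((z ^ 2 + (T:ℂ) ^ 2)⁻¹).re) (𝓝[{z | 0 ≤ z.im}] z0) (𝓝 0) := by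
      have hlim : Tendsto (fun z : ℂ => C3 * z.im / (z.re ^ 2 + 1)) (𝓝[{z | 0 ≤ z.im}] z0) (𝓝 0) := by
        have hcc : Continuous fun z : ℂ => C3 * z.im / (z.re ^ 2 + 1) := by
          refine Continuous.div (by fun_prop) (by fun_prop) fun z => by positivity
        have := hcc.tendsto z0
        rw [← hz] at this
        simp at this
        exact this.mono_left nhdsWithin_le_nhds
      refine squeeze_zero_norm' ?_ hlim
      have ho : IsOpen {z : ℂ | z.im < 1 / 4} := isOpen_lt (by fun_prop) continuous_const
      filter_upwards [self_mem_nhdsWithin, nhdsWithin_le_nhds (ho.mem_nhds (show z0.im < 1 / 4 by rw [← hz]; norm_num))] with z a b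
      have b : z.im < 1 / 4 := b
      exact hn z a b.le
    have hval : Ph u Θ α β T z0 = 0 + u z0 * ((z0 ^ 2 + (T:ℂ) ^ 2)⁻¹).re := by
      have t := hn z0 hz0 (by rw [← hz]; norm_num)
      rw [← hz, mul_zero, zero_div] at t
      have := abs_eq_zero.1 (le_antisymm t (abs_nonneg _))
      linarith
    have := hc2.add (hc1.tendsto.mono_left nhdsWithin_le_nhds)
    rw [← hval] at this
    simpa [ContinuousWithinAt] using this
  · refine ContinuousAt.continuousWithinAt ?_
    have h1 : ContinuousAt (fun z => (GT Θ α β T z).im) z0 :=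
      Complex.continuous_im.continuousAt.comp ((GT_diff h (by linarith)).continuousOn.continuousAt (open_hp.mem_nhds hz))
    refine h1.congr ?_
    filter_upwards [open_hp.mem_nhds hz] with z hz
    exact (if_pos hz).symm

lemma Ph_nonneg (h : GW u Θ A) {C : ℝ} (hC0 : 0 ≤ C) (hC : ∀ z : ℂ, 0 < z.im → ‖Θ z‖ ≤ C * (1 + ‖z‖)) (hT : 1 ≤ T)
    (hΘ : Θ (T * I) = α + β * (T * I)) : ∀ z : ℂ, 0 ≤ z.im → 0 ≤ Ph u Θ α β T z := by
  have hc := Ph_cont h hC0 hC hT hΘ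
  have hcl : IsClosed {z : ℂ | 0 ≤ z.im} := isClosed_le continuous_const (by fun_prop)
  have hcomp : IsCompact (closedBall (0:ℂ) (2 * T) ∩ {z | 0 ≤ z.im}) := (isCompact_closedBall _ _).inter_right hcl
  obtain ⟨M, hM⟩ := hcomp.exists_bound_of_continuousOn (hc.mono inter_subset_right)
  refine PL0 (B := max M (4 * (C + |α| + |β|))) hc ?_ ?_ ?_
  · intro z hz
    refine SupM_congr ?_ (SupM_im open_hp (GT_diff (α := α) (β := β) h (show 0 < T by linarith)) hz)
    filter_upwards [open_hp.mem_nhds hz] with z hz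
    exact (if_pos hz).symm
  · intro x
    rw [Ph, if_neg (by simp)]
    exact div_nonneg (h.nonneg _) (by positivity)
  · intro z hz
    by_cases hz2 : ‖z‖ ≤ 2 * T
    · have := hM z ⟨by simpa using hz2, hz⟩
      have := neg_abs_le (Ph u Θ α β T z)
      rw [Real.norm_eq_abs] at *
      linarith [le_max_left M (4 * (C + |α| + |β|))]
    · push Not at hz2
      rcases hz.eq_or_lt with h0 | h0
      · rw [Ph, if_neg (by rw [← h0]; simp)]
        have : 0 ≤ u z / (z.re ^ 2 + T ^ 2) := div_nonneg (h.nonneg _) (by positivity)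
        have : 0 ≤ max M (4 * (C + |α| + |β|)) := le_max_of_le_right (by positivity)
        linarith
      · rw [Ph, if_pos h0, GT_eq hΘ]
        swap
        · intro hh
          rw [hh] at hz2
          simp [abs_of_pos (show 0 < T by linarith)] at hz2
          linarith
        have h1 : ‖z‖ ^ 2 / 2 ≤ ‖z ^ 2 + (T:ℂ) ^ 2‖ := by
          have := norm_sub_norm_le (z ^ 2) (-(T:ℂ) ^ 2)
          rw [sub_neg_eq_add] at this
          rw [norm_neg, norm_pow, norm_pow, norm_real, Real.norm_eq_abs, sq_abs] at this
          nlinarith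
        have hz1 : 1 ≤ ‖z‖ := by linarith
        have h2 : ‖Θ z - (α + β * z)‖ ≤ 2 * (C + |α| + |β|) * ‖z‖ := by
          have a1 := hC z h0
          have a2 := norm_sub_le (Θ z) (α + β * z)
          have a3 := norm_add_le (α : ℂ) (β * z)
          rw [norm_mul, norm_real, norm_real, Real.norm_eq_abs, Real.norm_eq_abs] at a3
          nlinarith [abs_nonneg α, abs_nonneg β, mul_nonneg (abs_nonneg α) (show 0 ≤ ‖z‖ - 1 by linarith), mul_nonneg hC0 (show 0 ≤ ‖z‖ - 1 by linarith)]
        have h3 : ‖(Θ z - (α + β * z)) * (z ^ 2 + (T:ℂ) ^ 2)⁻¹‖ ≤ 4 * (C + |α| + |β|) := by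
          rw [norm_mul, norm_inv]
          calc _ ≤ (2 * (C + |α| + |β|) * ‖z‖) * (‖z‖ ^ 2 / 2)⁻¹ := by gcongr
            _ = 4 * (C + |α| + |β|) / ‖z‖ := by field_simp; ring
            _ ≤ _ := div_le_self (by positivity) hz1
        have h4 := (abs_im_le_norm _).trans h3
        have := neg_abs_le ((Θ z - (α + β * z)) * (z ^ 2 + (T:ℂ) ^ 2)⁻¹).im
        linarith [le_max_right M (4 * (C + |α| + |β|))]
end

noncomputable def et (z : ℂ) : ℝ := z.im / normSq (z + I)

lemma et_diff_aux {z : ℂ} {r : ℝ} (hp : r < ‖z + I‖) : ∀ w ∈ closedBall z r, w + I ≠ 0 := by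
  intro w hw h0
  rw [mem_closedBall, Complex.dist_eq] at hw
  have : w - z = -(z + I) := by linear_combination h0
  rw [this, norm_neg] at hw
  linarith

lemma et_avg {z : ℂ} {r : ℝ} (hr : 0 < r) (hp : r < ‖z + I‖) : circleAverage et z r ≤ et z - r ^ 2 / ‖z + I‖ ^ 4 := by
  have hne := et_diff_aux hp
  set p := z + I with hpd
  have hq : 0 < ‖p‖ ^ 2 - r ^ 2 := by nlinarith
  have hpn : p ≠ 0 := hne z (mem_closedBall_self hr.le)
  set F : ℂ → ℂ := fun w => I / (w + I) - (2 * p / (w + I) - 1) * ((‖p‖ ^ 2 - r ^ 2)⁻¹ : ℝ) with hF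
  have hd : DifferentiableOn ℂ F (closedBall z r) := by
    have h1 : DifferentiableOn ℂ (fun w : ℂ => w + I) (closedBall z r) := by fun_prop
    exact ((differentiableOn_const _).div h1 hne).sub ((((differentiableOn_const _).div h1 hne).sub_const _).mul_const _)
  have h1 : circleAverage et z r = circleAverage (fun w => (F w).re) z r := by
    apply circleAverage_congr_sphere
    intro w hw
    rw [abs_of_pos hr] at hw
    have hw0 := hne w (sphere_subset_closedBall hw)
    rw [mem_sphere, Complex.dist_eq] at hw
    have hn : normSq (w + I) ≠ 0 := by simpa using hw0
    have hw2 : normSq (w - z) = r ^ 2 := by rw [Complex.normSq_eq_norm_sq, hw]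
    simp only [hF, et, sub_re, mul_re, ofReal_re, ofReal_im, div_re, sub_im]
    rw [← Complex.normSq_eq_norm_sq] at *
    field_simp
    simp [normSq_apply, hpd] at *
    rw [← hw2]
    ring
  rw [h1, avg_re' hd hr subset_rfl]
  have h2 : (F z).re = et z + 1 / ‖p‖ ^ 2 - (‖p‖ ^ 2 - r ^ 2)⁻¹ := by
    have e1 : (2 * p / (z + I) - 1) = 1 := by rw [← hpd]; field_simp; ring
    have hn : normSq p ≠ 0 := by simpa using hpn
    simp only [hF, e1]
    rw [one_mul, sub_re, ofReal_re, div_re, ← Complex.normSq_eq_norm_sq, et, ← hpd]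
    field_simp
    simp [hpd]
  rw [h2]
  have hp0 : 0 < ‖p‖ := norm_pos_iff.2 hpn
  have : 1 / ‖p‖ ^ 2 + r ^ 2 / ‖p‖ ^ 4 ≤ (‖p‖ ^ 2 - r ^ 2)⁻¹ := by
    rw [inv_eq_one_div, le_div_iff₀ hq]
    field_simp
    nlinarith [sq_nonneg (r ^ 2)]
  linarith

lemma et_gap {z : ℂ} (h1 : -(1 / 4) < z.im) (h0 : z.im < 0) : et (conj z) - et z ≤ 3 * (-z.im / (z.re ^ 2 + 1)) := by
  obtain ⟨y, hy⟩ : ∃ y, y = -z.im := ⟨_, rfl⟩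
  have hz : z.im = -y := by linarith
  have hx := sq_nonneg z.re
  have e2 : et (conj z) ≤ y / (z.re ^ 2 + 1) := by
    rw [et, normSq_apply]
    simp only [conj_im, conj_re, add_re, add_im, I_re, I_im, hz, neg_neg]
    rw [hz] at h1 h0
    refine div_le_div_of_nonneg_left (by linarith) (by positivity) (by nlinarith)
  have e3 : - et z ≤ y / ((z.re ^ 2 + 1) / 2) := by
    rw [et, normSq_apply, ← neg_div]
    simp only [add_re, add_im, I_re, I_im, hz, neg_neg]
    rw [hz] at h1 h0
    refine div_le_div_of_nonneg_left (by linarith) (by positivity) (by nlinarith)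
  have e4 : y / ((z.re ^ 2 + 1) / 2) = 2 * (y / (z.re ^ 2 + 1)) := by field_simp
  rw [← hy]
  linarith

lemma et_le {x y : ℝ} (hy : 0 ≤ y) (hy1 : y ≤ 1) : et (x + y * I) ≤ 1 / (x ^ 2 + 1) := by
  have hx := sq_nonneg x
  rw [et, normSq_apply]
  simp
  rw [inv_eq_one_div, div_le_div_iff₀ (by nlinarith) (by positivity)]
  nlinarith [mul_nonneg hx (sub_nonneg.2 hy1)]

lemma et_cont : ContinuousOn et {z | -1 < z.im} := by
  refine ContinuousOn.div (by fun_prop) (by fun_prop) fun z hz h0 => ?_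
  have := congrArg Complex.im (normSq_eq_zero.1 h0)
  simp at this
  have hz : -1 < z.im := hz
  linarith

lemma et_sup {z : ℂ} (hz : -1 < z.im) : SupM et z := by
  have : 0 < ‖z + I‖ := norm_pos_iff.2 fun h0 => by
    have := congrArg Complex.im h0
    simp at this
    linarith
  filter_upwards [Ioo_mem_nhdsGT this] with r hr
  have := et_avg hr.1 hr.2
  have : 0 ≤ r ^ 2 / ‖z + I‖ ^ 4 := by positivity
  linarith

lemma N_lb {c x τ α β T R C : ℝ} (hc : 0 < c) (hR : 1 ≤ R) (hRT : R ≤ T) (hC : 0 ≤ C) (hT : 2 * R * (C * (1 + R)) + 2 * c * R ^ 2 ≤ 0.4 * c * T ^ 2)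
    (hα : |α| ≤ c / 10 * T) (h1 : c ≤ β) (h2 : β ≤ c + c / 10) (h3 : |τ| ≤ C * (1 + |x|))
    (h4 : R ≤ |x| → |τ - c * x| ≤ c / 10 * |x|) : c / 2 * (x ^ 2 + T ^ 2) ≤ β * (x ^ 2 + T ^ 2) + 2 * x * (τ - α - β * x) := by
  have e1 : |2 * x * α| ≤ c / 10 * (x ^ 2 + T ^ 2) := by
    rw [abs_mul, abs_mul, abs_of_pos (by norm_num : (0:ℝ) < 2), ← sq_abs x]
    nlinarith [sq_nonneg (|x| - T), mul_le_mul_of_nonneg_left hα (abs_nonneg x)]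
  have e1 := (abs_le.1 e1).2
  rcases le_or_gt R |x| with hx | hx
  · have e2 : |2 * x * (τ - c * x)| ≤ c / 5 * x ^ 2 := by
      rw [abs_mul, abs_mul, abs_of_pos (by norm_num : (0:ℝ) < 2), ← sq_abs x]
      nlinarith [mul_le_mul_of_nonneg_left (h4 hx) (abs_nonneg x)]
    have e2 := (abs_le.1 e2).1
    nlinarith [mul_nonneg (sub_nonneg.2 h1) (sq_nonneg T), mul_nonneg (sub_nonneg.2 h2) (sq_nonneg x)]
  · have e2 : |2 * x * τ| ≤ 2 * R * (C * (1 + R)) := by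
      rw [abs_mul, abs_mul, abs_of_pos (by norm_num : (0:ℝ) < 2)]
      have : |τ| ≤ C * (1 + R) := h3.trans (by gcongr)
      gcongr
    have e2 := (abs_le.1 e2).1
    have hx2 : x ^ 2 ≤ R ^ 2 := by rw [← sq_abs x]; gcongr
    have hT2 : R ^ 2 ≤ T ^ 2 := by gcongr
    nlinarith [mul_nonneg (sub_nonneg.2 h1) (show 0 ≤ T ^ 2 - x ^ 2 by linarith)]

noncomputable def fold (z : ℂ) : ℂ := z.re + |z.im| * I

noncomputable def Qs (u : ℂ → ℝ) (Θ : ℂ → ℂ) (α β T ε : ℝ) (z : ℂ) : ℝ := Ph u Θ α β T z + ε * et z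

lemma fold_im (z : ℂ) : (fold z).im = |z.im| := by simp [fold]
lemma fold_re (z : ℂ) : (fold z).re = z.re := by simp [fold]
lemma fold_up {z : ℂ} (hz : 0 ≤ z.im) : fold z = z := by rw [fold, abs_of_nonneg hz, eqxy]
lemma fold_conj (z : ℂ) : fold (conj z) = fold z := by simp [fold]
lemma fold_dn {z : ℂ} (hz : z.im ≤ 0) : fold z = conj z := by rw [← fold_conj, fold_up (by simpa using hz)]
lemma fold_cont : Continuous fold := by unfold fold; fun_prop

/-- analytic completion across a gap -/
lemma gap_ext {u : ℂ → ℝ} {Θ : ℂ → ℂ} {A : ℝ} (h : GW u Θ A) {x ρ : ℝ} (hρ : 0 < ρ) (hh : InnerProductSpace.HarmonicOnNhd u (ball (x:ℂ) ρ)) :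
    ∃ Q : ℂ → ℂ, DifferentiableOn ℂ Q (ball (x:ℂ) ρ) ∧ (∀ z ∈ ball (x:ℂ) ρ, (Q z).im = u z) ∧ ∀ z ∈ ball (x:ℂ) ρ, 0 < z.im → Q z = Θ z := by
  obtain ⟨F, hF, he⟩ := hh.exists_analyticOnNhd_ball_re_eq
  set U := ball (x:ℂ) ρ ∩ {z | 0 < z.im} with hU
  have hUo : IsOpen U := isOpen_ball.inter open_hp
  have hUp : IsPreconnected U := ((convex_ball _ _).inter convex_hp).isPreconnected
  have hd : DifferentiableOn ℂ (fun z => Θ z - I * F z) U :=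
    (h.diff.mono inter_subset_right).sub ((differentiableOn_const _).mul (hF.differentiableOn.mono inter_subset_left))
  have him : ∀ z ∈ U, (Θ z - I * F z).im = 0 := fun z hz => by
    have := he hz.1
    simp only at this
    simp [h.im z hz.2, this]
  have hne : (x + (ρ / 2 : ℝ) * I : ℂ) ∈ U := ⟨by simp [abs_of_pos hρ]; linarith, by simpa using hρ⟩
  obtain ⟨w, hw⟩ : ∃ w, ∀ z ∈ U, Θ z - I * F z = w := by
    refine (hd.analyticOnNhd hUo).is_constant_or_isOpen hUp |>.resolve_right fun ho => ?_
    have h1 := ho U subset_rfl hUo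
    obtain ⟨e, he, hb⟩ := Metric.isOpen_iff.1 h1 _ (mem_image_of_mem _ hne)
    have h2 : (Θ (x + (ρ / 2 : ℝ) * I) - I * F (x + (ρ / 2 : ℝ) * I)) + (e / 2 : ℝ) * I ∈ (fun z => Θ z - I * F z) '' U :=
      hb (by rw [mem_ball, dist_self_add_left]; simp [abs_of_pos he]; linarith)
    obtain ⟨z, hz, hz2⟩ := h2
    have h3 := congrArg Complex.im hz2
    simp only at h3
    rw [him z hz, add_im, him _ hne] at h3
    simp at h3
    linarith
  have hw0 : w.im = 0 := by rw [← hw _ hne]; exact him _ hne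
  refine ⟨fun z => I * F z + w, ((differentiableOn_const _).mul hF.differentiableOn).add_const _, fun z hz => ?_, fun z hz h0 => ?_⟩
  · have := he hz
    simp only at this
    simp [this, hw0]
  · rw [← hw z ⟨hz, h0⟩]; ring

section
variable {u : ℂ → ℝ} {Θ : ℂ → ℂ} {A α β T : ℝ}

lemma Qs_cont (h : GW u Θ A) {C : ℝ} (hC0 : 0 ≤ C) (hC : ∀ z : ℂ, 0 < z.im → ‖Θ z‖ ≤ C * (1 + ‖z‖)) (hT : 1 ≤ T)
    (hΘ : Θ (T * I) = α + β * (T * I)) (ε : ℝ) : Continuous fun z => Qs u Θ α β T ε (fold z) := by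
  refine ContinuousOn.comp_continuous (g := Qs u Θ α β T ε) (s := {z : ℂ | 0 ≤ z.im}) ?_ fold_cont fun z => ?_
  · refine (Ph_cont h hC0 hC hT hΘ).add (continuousOn_const.mul (et_cont.mono fun z hz => ?_))
    have hz : 0 ≤ z.im := hz
    show -1 < z.im
    linarith
  · show 0 ≤ (fold z).im
    rw [fold_im]; exact abs_nonneg _

lemma Qs_up (h : GW u Θ A) (hT : 0 < T) {ε : ℝ} (hε : 0 ≤ ε) {z : ℂ} {r : ℝ} (hr : 0 < r) (hz : r < z.im) :
    circleAverage (fun z => Qs u Θ α β T ε (fold z)) z r + ε * (r ^ 2 / ‖z + I‖ ^ 4) ≤ Qs u Θ α β T ε z := by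
  have hz0 : 0 < z.im := hr.trans hz
  have hb : closedBall z r ⊆ {z | 0 < z.im} := fun w hw => by
    rw [mem_closedBall, Complex.dist_eq] at hw
    have := (abs_le.1 ((abs_im_le_norm _).trans hw)).1
    rw [sub_im] at this
    show 0 < w.im
    linarith
  have hp : r < ‖z + I‖ := by
    have := (le_abs_self _).trans (abs_im_le_norm (z + I))
    simp at this
    linarith
  have e1 : circleAverage (fun z => Qs u Θ α β T ε (fold z)) z r = circleAverage (fun w => (GT Θ α β T w).im + ε * et w) z r := by
    apply circleAverage_congr_sphere
    intro w hw
    rw [abs_of_pos hr] at hw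
    have hw : 0 < w.im := hb (sphere_subset_closedBall hw)
    simp only [Qs]
    rw [fold_up hw.le, Ph, if_pos hw]
  have hd := GT_diff (α := α) (β := β) h hT
  have hsub : {z : ℂ | 0 < z.im} ⊆ {z | -1 < z.im} := fun z hz => by
    have hz : 0 < z.im := hz
    show -1 < z.im
    linarith
  have k1 : CircleIntegrable (fun w => (GT Θ α β T w).im) z r := ci_of_contBall hr.le (Complex.continuous_im.comp_continuousOn hd.continuousOn) hb
  have k2 : CircleIntegrable (fun w => ε * et w) z r := ci_of_contBall hr.le (continuousOn_const.mul (et_cont.mono hsub)) hb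
  rw [e1, circleAverage_fun_add k1 k2, avg_im' hd hr hb, Qs, Ph, if_pos hz0]
  have e2 : circleAverage (fun w => ε * et w) z r = ε * circleAverage et z r := circleAverage_fun_smul (a := ε) (f := et)
  rw [e2]
  nlinarith [mul_le_mul_of_nonneg_left (et_avg hr hp) hε]

lemma fold_bd (g : ℂ → ℝ) (z : ℂ) (r : ℝ) : circleAverage (fun z => g (fold z)) (conj z) r = circleAverage (fun z => g (fold z)) z r := by
  rw [← avg_conj]
  simp_rw [fold_conj]

lemma Qs_all (h : GW u Θ A) (hT : 0 < T) {ε : ℝ} (hε : 0 ≤ ε) {z : ℂ} {r : ℝ} (hr : 0 < r) (hz : r < |z.im|) :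
    circleAverage (fun z => Qs u Θ α β T ε (fold z)) z r + ε * (r ^ 2 / ‖fold z + I‖ ^ 4) ≤ Qs u Θ α β T ε (fold z) := by
  rcases le_or_gt 0 z.im with h0 | h0
  · rw [abs_of_nonneg h0] at hz
    rw [fold_up h0]
    exact Qs_up h hT hε hr hz
  · rw [abs_of_neg h0] at hz
    rw [← fold_bd, fold_dn h0.le]
    exact Qs_up h hT hε hr (by simpa using hz)

set_option maxHeartbeats 800000 in
lemma Qs_gap (h : GW u Θ A) {C c R x ρ ε : ℝ} (hC0 : 0 ≤ C) (hC : ∀ z : ℂ, 0 < z.im → ‖Θ z‖ ≤ C * (1 + ‖z‖))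
    (hΘ : Θ (T * I) = α + β * (T * I)) (hρ : 0 < ρ) (hh : InnerProductSpace.HarmonicOnNhd u (ball (x:ℂ) ρ))
    (hc : 0 < c) (hR : 1 ≤ R) (hRT : R ≤ T) (hT : 2 * R * (C * (1 + R)) + 2 * c * R ^ 2 ≤ 0.4 * c * T ^ 2)
    (hα : |α| ≤ c / 10 * T) (h1 : c ≤ β) (h2 : β ≤ c + c / 10)
    (h4 : ∀ z : ℂ, 0 < z.im → R ≤ ‖z‖ → |(Θ z).re - c * z.re| ≤ c / 10 * ‖z‖) (hε : ε = c / (4 * T ^ 2)) :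
    SupM (fun z => Qs u Θ α β T ε (fold z)) x := by
  have hT1 : 1 ≤ T := hR.trans hRT
  have hε0 : 0 < ε := by rw [hε]; positivity
  obtain ⟨Q, hQ, hQu, hQΘ⟩ := gap_ext h hρ hh
  set B := ball (x:ℂ) (min ρ (1 / 4)) with hB
  have hBo : IsOpen B := isOpen_ball
  have hxB : (x:ℂ) ∈ B := mem_ball_self (by positivity)
  have hBρ : B ⊆ ball (x:ℂ) ρ := ball_subset_ball (min_le_left _ _)
  have hB4 : ∀ z ∈ B, |z.im| < 1 / 4 := fun z hz => by
    have := (abs_im_le_norm (z - x)).trans_lt ((mem_ball_iff_norm.1 hz).trans_le (min_le_right _ _))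
    simpa using this
  have hq0 : ∀ z ∈ B, z ^ 2 + (T:ℂ) ^ 2 ≠ 0 := fun z hz h0 => by
    have := s_norm hT1 (hB4 z hz).le
    rw [h0, norm_zero] at this
    nlinarith [sq_nonneg z.re]
  set G : ℂ → ℂ := fun z => (Q z - (α + β * z)) * (z ^ 2 + (T:ℂ) ^ 2)⁻¹ with hG
  have hGd : DifferentiableOn ℂ G B := ((hQ.mono hBρ).sub (by fun_prop)).mul (DifferentiableOn.inv (by fun_prop) hq0)
  have hGP : ∀ z ∈ B, 0 ≤ z.im → Ph u Θ α β T z = (G z).im := fun z hz h0 => by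
    rcases h0.eq_or_lt with h0 | h0
    · have e : (z ^ 2 + (T:ℂ) ^ 2) = ((z.re ^ 2 + T ^ 2 : ℝ) : ℂ) := by
        apply Complex.ext <;> rw [← ofReal_pow] <;> simp [sq, ← h0]
      rw [Ph, if_neg (by rw [← h0]; simp), hG]
      simp only
      rw [e, ← ofReal_inv, im_mul_ofReal, sub_im, hQu z (hBρ hz)]
      simp [← h0, div_eq_mul_inv]
    · rw [Ph, if_pos h0, GT_eq hΘ, hG]
      · simp only
        rw [hQΘ z (hBρ hz) h0]
      · intro hh
        have := hB4 z hz
        rw [hh] at this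
        simp [abs_of_pos (show 0 < T by linarith)] at this
        linarith
  have hv : ∀ (F : ℂ → ℂ), DifferentiableOn ℂ F B → ∀ a t : ℝ, (a + t * I : ℂ) ∈ B → HasDerivAt (fun t : ℝ => (F (a + t * I)).im) (deriv F (a + t * I)).re t := by
    intro F hF a t ht
    have e1 := (hF.differentiableAt (hBo.mem_nhds ht)).hasDerivAt
    have e2 : HasDerivAt (fun t : ℝ => (a + t * I : ℂ)) I t := by
      simpa using ((Complex.ofRealCLM.hasDerivAt (x := t)).mul_const I).const_add (a:ℂ)
    exact (hd_im (e1.comp t e2)).congr_deriv (by simp)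
  -- derivative at x
  have hQ0 : (deriv Q x).re = 0 := by
    have e1 := hv Q (hQ.mono hBρ) x 0 (by simpa using hxB)
    have e2 : HasDerivAt (fun t : ℝ => (Q (x + (-t : ℝ) * I)).im) (-(deriv Q (x + (0:ℝ) * I)).re) 0 := by
      have := HasDerivAt.comp (0:ℝ) (h := fun t : ℝ => -t) (by simpa using e1) (hasDerivAt_neg (0:ℝ))
      exact this.congr_deriv (by simp)
    have e3 : HasDerivAt (fun t : ℝ => (Q (x + (-t : ℝ) * I)).im) (deriv Q (x + (0:ℝ) * I)).re 0 := by
      refine e1.congr_of_eventuallyEq ?_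
      have hcb : Continuous fun t : ℝ => (x + t * I : ℂ) := by fun_prop
      have hmem : ∀ᶠ t : ℝ in 𝓝 0, (x + t * I : ℂ) ∈ B := hcb.continuousAt.eventually (hBo.mem_nhds (by simpa using hxB))
      filter_upwards [hmem] with t ht
      have ht' : (x + (-t : ℝ) * I : ℂ) = conj (x + t * I : ℂ) := by simp
      have ht2 : (x + (-t : ℝ) * I : ℂ) ∈ B := by
        rw [mem_ball, Complex.dist_eq] at ht ⊢
        simpa using ht
      rw [hQu _ (hBρ ht2), hQu _ (hBρ ht), ht', h.symm]
    have := e2.unique e3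
    simp at this
    linarith
  have hτlim : Tendsto (fun t : ℝ => Θ (x + t * I)) (𝓝[>] 0) (𝓝 (Q x)) := by
    have hcb : Continuous fun t : ℝ => (x + t * I : ℂ) := by fun_prop
    have hcb0 := hcb.tendsto 0
    simp only [ofReal_zero, zero_mul, add_zero] at hcb0
    have e1 := ((hQ.continuousOn.continuousAt (isOpen_ball.mem_nhds (hBρ hxB))).tendsto.comp hcb0).mono_left (nhdsWithin_le_nhds (s := Ioi 0))
    refine e1.congr' ?_
    filter_upwards [nhdsWithin_le_nhds (hcb0.eventually (hBo.mem_nhds hxB)), self_mem_nhdsWithin] with t a b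
    exact hQΘ _ (hBρ a) (by simpa using b)
  have hnl : Tendsto (fun t : ℝ => ‖(x + t * I : ℂ)‖) (𝓝[>] 0) (𝓝 |x|) := by
    have hcb : Continuous fun t : ℝ => ‖(x + t * I : ℂ)‖ := by fun_prop
    have := hcb.tendsto 0
    simp at this
    exact this.mono_left nhdsWithin_le_nhds
  have h3 : |(Q x).re| ≤ C * (1 + |x|) := by
    refine (abs_re_le_norm _).trans (le_of_tendsto_of_tendsto hτlim.norm ((hnl.const_add 1).const_mul C) ?_)
    filter_upwards [self_mem_nhdsWithin] with t ht
    exact hC _ (by simpa using ht)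
  have h4' : R ≤ |x| → |(Q x).re - c * x| ≤ c / 10 * |x| := fun hx => by
    refine le_of_tendsto_of_tendsto (((Complex.continuous_re.tendsto _).comp hτlim).sub_const (c * x)).abs (hnl.const_mul (c / 10)) ?_
    filter_upwards [self_mem_nhdsWithin] with t ht
    have := h4 (x + t * I) (by simpa using ht) (hx.trans (by simpa using abs_re_le_norm (x + t * I : ℂ)))
    simpa using this
  have hN := N_lb (x := x) hc hR hRT hC0 hT hα h1 h2 h3 h4'
  have hqp : 0 < x ^ 2 + T ^ 2 := by positivity
  have hGx : (deriv G x).re = -(β * (x ^ 2 + T ^ 2) + 2 * x * ((Q x).re - α - β * x)) / (x ^ 2 + T ^ 2) ^ 2 := by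
    have e1 : HasDerivAt Q (deriv Q x) x := (hQ.differentiableAt (isOpen_ball.mem_nhds (hBρ hxB))).hasDerivAt
    have e2 : HasDerivAt (fun z : ℂ => α + β * z) (β:ℂ) x := by simpa using ((hasDerivAt_id (x:ℂ)).const_mul (β:ℂ)).const_add (α:ℂ)
    have e3 : HasDerivAt (fun z : ℂ => z ^ 2 + (T:ℂ) ^ 2) (2 * x : ℂ) x := by simpa using (hasDerivAt_pow 2 (x:ℂ)).add_const ((T:ℂ) ^ 2)
    have e4 := ((e1.sub e2).mul (e3.inv (hq0 x hxB))).deriv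
    have e5 : deriv G x = _ := e4
    have e6 : ((x:ℂ) ^ 2 + (T:ℂ) ^ 2) = ((x ^ 2 + T ^ 2 : ℝ) : ℂ) := by push_cast; rfl
    have e7 : (-(2 * (x:ℂ)) / ((x:ℂ) ^ 2 + (T:ℂ) ^ 2) ^ 2) = ((-(2 * x) / (x ^ 2 + T ^ 2) ^ 2 : ℝ) : ℂ) := by push_cast; rfl
    rw [e5]
    simp only [Pi.sub_apply, Pi.inv_apply]
    rw [e7, e6, ← ofReal_inv, add_re, re_mul_ofReal, re_mul_ofReal, sub_re, sub_re, hQ0]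
    simp
    field_simp
    ring
  have hK0 : (deriv G x).re + 3 / 2 * ε / (x ^ 2 + 1) < 0 := by
    have e1 : (deriv G x).re ≤ - (c / 2) / (x ^ 2 + T ^ 2) := by
      rw [hGx, div_le_div_iff₀ (by positivity) hqp]
      nlinarith [mul_le_mul_of_nonneg_right hN hqp.le]
    have e2 : 2 * ε / (x ^ 2 + 1) ≤ (c / 2) / (x ^ 2 + T ^ 2) := by
      rw [hε]
      have : x ^ 2 + T ^ 2 ≤ T ^ 2 * (x ^ 2 + 1) := by nlinarith [mul_nonneg (sq_nonneg x) (show 0 ≤ T ^ 2 - 1 by nlinarith)]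
      calc _ = c / 2 / (T ^ 2 * (x ^ 2 + 1)) := by field_simp; ring
        _ ≤ _ := by gcongr
    have e3 : 3 / 2 * ε / (x ^ 2 + 1) < 2 * ε / (x ^ 2 + 1) := by gcongr; linarith
    have e4 : - (c / 2) / (x ^ 2 + T ^ 2) = - ((c / 2) / (x ^ 2 + T ^ 2)) := neg_div _ _
    linarith
  obtain ⟨m, hm, hmb⟩ : ∃ m > 0, ∀ z ∈ ball (x:ℂ) m, z ∈ B ∧ (deriv G z).re + 3 / 2 * ε / (z.re ^ 2 + 1) < 0 := by
    refine Metric.eventually_nhds_iff_ball.1 (Eventually.and (hBo.mem_nhds hxB) ?_)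
    have e1 : ContinuousAt (fun z : ℂ => (deriv G z).re + 3 / 2 * ε / (z.re ^ 2 + 1)) x := by
      refine (Complex.continuous_re.continuousAt.comp ((hGd.deriv hBo).continuousOn.continuousAt (hBo.mem_nhds hxB))).add ?_
      exact Continuous.continuousAt (Continuous.div (by fun_prop) (by fun_prop) fun z => by positivity)
    exact e1.eventually (gt_mem_nhds (by simpa using hK0))
  have hms : ball (x:ℂ) m ⊆ B := fun z hz => (hmb z hz).1
  have hm1 : ball (x:ℂ) m ⊆ {z | -1 < z.im} := fun z hz => by
    have := (abs_lt.1 (hB4 z (hms hz))).1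
    show -1 < z.im
    linarith
  have hxm : (x:ℂ) ∈ ball (x:ℂ) m := mem_ball_self hm
  have hcG : ContinuousOn (fun z => (G z).im) (ball (x:ℂ) m) := Complex.continuous_im.comp_continuousOn (hGd.continuousOn.mono hms)
  have hce : ContinuousOn (fun z => ε * et z) (ball (x:ℂ) m) := continuousOn_const.mul (et_cont.mono hm1)
  refine SupM_of_ge (v := fun z => (G z).im + ε * et z) isOpen_ball (Qs_cont h hC0 hC hT1 hΘ ε).continuousOn (hcG.add hce) hxm ?_ ?_ ?_
  · exact SupM_add isOpen_ball hcG hce hxm (SupM_im isOpen_ball (hGd.mono hms) hxm) (SupM_const_mul hε0.le (et_sup (hm1 hxm)))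
  · intro z hz
    rcases le_or_gt 0 z.im with h0 | h0
    · rw [fold_up h0, Qs, hGP z (hms hz) h0]
    · have hcz : conj z ∈ ball (x:ℂ) m := by
        rw [mem_ball, Complex.dist_eq] at hz ⊢
        have : conj z - x = conj (z - x) := by simp
        rw [this, norm_conj]
        exact hz
      rw [fold_dn h0.le, Qs, hGP _ (hms hcz) (by simpa using h0.le)]
      have hseg : ∀ t ∈ Icc z.im (-z.im), (z.re + t * I : ℂ) ∈ ball (x:ℂ) m := fun t ht => by
        rw [mem_ball_iff_norm] at hz ⊢
        refine lt_of_le_of_lt ?_ hz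
        rw [← sq_le_sq₀ (norm_nonneg _) (norm_nonneg _), ← Complex.normSq_eq_norm_sq, ← Complex.normSq_eq_norm_sq, normSq_apply, normSq_apply]
        simp
        nlinarith [ht.1, ht.2]
      have hmv := (convex_Icc z.im (-z.im)).image_sub_le_mul_sub_of_deriv_le (f := fun t : ℝ => (G (z.re + t * I)).im) (C := -(3 / 2 * ε / (z.re ^ 2 + 1)))
        (fun t ht => (hv G hGd _ _ (hms (hseg t ht))).continuousAt.continuousWithinAt)
        (fun t ht => (hv G hGd _ _ (hms (hseg t (interior_subset ht)))).differentiableAt.differentiableWithinAt)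
        (fun t ht => by
          rw [(hv G hGd _ _ (hms (hseg t (interior_subset ht)))).deriv]
          have := (hmb _ (hseg t (interior_subset ht))).2
          simp only [add_re, ofReal_re, mul_re, ofReal_im, I_re, I_im] at this
          simp at this
          linarith) z.im ⟨le_rfl, by linarith⟩ (-z.im) ⟨by linarith, le_rfl⟩ (by linarith)
      have e1 : (z.re + (-z.im : ℝ) * I : ℂ) = conj z := by apply Complex.ext <;> simp
      rw [e1, eqxy] at hmv
      have hy := abs_lt.1 (hB4 z (hms hz))
      have e3 := et_gap hy.1 h0
      have e5 : -(3 / 2 * ε / (z.re ^ 2 + 1)) * (-z.im - z.im) = - (3 * ε * (-z.im / (z.re ^ 2 + 1))) := by ring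
      rw [e5] at hmv
      have := mul_le_mul_of_nonneg_left e3 hε0.le
      linarith
  · rw [fold_up (by simp), Qs, hGP x hxB (by simp)]

theorem exists_test (h : GW u Θ A) {E : Set ℝ} (hE : IsClosed E) (hh : InnerProductSpace.HarmonicOnNhd u (cplx E)ᶜ)
    (hAL : 0 < Filter.limsup (fun y : ℝ => u ((y : ℂ) * Complex.I) / y) Filter.atTop) :
    ∃ (Ψ : ℂ → ℝ) (ε C : ℝ), 0 < ε ∧ 0 ≤ C ∧ Continuous Ψ ∧ (∀ z, 0 ≤ Ψ z) ∧ (∀ z ∈ (cplx E)ᶜ, SupM Ψ z) ∧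
      (∀ z : ℂ, ∀ r : ℝ, 0 < r → r < |z.im| → circleAverage Ψ z r + ε * (r ^ 2 / ‖fold z + I‖ ^ 4) ≤ Ψ z) ∧
      ∀ z : ℂ, |z.im| ≤ 1 / 4 → Ψ z ≤ C * u (z.re + 1 * I) / (1 + z.re ^ 2) := by
  obtain ⟨c, hc0, hcu, hT, hlim⟩ := h.lemT
  rw [hlim.limsup_eq] at hAL
  obtain ⟨R, hR, hRb⟩ := hT (c / 10) (by positivity)
  obtain ⟨C, hC0, hC⟩ := h.theta_bd
  have ht2 : Tendsto (fun T : ℝ => 0.4 * c * T ^ 2) atTop atTop := (tendsto_pow_atTop two_ne_zero).const_mul_atTop (by positivity)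
  obtain ⟨T, ⟨hT1, hT2⟩, hT3⟩ := ((hlim.eventually (gt_mem_nhds (show c < c + c / 10 by linarith))).and (ht2.eventually_ge_atTop (2 * R * (C * (1 + R)) + 2 * c * R ^ 2)) |>.and (eventually_ge_atTop R)).exists
  have hT0 : 1 ≤ T := hR.trans hT3
  have hTp : 0 < T := by linarith
  have hTi : 0 < (T * I : ℂ).im := by simpa using hTp
  obtain ⟨α, hα⟩ : ∃ α, α = (Θ (T * I)).re := ⟨_, rfl⟩
  obtain ⟨β, hβ⟩ : ∃ β, β = u (T * I) / T := ⟨_, rfl⟩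
  have hΘ : Θ (T * I) = α + β * (T * I) := by
    apply Complex.ext
    · simp [hα]
    · rw [h.im _ hTi]; simp [hβ]; field_simp
  have hα1 : |α| ≤ c / 10 * T := by
    have := hRb (T * I) hTi (by simpa [abs_of_pos hTp] using hT3)
    simpa [abs_of_pos hTp, hα] using this
  have hβ1 : c ≤ β := by
    rw [hβ, le_div_iff₀ hTp]
    simpa using hcu _ hTi
  obtain ⟨ε, hε⟩ : ∃ ε, ε = c / (4 * T ^ 2) := ⟨_, rfl⟩
  have hε0 : 0 < ε := by rw [hε]; positivity
  obtain ⟨C3, hC3, hn⟩ := near h hC0 hC hT0 hΘ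
  have hetn : ∀ z : ℂ, 0 ≤ z.im → 0 ≤ et z := fun z hz => div_nonneg hz (normSq_nonneg _)
  have hall := fun z r => Qs_all (α := α) (β := β) (z := z) (r := r) h hTp hε0.le
  refine ⟨fun z => Qs u Θ α β T ε (fold z), ε, 2 + (C3 + ε) / c, hε0, by positivity, Qs_cont h hC0 hC hT0 hΘ ε, fun z => ?_, fun z hz => ?_, hall, fun z hz => ?_⟩
  · have : 0 ≤ (fold z).im := by rw [fold_im]; positivity
    exact add_nonneg (Ph_nonneg h hC0 hC hT0 hΘ _ this) (mul_nonneg hε0.le (hetn _ this))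
  · by_cases h0 : z.im = 0
    · obtain ⟨ρ, hρ, hb⟩ := Metric.isOpen_iff.1 (cplx_closed hE).isOpen_compl z hz
      have hzx : z = (z.re : ℂ) := by apply Complex.ext <;> simp [h0]
      rw [hzx] at hb ⊢
      exact Qs_gap h hC0 hC hΘ hρ (hh.mono hb) hAL hR hT3 hT2 hα1 hβ1 (hβ ▸ hT1.le) hRb hε
    · filter_upwards [Ioo_mem_nhdsGT (abs_pos.2 h0)] with r hr
      have := hall z r hr.1 hr.2
      have : 0 ≤ ε * (r ^ 2 / ‖fold z + I‖ ^ 4) := by positivity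
      linarith
  · have h1 := hn (fold z) (by rw [fold_im]; positivity) (by rw [fold_im]; exact hz)
    have h2 := (abs_le.1 h1).2
    rw [fold_im, fold_re] at h2
    have h3 := s_norm hT0 (z := fold z) (by rw [fold_im, abs_abs]; exact hz)
    rw [fold_re] at h3
    have hx : 0 < z.re ^ 2 + 1 := by positivity
    have h4 : (((fold z) ^ 2 + (T:ℂ) ^ 2)⁻¹).re ≤ 2 / (z.re ^ 2 + 1) := by
      refine (le_abs_self _).trans ((abs_re_le_norm _).trans ?_)
      rw [norm_inv]
      exact (inv_anti₀ (by positivity) h3).trans (le_of_eq (by field_simp))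
    have h5 : u (fold z) ≤ u (z.re + 1 * I) := by
      have := h.mono z.re (y1 := |z.im|) (y2 := 1) (by rw [abs_abs]; linarith)
      simpa [fold] using this
    have h6 : c ≤ u (z.re + 1 * I) := by simpa using hcu (z.re + 1 * I) (by simp)
    have h7 : et (fold z) ≤ 1 / (z.re ^ 2 + 1) := by
      exact et_le (abs_nonneg _) (by linarith)
    have h8 : u (fold z) * (((fold z) ^ 2 + (T:ℂ) ^ 2)⁻¹).re ≤ u (z.re + 1 * I) * (2 / (z.re ^ 2 + 1)) :=
      (mul_le_mul_of_nonneg_left h4 (h.nonneg _)).trans (mul_le_mul_of_nonneg_right h5 (by positivity))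
    have h9 : C3 * |z.im| / (z.re ^ 2 + 1) ≤ C3 * 1 / (z.re ^ 2 + 1) := by gcongr; linarith
    have h10 := mul_le_mul_of_nonneg_left h7 hε0.le
    have h11 : (C3 + ε) / (z.re ^ 2 + 1) ≤ (C3 + ε) / c * u (z.re + 1 * I) / (z.re ^ 2 + 1) := by
      gcongr
      rw [div_mul_eq_mul_div, le_div_iff₀ hAL]
      gcongr
    calc Qs u Θ α β T ε (fold z) = Ph u Θ α β T (fold z) + ε * et (fold z) := rfl
      _ ≤ u (z.re + 1 * I) * (2 / (z.re ^ 2 + 1)) + C3 * 1 / (z.re ^ 2 + 1) + ε * (1 / (z.re ^ 2 + 1)) := by linarith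
      _ = u (z.re + 1 * I) * (2 / (z.re ^ 2 + 1)) + (C3 + ε) / (z.re ^ 2 + 1) := by ring
      _ ≤ u (z.re + 1 * I) * (2 / (z.re ^ 2 + 1)) + (C3 + ε) / c * u (z.re + 1 * I) / (z.re ^ 2 + 1) := by linarith
      _ = _ := by ring
end

lemma fub_int {F : ℝ → ℂ → ℝ} (hF : Continuous (Function.uncurry F)) {R : ℝ} (h0 : ∀ t z, R < ‖z‖ → F t z = 0) (a b : ℝ) :
    Integrable (Function.uncurry F) ((volume.restrict (uIoc a b)).prod volume) := by
  have h1 : (volume.restrict (uIoc a b)).prod (volume : Measure ℂ) = (volume.prod volume).restrict (uIoc a b ×ˢ univ) := by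
    rw [← Measure.prod_restrict, Measure.restrict_univ]
  rw [h1]
  have h2 : IntegrableOn (Function.uncurry F) (uIcc a b ×ˢ closedBall (0:ℂ) R) (volume.prod volume) :=
    hF.continuousOn.integrableOn_compact (isCompact_uIcc.prod (isCompact_closedBall _ _))
  refine h2.of_forall_sdiff_eq_zero (measurableSet_uIoc.prod MeasurableSet.univ) fun p hp => ?_
  refine h0 _ _ ?_
  by_contra h
  push Not at h
  exact hp.2 ⟨uIoc_subset_uIcc hp.1.1, by simpa using h⟩

lemma avg_fub {Ψ D : ℂ → ℝ} (hΨ : Continuous Ψ) (hD : Continuous D) (hK : HasCompactSupport D) (r : ℝ) :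
    ∫ z, Ψ z * circleAverage D z r = ∫ z, D z * circleAverage Ψ z r := by
  obtain ⟨R, hR⟩ := hK.isCompact.isBounded.subset_closedBall 0
  have hD0 : ∀ z, R < ‖z‖ → D z = 0 := fun z hz => by
    by_contra h
    have := hR (subset_tsupport _ h)
    rw [mem_closedBall_zero_iff] at this
    linarith
  have hcm : Continuous fun p : ℝ × ℂ => circleMap p.2 r p.1 := by unfold circleMap; fun_prop
  have hcm' : Continuous fun p : ℝ × ℂ => circleMap p.2 (-r) p.1 := by unfold circleMap; fun_prop
  have i1 := fub_int (F := fun t z => Ψ z * D (circleMap z r t)) (R := R + |r|)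
    ((hΨ.comp continuous_snd).mul (hD.comp hcm)) (fun t z hz => by
      rw [hD0, mul_zero]
      have := norm_sub_norm_le z (z - circleMap z r t)
      have e : z - circleMap z r t = -(circleMap 0 r t) := by simp [circleMap]
      rw [sub_sub_cancel, e, norm_neg, norm_circleMap_zero] at this
      linarith) 0 (2 * π)
  have i2 := fub_int (F := fun t z => D z * Ψ (circleMap z (-r) t)) (R := R)
    ((hD.comp continuous_snd).mul (hΨ.comp hcm')) (fun t z hz => by rw [hD0 z hz, zero_mul]) 0 (2 * π)
  have e1 := intervalIntegral_integral_swap i1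
  have e2 := intervalIntegral_integral_swap i2
  have e3 : ∀ t : ℝ, ∫ z, Ψ z * D (circleMap z r t) = ∫ z, D z * Ψ (circleMap z (-r) t) := fun t => by
    rw [← integral_sub_right_eq_self _ (circleMap 0 r t)]
    congr 1; ext z
    have a1 : circleMap (z - circleMap 0 r t) r t = z := by simp [circleMap]
    have a2 : z - circleMap 0 r t = circleMap z (-r) t := by simp [circleMap]; ring
    rw [a1, a2, mul_comm]
  simp_rw [e3] at e1
  rw [e1] at e2
  have f1 : ∀ z, Ψ z * circleAverage D z r = (2 * π)⁻¹ * ∫ t in 0..2 * π, Ψ z * D (circleMap z r t) := fun z => by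
    rw [circleAverage_def, smul_eq_mul, intervalIntegral.integral_const_mul]; ring
  have f2 : ∀ z, D z * circleAverage Ψ z r = (2 * π)⁻¹ * ∫ t in 0..2 * π, D z * Ψ (circleMap z (-r) t) := fun z => by
    rw [← circleAverage_neg_radius, circleAverage_def, smul_eq_mul, intervalIntegral.integral_const_mul]; ring
  simp_rw [f1, f2]
  rw [integral_const_mul, integral_const_mul, e2]

noncomputable def UU (W : ℂ → ℝ) (z : ℂ) : ℝ := W (fold z + I)

section
variable {W : ℂ → ℝ} {Θ : ℂ → ℂ} {A : ℝ}

lemma UU_cont (h : GW W Θ A) : Continuous (UU W) := h.cont.comp (fold_cont.add continuous_const)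

lemma UU_ge (h : GW W Θ A) (z : ℂ) {a : ℝ} (ha : |z.im + a| ≤ 1 + |z.im|) : W (z + a * I) ≤ UU W z := by
  have := h.mono z.re (y1 := z.im + a) (y2 := 1 + |z.im|) ha
  rw [UU, fold]
  convert this using 2
  · apply Complex.ext <;> simp
  · push_cast; ring

lemma UU_conj (W : ℂ → ℝ) (z : ℂ) : UU W (conj z) = UU W z := by rw [UU, fold_conj, UU]

lemma UU_avg_conj (W : ℂ → ℝ) (z : ℂ) (r : ℝ) : circleAverage (UU W) (conj z) r = circleAverage (UU W) z r :=
  fold_bd (fun z => W (z + I)) z r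

lemma up_wlog {P : ℂ → Prop} (h1 : ∀ z, P (conj z) → P z) (h2 : ∀ z : ℂ, 0 ≤ z.im → P z) (z : ℂ) : P z := by
  rcases le_or_gt 0 z.im with h | h
  · exact h2 z h
  · exact h1 z (h2 _ (by simpa using h.le))

lemma J_nonneg (h : GW W Θ A) {r : ℝ} (hr : 0 < r) (z : ℂ) : UU W z ≤ circleAverage (UU W) z r := by
  refine up_wlog (P := fun z => UU W z ≤ circleAverage (UU W) z r) (fun z hz => by rwa [UU_conj, UU_avg_conj] at hz) (fun z hz => ?_) z
  have hc : Continuous fun w => W (w + I) := h.cont.comp (by fun_prop)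
  rw [UU, fold_up hz]
  refine (le_avg hc hr fun w _ => SubM_trans (h.sub _)).trans (circleAverage_mono (ci_of_cont hr.le hc.continuousOn) (ci_of_cont hr.le (UU_cont h).continuousOn) fun w _ => ?_)
  have := UU_ge h w (a := 1) ((abs_add_le _ _).trans (by simp [add_comm]))
  simpa using this

lemma harm_avg (h : GW W Θ A) {r : ℝ} (hr : 0 < r) {z : ℂ} (hz : r < z.im + 1) : circleAverage (fun w => W (w + I)) z r = W (z + I) := by
  rw [avg_add]
  have hb : closedBall (z + I) r ⊆ {z | 0 < z.im} := fun w hw => by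
    rw [mem_closedBall, Complex.dist_eq] at hw
    have := (abs_le.1 ((abs_im_le_norm _).trans hw)).1
    simp at this
    show 0 < w.im
    linarith
  rw [← h.im _ (hb (mem_closedBall_self hr.le)), ← avg_im' h.diff hr hb]
  apply circleAverage_congr_sphere
  intro w hw
  rw [abs_of_pos hr] at hw
  exact (h.im w (hb (sphere_subset_closedBall hw))).symm

lemma J_zero (h : GW W Θ A) {r : ℝ} (hr : 0 < r) (z : ℂ) : r ≤ |z.im| → circleAverage (UU W) z r = UU W z := by
  refine up_wlog (P := fun z => r ≤ |z.im| → circleAverage (UU W) z r = UU W z) (fun z hz => by simpa [UU_conj, UU_avg_conj] using hz) (fun z hz hrz => ?_) z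
  rw [abs_of_nonneg hz] at hrz
  rw [UU, fold_up hz, ← harm_avg h hr (by linarith)]
  apply circleAverage_congr_sphere
  intro w hw
  rw [abs_of_pos hr, mem_sphere, Complex.dist_eq] at hw
  have := (abs_le.1 ((abs_im_le_norm _).trans hw.le)).1
  rw [sub_im] at this
  simp only [UU]
  rw [fold_up (by linarith)]

lemma J_le (h : GW W Θ A) {r : ℝ} (hr : 0 < r) (hr8 : r ≤ 1 / 8) (z : ℂ) : |z.im| ≤ r →
    circleAverage (UU W) z r - UU W z ≤ 2 * Real.exp 1 * r * (deriv Θ (z.re + 1 * I)).re := by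
  refine up_wlog (P := fun z => |z.im| ≤ r → circleAverage (UU W) z r - UU W z ≤ 2 * Real.exp 1 * r * (deriv Θ (z.re + 1 * I)).re) (fun z hz => by simpa [UU_conj, UU_avg_conj] using hz) (fun z hz hrz => ?_) z
  rw [abs_of_nonneg hz] at hrz
  have hW0 : 0 ≤ (deriv Θ (z.re + 1 * I)).re := h.deriv_re (by simp)
  have hc : Continuous fun w => W (w + I) := h.cont.comp (by fun_prop)
  have hd2 : DifferentiableOn ℂ (fun z => I * deriv Θ z) {z | 0 < z.im} := (differentiableOn_const _).mul (h.diff.deriv open_hp)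
  have hcI := ci_of_cont hr.le hc.continuousOn (z := z)
  have hcU := ci_of_cont hr.le (UU_cont h).continuousOn (z := z)
  have e1 : UU W z = circleAverage (fun w => W (w + I)) z r := by rw [harm_avg h hr (by linarith), UU, fold_up hz]
  rw [e1, ← circleAverage_sub hcU hcI]
  refine circleAverage_mono_on_of_le_circle (hcU.sub hcI) fun w hw => ?_
  rw [abs_of_pos hr, mem_sphere, Complex.dist_eq] at hw
  have hwi := abs_le.1 ((abs_im_le_norm _).trans hw.le)
  have hwr := abs_re_le_norm (w - z)
  rw [hw] at hwr
  rw [sub_im] at hwi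
  rw [sub_re] at hwr
  rw [Pi.sub_apply, UU]
  rcases le_or_gt 0 w.im with h0 | h0
  · rw [fold_up h0, sub_self]; positivity
  have hpt : ∀ t ∈ Icc (1 + w.im) (1 - w.im), (0:ℝ) < t := fun t ht => by linarith [ht.1, hwi.1]
  have hv : ∀ t ∈ Icc (1 + w.im) (1 - w.im), HasDerivAt (fun t : ℝ => (Θ (w.re + t * I)).im) (deriv Θ (w.re + t * I)).re t := fun t ht =>
    (hd_im (hasDerivAt_vert h.diff w.re (hpt t ht))).congr_deriv (by simp)
  have hmv := (convex_Icc (1 + w.im) (1 - w.im)).image_sub_le_mul_sub_of_deriv_le (f := fun t : ℝ => (Θ (w.re + t * I)).im) (C := Real.exp 1 * (deriv Θ (z.re + 1 * I)).re)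
    (fun t ht => (hv t ht).continuousAt.continuousWithinAt)
    (fun t ht => (hv t (interior_subset ht)).differentiableAt.differentiableWithinAt)
    (fun t ht => by
      have ht := interior_subset ht
      rw [(hv t ht).deriv]
      have := harnack hd2 (fun z hz => by simpa using h.deriv_re hz) (m := 1 / 2) (by norm_num) (z := w.re + t * I) (z0 := z.re + 1 * I)
        (by simp; linarith [ht.1]) (by simp; norm_num)
      simp only [I_mul_im] at this
      refine this.trans ?_
      rw [mul_comm]
      gcongr
      have h2 := norm_le_abs_re_add_abs_im ((w.re + t * I : ℂ) - (z.re + 1 * I))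
      simp at h2
      have h3 : |t - 1| ≤ 1 / 8 := abs_le.2 ⟨by linarith [ht.1], by linarith [ht.2]⟩
      rw [one_mul]
      linarith) (1 + w.im) ⟨le_rfl, by linarith⟩ (1 - w.im) ⟨by linarith, le_rfl⟩ (by linarith)
  rw [h.im _ (by simp; linarith), h.im _ (by simp; linarith)] at hmv
  have e2 : (w.re + (1 + w.im : ℝ) * I : ℂ) = w + I := by apply Complex.ext <;> simp [add_comm]
  have e3 : (w.re + (1 - w.im : ℝ) * I : ℂ) = fold w + I := by rw [fold, abs_of_neg h0]; push_cast; ring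
  rw [e2, e3] at hmv
  refine hmv.trans ?_
  have : (1 - w.im - (1 + w.im)) ≤ 2 * r := by linarith
  calc _ ≤ Real.exp 1 * (deriv Θ (z.re + 1 * I)).re * (2 * r) := by gcongr
    _ = _ := by ring

lemma strip_int {g : ℝ → ℝ} (hg : Integrable g) (r : ℝ) (hr : 0 < r) :
    Integrable (fun z : ℂ => g z.re * (Icc (-r) r).indicator 1 z.im) ∧ ∫ z : ℂ, g z.re * (Icc (-r) r).indicator 1 z.im = (∫ x, g x) * (2 * r) := by
  have i2 : Integrable ((Icc (-r) r).indicator (1 : ℝ → ℝ)) := (integrable_indicator_iff measurableSet_Icc).2 (by simp [Pi.one_def])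
  have i3 := hg.mul_prod i2
  constructor
  · have := (Complex.volume_preserving_equiv_real_prod.integrable_comp_emb Complex.measurableEquivRealProd.measurableEmbedding).2 i3
    exact this
  · have := Complex.volume_preserving_equiv_real_prod.integral_comp Complex.measurableEquivRealProd.measurableEmbedding (fun p : ℝ × ℝ => g p.1 * (Icc (-r) r).indicator 1 p.2)
    refine (Eq.trans ?_ this).trans ?_
    · rfl
    · have e := integral_prod_mul (μ := (volume : Measure ℝ)) (ν := (volume : Measure ℝ)) g ((Icc (-r) r).indicator (1 : ℝ → ℝ))
      refine e.trans ?_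
      rw [integral_indicator_one measurableSet_Icc]
      congr 1
      rw [measureReal_def, Real.volume_Icc, ENNReal.toReal_ofReal (by linarith)]
      ring

lemma avg_cont {Ψ : ℂ → ℝ} (hΨ : Continuous Ψ) (r : ℝ) : Continuous fun z => circleAverage Ψ z r := by
  simp_rw [circleAverage_def]
  refine Continuous.const_smul (M := ℝ) (intervalIntegral.continuous_parametric_intervalIntegral_of_continuous' (μ := volume) (f := fun z t => Ψ (circleMap z r t)) ?_ 0 (2 * π)) _
  have : Continuous fun p : ℂ × ℝ => circleMap p.1 r p.2 := by unfold circleMap; fun_prop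
  exact hΨ.comp this

lemma im_null : (volume : Measure ℂ) {z : ℂ | z.im = 0} = 0 := by
  have := Measure.addHaar_submodule (volume : Measure ℂ) (LinearMap.ker Complex.imLm) fun h0 => by
    have : I ∈ LinearMap.ker Complex.imLm := by rw [h0]; trivial
    simp at this
  convert this using 2
  ext z
  simp

theorem pairing (h : GW W Θ A) {Ω : Set ℂ} (hΩ : IsOpen Ω) {Ψ : ℂ → ℝ} {ε C : ℝ} (hε : 0 < ε) (hC : 0 ≤ C) (hΨc : Continuous Ψ)
    (hΨ0 : ∀ z, 0 ≤ Ψ z) (hΨs : ∀ z ∈ Ω, SupM Ψ z)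
    (hΨε : ∀ z : ℂ, ∀ r : ℝ, 0 < r → r < |z.im| → circleAverage Ψ z r + ε * (r ^ 2 / ‖fold z + I‖ ^ 4) ≤ Ψ z)
    (hΨb : ∀ z : ℂ, |z.im| ≤ 1 / 4 → Ψ z ≤ C * W (z.re + 1 * I) / (1 + z.re ^ 2)) :
    ∃ C' : ℝ, ∀ D : ℂ → ℝ, Continuous D → HasCompactSupport D → tsupport D ⊆ Ω → (∀ z, 0 ≤ D z) →
      (∀ z ∈ Ω, SubM (fun z => UU W z + D z) z) → ∫ z, D z * (1 / ‖fold z + I‖ ^ 4) ≤ C' := by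
  set g : ℝ → ℝ := fun x => W (x + 1 * I) * (deriv Θ (x + 1 * I)).re / (1 + x ^ 2) with hg
  have hgi : Integrable g := h.energy
  refine ⟨ε⁻¹ * (C * (2 * Real.exp 1) * 2 * ∫ x, g x), fun D hD hK hKΩ hD0 hsub => ?_⟩
  obtain ⟨δ, hδ, hδK⟩ := hK.isCompact.exists_cthickening_subset_open hΩ hKΩ
  have hωc : Continuous fun z => 1 / ‖fold z + I‖ ^ 4 := by
    refine continuous_const.div (((fold_cont.add continuous_const).norm).pow 4) fun z h0 => ?_
    have h1 : fold z + I = 0 := by simpa using h0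
    have := congrArg Complex.im h1
    simp [fold_im] at this
    linarith [abs_nonneg z.im]
  have hi : Integrable fun z => D z * (1 / ‖fold z + I‖ ^ 4) := (hD.mul hωc).integrable_of_hasCompactSupport hK.mul_right
  have key : ∀ r : ℝ, 0 < r → r < min (1 / 8) (δ / 2) →
      ∫ z, {z : ℂ | r < |z.im|}.indicator (fun z => D z * (1 / ‖fold z + I‖ ^ 4)) z ≤ ε⁻¹ * (C * (2 * Real.exp 1) * 2 * ∫ x, g x) := by
    intro r hr hr2
    have hr8 : r < 1 / 8 := hr2.trans_le (min_le_left _ _)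
    have hrδ : 2 * r ≤ δ := by linarith [hr2.trans_le (min_le_right _ _)]
    have hin : ∀ k ∈ tsupport D, ∀ z, dist z k ≤ r → ball z r ⊆ Ω := fun k hk z hz w hw => by
      refine hδK (closedBall_subset_cthickening hk δ ?_)
      rw [mem_closedBall]
      rw [mem_ball] at hw
      linarith [dist_triangle w z k]
    have hMD : ∀ z, D z - circleAverage D z r ≤ circleAverage (UU W) z r - UU W z := fun z => by
      by_cases hz : ∃ k ∈ tsupport D, dist z k ≤ r
      · obtain ⟨k, hk, hz⟩ := hz
        have := le_avg ((UU_cont h).add hD) hr fun w hw => hsub w (hin k hk z hz hw)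
        simp only [Pi.add_apply] at this
        have e := circleAverage_add (ci_of_cont hr.le (UU_cont h).continuousOn (z := z)) (ci_of_cont hr.le hD.continuousOn)
        linarith
      · push Not at hz
        have hz0 : ∀ w, dist z w ≤ r → D w = 0 := fun w hw => by
          by_contra h0
          exact (hz w (subset_tsupport _ h0)).not_ge hw
        have e1 : circleAverage D z r = 0 := circleAverage_const_on_circle fun w hw => hz0 w (by
          rw [abs_of_pos hr, mem_sphere, dist_comm] at hw; exact hw.le)
        rw [e1, hz0 z (by simpa using hr.le)]
        linarith [J_nonneg h hr z]
    obtain ⟨i3, e3⟩ := strip_int hgi r hr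
    have hDa : HasCompactSupport fun z => circleAverage D z r := by
      obtain ⟨R, hR⟩ := hK.isCompact.isBounded.subset_closedBall 0
      refine HasCompactSupport.intro (isCompact_closedBall 0 (R + r)) fun z hz => ?_
      refine circleAverage_const_on_circle fun w hw => ?_
      by_contra h0
      have h1 := hR (subset_tsupport _ h0)
      rw [abs_of_pos hr, mem_sphere, dist_comm] at hw
      rw [mem_closedBall] at h1 hz
      linarith [dist_triangle z w 0]
    have s1 : ∫ z, Ψ z * (D z - circleAverage D z r) ≤ ∫ z : ℂ, C * (2 * Real.exp 1) * r * (g z.re * (Icc (-r) r).indicator 1 z.im) := by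
      refine integral_mono ?_ (i3.const_mul _) fun z => ?_
      · exact (hΨc.mul (hD.sub (avg_cont hD r))).integrable_of_hasCompactSupport (hK.sub hDa).mul_left
      · simp only
        rcases le_or_gt |z.im| r with hz | hz
        · rw [indicator_of_mem (show z.im ∈ Icc (-r) r from abs_le.1 hz), Pi.one_apply, mul_one]
          have a1 := (hMD z).trans (J_le h hr hr8.le z hz)
          have a2 := hΨb z (by linarith)
          have a3 : 0 ≤ (deriv Θ (z.re + 1 * I)).re := h.deriv_re (by simp)
          calc _ ≤ Ψ z * (2 * Real.exp 1 * r * (deriv Θ (z.re + 1 * I)).re) := mul_le_mul_of_nonneg_left a1 (hΨ0 z)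
            _ ≤ (C * W (z.re + 1 * I) / (1 + z.re ^ 2)) * (2 * Real.exp 1 * r * (deriv Θ (z.re + 1 * I)).re) := by gcongr
            _ = _ := by rw [hg]; ring
        · rw [indicator_of_notMem (show z.im ∉ Icc (-r) r from fun hh => hz.not_ge (abs_le.2 hh)), mul_zero, mul_zero]
          have a1 := hMD z
          rw [J_zero h hr z hz.le, sub_self] at a1
          exact mul_nonpos_of_nonneg_of_nonpos (hΨ0 z) a1
    have s2 : ∫ z, Ψ z * (D z - circleAverage D z r) = ∫ z, D z * (Ψ z - circleAverage Ψ z r) := by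
      have j1 : Integrable fun z => Ψ z * D z := (hΨc.mul hD).integrable_of_hasCompactSupport hK.mul_left
      have j2 : Integrable fun z => Ψ z * circleAverage D z r := (hΨc.mul (avg_cont hD r)).integrable_of_hasCompactSupport hDa.mul_left
      have j3 : Integrable fun z => D z * Ψ z := (hD.mul hΨc).integrable_of_hasCompactSupport hK.mul_right
      have j4 : Integrable fun z => D z * circleAverage Ψ z r := (hD.mul (avg_cont hΨc r)).integrable_of_hasCompactSupport hK.mul_right
      simp_rw [mul_sub]
      rw [integral_sub j1 j2, integral_sub j3 j4, avg_fub hΨc hD hK r]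
      simp_rw [mul_comm]
    have s3 : ∫ z, ε * r ^ 2 * {z : ℂ | r < |z.im|}.indicator (fun z => D z * (1 / ‖fold z + I‖ ^ 4)) z ≤ ∫ z, D z * (Ψ z - circleAverage Ψ z r) := by
      refine integral_mono ?_ ?_ fun z => ?_
      · have ho : IsOpen {z : ℂ | r < |z.im|} := isOpen_lt continuous_const (by fun_prop)
        exact (hi.indicator ho.measurableSet).const_mul _
      · exact (hD.mul (hΨc.sub (avg_cont hΨc r))).integrable_of_hasCompactSupport hK.mul_right
      · simp only
        by_cases hz : r < |z.im|
        · rw [indicator_of_mem (show z ∈ {z : ℂ | r < |z.im|} from hz)]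
          have := mul_le_mul_of_nonneg_left (hΨε z r hr hz) (hD0 z)
          calc _ = D z * (ε * (r ^ 2 / ‖fold z + I‖ ^ 4)) := by ring
            _ ≤ _ := by linarith
        · rw [indicator_of_notMem (show z ∉ {z : ℂ | r < |z.im|} from hz), mul_zero]
          by_cases hz0 : D z = 0
          · rw [hz0, zero_mul]
          · have := ge_avg hΨc hr fun w hw => hΨs w (hin z (subset_tsupport _ hz0) z (by simpa using hr.le) hw)
            exact mul_nonneg (hD0 z) (by linarith)
    rw [s2, integral_const_mul, e3] at s1
    rw [integral_const_mul] at s3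
    have s4 := s3.trans s1
    rw [← div_eq_inv_mul, le_div_iff₀ hε]
    have hr2 : 0 < r ^ 2 := by positivity
    refine le_of_mul_le_mul_left (le_trans (le_of_eq ?_) (s4.trans (le_of_eq ?_))) hr2 <;> ring
  -- limit
  obtain ⟨m, hm⟩ : ∃ m, m = min (1 / 8) (δ / 2) := ⟨_, rfl⟩
  have hm0 : 0 < m := by rw [hm]; positivity
  have ht : Tendsto (fun n : ℕ => m * (1 / ((n:ℝ) + 1))) atTop (𝓝 0) := by simpa using tendsto_one_div_add_atTop_nhds_zero_nat.const_mul m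
  have hlim : Tendsto (fun n : ℕ => ∫ z, {z : ℂ | m * (1 / ((n:ℝ) + 1)) < |z.im|}.indicator (fun z => D z * (1 / ‖fold z + I‖ ^ 4)) z) atTop (𝓝 (∫ z, D z * (1 / ‖fold z + I‖ ^ 4))) := by
    refine tendsto_integral_of_dominated_convergence (fun z => D z * (1 / ‖fold z + I‖ ^ 4)) (fun n => ?_) hi (fun n => Eventually.of_forall fun z => ?_) ?_
    · have ho : IsOpen {z : ℂ | m * (1 / ((n:ℝ) + 1)) < |z.im|} := isOpen_lt continuous_const (by fun_prop)
      exact (hi.indicator ho.measurableSet).1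
    · rw [Real.norm_of_nonneg (indicator_nonneg (fun z _ => mul_nonneg (hD0 z) (by positivity)) _)]
      exact indicator_le_self' (fun z _ => mul_nonneg (hD0 z) (by positivity)) _
    · have : ∀ᵐ z : ℂ, z.im ≠ 0 := by rw [ae_iff]; simpa using im_null
      filter_upwards [this] with z hz
      refine tendsto_const_nhds.congr' ?_
      filter_upwards [ht.eventually (gt_mem_nhds (abs_pos.2 hz))] with n hn
      rw [indicator_of_mem]
      exact hn
  refine le_of_tendsto hlim ((eventually_ge_atTop 1).mono fun n hn => key _ (by positivity) ?_)
  rw [← hm]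
  have : (1:ℝ) ≤ n := by exact_mod_cast hn
  calc _ < m * 1 := by gcongr; rw [div_lt_one (by positivity)]; linarith
    _ = m := mul_one m
end

lemma area {w : ℂ → ℝ} (hw : Continuous w) {z : ℂ} {δ : ℝ} (hs : ∀ ζ ∈ ball z δ, SubM w ζ) :
    w z * ∫ x : ℂ, max 0 (δ - ‖x‖) ≤ ∫ x : ℂ, w (z + x) * max 0 (δ - ‖x‖) := by
  have h0 : ∀ x : ℂ, δ < ‖x‖ → max 0 (δ - ‖x‖) = 0 := fun x hx => max_eq_left (by linarith)
  have hcs : HasCompactSupport fun x : ℂ => max 0 (δ - ‖x‖) :=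
    HasCompactSupport.intro (isCompact_closedBall 0 δ) fun x hx => h0 x (by simpa using hx)
  have hφ : Continuous fun x : ℂ => max 0 (δ - ‖x‖) := by fun_prop
  have i1 := fub_int (F := fun t x => w (z + Complex.exp (t * I) * x) * max 0 (δ - ‖x‖)) (R := δ) (by
    unfold Function.uncurry; fun_prop) (fun t x hx => by rw [h0 x hx, mul_zero]) 0 (2 * π)
  have e1 := intervalIntegral_integral_swap i1
  have e2 : ∀ t : ℝ, ∫ x, w (z + Complex.exp (t * I) * x) * max 0 (δ - ‖x‖) = ∫ x : ℂ, w (z + x) * max 0 (δ - ‖x‖) := fun t => by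
    have := (rotation (Circle.exp t)).measurePreserving.integral_comp (rotation (Circle.exp t)).toHomeomorph.measurableEmbedding fun x => w (z + x) * max 0 (δ - ‖x‖)
    simpa [rotation_apply] using this
  have e3 : ∀ x, ∫ t in 0..2 * π, w (z + Complex.exp (t * I) * x) * max 0 (δ - ‖x‖) = 2 * π * (circleAverage w z ‖x‖ * max 0 (δ - ‖x‖)) := fun x => by
    rw [intervalIntegral.integral_mul_const, circleAverage_def, smul_eq_mul]
    have a1 : ∀ t : ℝ, w (z + Complex.exp (t * I) * x) = w (circleMap z ‖x‖ (t + x.arg)) := fun t => by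
      congr 1
      conv_lhs => rw [← Complex.norm_mul_exp_arg_mul_I x]
      rw [circleMap, Complex.ofReal_add, add_mul, Complex.exp_add]; ring
    have hp : Function.Periodic (fun t => w (circleMap z ‖x‖ t)) (2 * π) := fun t => by simp only [periodic_circleMap z ‖x‖ t]
    simp_rw [a1]
    rw [intervalIntegral.integral_comp_add_right (fun t => w (circleMap z ‖x‖ t)), zero_add, add_comm (2 * π),
      hp.intervalIntegral_add_eq x.arg 0, zero_add]
    field_simp
  simp_rw [e2, e3] at e1
  rw [intervalIntegral.integral_const, integral_const_mul, sub_zero, smul_eq_mul] at e1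
  rw [mul_left_cancel₀ (by positivity) e1, ← integral_const_mul]
  have hca : Continuous fun x : ℂ => circleAverage w z ‖x‖ := by
    simp_rw [circleAverage_def]
    refine Continuous.const_smul (M := ℝ) (intervalIntegral.continuous_parametric_intervalIntegral_of_continuous' (μ := volume) (f := fun x t => w (circleMap z ‖x‖ t)) ?_ 0 (2 * π)) _
    have : Continuous fun p : ℂ × ℝ => circleMap z ‖p.1‖ p.2 := by unfold circleMap; fun_prop
    exact hw.comp this
  refine integral_mono ((hφ.integrable_of_hasCompactSupport hcs).const_mul _) ((hca.mul hφ).integrable_of_hasCompactSupport hcs.mul_left) fun x => ?_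
  simp only
  rcases lt_or_ge δ ‖x‖ with hx | hx
  · rw [h0 x hx]; simp
  rcases eq_or_ne x 0 with rfl | hx0
  · simp
  · exact mul_le_mul_of_nonneg_right (le_avg hw (norm_pos_iff.2 hx0) fun ζ hζ => hs ζ (ball_subset_ball hx hζ)) (le_max_left _ _)

def Adm (U : ℂ → ℝ) (Ω : Set ℂ) (w : ℂ → ℝ) : Prop :=
  Continuous w ∧ (∀ z, U z ≤ w z) ∧ (∃ K ⊆ Ω, IsCompact K ∧ ∀ z ∉ K, w z = U z) ∧ ∀ z ∈ Ω, SubM w z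

lemma Adm.step {U w : ℂ → ℝ} {Ω : Set ℂ} (h : Adm U Ω w) {c : ℂ} {R : ℝ} (hR : 0 < R) (hc : closedBall c R ⊆ Ω) :
    Adm U Ω (PM w c R) ∧ ∀ z, w z ≤ PM w c R z := by
  obtain ⟨h1, h2, ⟨K, hK, hKc, hKe⟩, h4⟩ := h
  have hb : ∀ z ∈ ball c R, SubM w z := fun z hz => h4 z (hc (ball_subset_closedBall hz))
  have hle := le_PM h1 c hR hb
  refine ⟨⟨PM_cont h1 c hR, fun z => (h2 z).trans (hle z), ⟨K ∪ closedBall c R, union_subset hK hc, hKc.union (isCompact_closedBall c R), fun z hz => ?_⟩,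
    fun z hz => PM_sub h1 c hR hb (h4 z hz)⟩, hle⟩
  rw [mem_union, not_or] at hz
  rw [PM_out fun hh => hz.2 (ball_subset_closedBall hh), hKe z hz.1]

lemma Adm.bdd {U : ℂ → ℝ} {Ω : Set ℂ} (hΩ : IsOpen Ω) (hU : Continuous U) {ω : ℂ → ℝ} (hω : Continuous ω) (hω0 : ∀ z, 0 < ω z) {C' : ℝ}
    (hC : ∀ D : ℂ → ℝ, Continuous D → HasCompactSupport D → tsupport D ⊆ Ω → (∀ z, 0 ≤ D z) →
      (∀ z ∈ Ω, SubM (fun z => U z + D z) z) → ∫ z, D z * ω z ≤ C') {S : Set ℂ} (hS : IsCompact S) (hSΩ : S ⊆ Ω) :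
    ∃ M, ∀ w, Adm U Ω w → ∀ z ∈ S, w z ≤ M := by
  rcases S.eq_empty_or_nonempty with rfl | hSne
  · exact ⟨0, fun _ _ z hz => hz.elim⟩
  obtain ⟨δ, hδ, hδS⟩ := hS.exists_cthickening_subset_open hΩ hSΩ
  have hK : IsCompact (cthickening δ S) := hS.cthickening
  have hin : ∀ z ∈ S, ∀ x : ℂ, ‖x‖ ≤ δ → z + x ∈ cthickening δ S := fun z hz x hx => closedBall_subset_cthickening hz δ (by simpa using hx)
  obtain ⟨m, hmS, hm⟩ := hK.exists_isMinOn (hSne.mono (self_subset_cthickening S)) hω.continuousOn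
  obtain ⟨b, hbS, hb⟩ := hK.exists_isMaxOn (hSne.mono (self_subset_cthickening S)) hU.continuousOn
  have hφ : Continuous fun x : ℂ => max 0 (δ - ‖x‖) := by fun_prop
  have hcs : HasCompactSupport fun x : ℂ => max 0 (δ - ‖x‖) :=
    HasCompactSupport.intro (isCompact_closedBall 0 δ) fun x hx => max_eq_left (by simp at hx; linarith)
  have hφi := hφ.integrable_of_hasCompactSupport hcs (μ := volume)
  obtain ⟨Φ, hΦ⟩ : ∃ Φ, Φ = ∫ x : ℂ, max 0 (δ - ‖x‖) := ⟨_, rfl⟩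
  have hΦ0 : 0 < Φ := by
    rw [hΦ]
    exact hφ.integral_pos_of_hasCompactSupport_nonneg_nonzero hcs (fun x => le_max_left _ _) (x := 0) (by simp [hδ.le, hδ.ne'])
  refine ⟨U b + δ / ω m * C' / Φ, fun w hw z hz => ?_⟩
  obtain ⟨h1, h2, ⟨K, hKΩ, hKc, hKe⟩, h4⟩ := hw
  have hDc : Continuous fun z => w z - U z := h1.sub hU
  have hDK : HasCompactSupport fun z => w z - U z := HasCompactSupport.intro hKc fun z hz => by rw [hKe z hz, sub_self]
  have hts : tsupport (fun z => w z - U z) ⊆ Ω := (closure_minimal (fun z hz => by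
    by_contra h
    exact hz (by simp [hKe z h])) hKc.isClosed).trans hKΩ
  have hCD := hC _ hDc hDK hts (fun z => sub_nonneg.2 (h2 z)) fun z hz => by simpa using h4 z hz
  have ha := area h1 (z := z) (δ := δ) fun ζ hζ => h4 ζ (hδS (closedBall_subset_cthickening hz δ (ball_subset_closedBall hζ)))
  rw [← hΦ] at ha
  have hi : Integrable fun x => (w (z + x) - U (z + x)) * ω (z + x) :=
    ((hDc.mul hω).integrable_of_hasCompactSupport hDK.mul_right).comp_add_left z
  have hb2 : ∫ x : ℂ, w (z + x) * max 0 (δ - ‖x‖) ≤ ∫ x : ℂ, (U b * max 0 (δ - ‖x‖) + δ / ω m * ((w (z + x) - U (z + x)) * ω (z + x))) := by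
    refine integral_mono ?_ ((hφi.const_mul _).add (hi.const_mul _)) fun x => ?_
    · exact ((h1.comp (continuous_const.add continuous_id)).mul hφ).integrable_of_hasCompactSupport hcs.mul_left
    · simp only
      have d0 := sub_nonneg.2 (h2 (z + x))
      rcases lt_or_ge δ ‖x‖ with hx | hx
      · rw [max_eq_left (by linarith), mul_zero, mul_zero, zero_add]
        have := hω0 (z + x)
        have := hω0 m
        positivity
      · have k1 : U (z + x) ≤ U b := hb (hin z hz x hx)
        have k2 : ω m ≤ ω (z + x) := hm (hin z hz x hx)
        have k3 : max 0 (δ - ‖x‖) ≤ δ := max_le hδ.le (by linarith [norm_nonneg x])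
        have k4 : 0 ≤ max 0 (δ - ‖x‖) := le_max_left _ _
        have k5 : (w (z + x) - U (z + x)) * max 0 (δ - ‖x‖) ≤ δ / ω m * ((w (z + x) - U (z + x)) * ω (z + x)) := by
          calc _ ≤ (w (z + x) - U (z + x)) * δ := by gcongr
            _ = δ / ω m * ((w (z + x) - U (z + x)) * ω m) := by field_simp [(hω0 m).ne']
            _ ≤ _ := by have := hω0 m; gcongr
        nlinarith [mul_le_mul_of_nonneg_right k1 k4]
  rw [integral_add (hφi.const_mul _) (hi.const_mul _), integral_const_mul, integral_const_mul, ← hΦ,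
    integral_add_left_eq_self (fun x => (w x - U x) * ω x) z] at hb2
  have hq : δ / ω m * ∫ x, (w x - U x) * ω x ≤ δ / ω m * C' := mul_le_mul_of_nonneg_left hCD (div_nonneg hδ.le (hω0 m).le)
  rw [← sub_le_iff_le_add', le_div_iff₀ hΦ0]
  nlinarith

theorem exists_harm {U : ℂ → ℝ} {Ω : Set ℂ} (hΩ : IsOpen Ω) (hne : Ω.Nonempty) (hU : Continuous U) (hU0 : ∀ z, 0 ≤ U z) (hUs : ∀ z ∈ Ω, SubM U z)
    {ω : ℂ → ℝ} (hω : Continuous ω) (hω0 : ∀ z, 0 < ω z) {C' : ℝ}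
    (hC : ∀ D : ℂ → ℝ, Continuous D → HasCompactSupport D → tsupport D ⊆ Ω → (∀ z, 0 ≤ D z) →
      (∀ z ∈ Ω, SubM (fun z => U z + D z) z) → ∫ z, D z * ω z ≤ C') :
    ∃ h : ℂ → ℝ, InnerProductSpace.HarmonicOnNhd h Ω ∧ ∀ z ∈ Ω, U z ≤ h z := by
  have hr : ∀ x : ℂ, ∃ r : ℝ, 0 < r ∧ (x ∈ Ω → closedBall x r ⊆ Ω) := fun x => by
    by_cases hx : x ∈ Ω
    · obtain ⟨r, h1, h2⟩ := (ball_ev hΩ hx).exists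
      exact ⟨r, h1, fun _ => h2⟩
    · exact ⟨1, one_pos, fun h => (hx h).elim⟩
  choose r hr0 hrΩ using hr
  obtain ⟨t, htΩ, htc, htU⟩ := TopologicalSpace.countable_cover_nhdsWithin (f := fun x => ball x (r x)) (s := Ω) fun x _ => mem_nhdsWithin_of_mem_nhds (ball_mem_nhds x (hr0 x))
  have htne : t.Nonempty := by
    obtain ⟨x, hx⟩ := hne
    obtain ⟨y, hy, _⟩ := mem_iUnion₂.1 (htU hx)
    exact ⟨y, hy⟩
  obtain ⟨c, rfl⟩ := htc.exists_eq_range htne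
  have hcΩ : ∀ k, closedBall (c k) (r (c k)) ⊆ Ω := fun k => hrΩ _ (htΩ (mem_range_self k))
  let w : ℕ → ℂ → ℝ := fun n => Nat.rec U (fun n v => PM v (c n.unpair.1) (r (c n.unpair.1))) n
  have hwS : ∀ n, w (n + 1) = PM (w n) (c n.unpair.1) (r (c n.unpair.1)) := fun n => rfl
  have hI : ∀ n, Adm U Ω (w n) := fun n => by
    induction n with
    | zero => exact ⟨hU, fun _ => le_rfl, ⟨∅, empty_subset _, isCompact_empty, fun _ _ => rfl⟩, hUs⟩
    | succ n ih => exact (ih.step (hr0 _) (hcΩ _)).1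
  have hmono : ∀ z, Monotone fun n => w n z := fun z => monotone_nat_of_le_succ fun n => ((hI n).step (hr0 _) (hcΩ _)).2 z
  have hbdd : ∀ z ∈ Ω, BddAbove (range fun n => w n z) := fun z hz => by
    obtain ⟨M, hM⟩ := Adm.bdd hΩ hU hω hω0 hC (isCompact_singleton (x := z)) (by simpa using hz)
    exact ⟨M, by rintro _ ⟨n, rfl⟩; exact hM _ (hI n) z rfl⟩
  obtain ⟨h, hh⟩ : ∃ h : ℂ → ℝ, h = fun z => ⨆ n, w n z := ⟨_, rfl⟩
  have hlim : ∀ z ∈ Ω, Tendsto (fun n => w n z) atTop (𝓝 (h z)) := fun z hz => by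
    rw [hh]; exact tendsto_atTop_ciSup (hmono z) (hbdd z hz)
  have hle : ∀ z ∈ Ω, ∀ n, w n z ≤ h z := fun z hz n => (hmono z).ge_of_tendsto (hlim z hz) n
  have hhm : Measurable h := by rw [hh]; exact Measurable.iSup fun n => (hI n).1.measurable
  refine ⟨h, fun z hz => ?_, fun z hz => hle z hz 0⟩
  obtain ⟨_, ⟨k, rfl⟩, hzk⟩ := mem_iUnion₂.1 (htU hz)
  have hR := hr0 (c k)
  have hsΩ : ∀ θ, circleMap (c k) (r (c k)) θ ∈ Ω := fun θ => hcΩ k (circleMap_mem_closedBall _ hR.le θ)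
  obtain ⟨M, hM⟩ := Adm.bdd hΩ hU hω hω0 hC (isCompact_closedBall (c k) (r (c k))) (hcΩ k)
  have hM : ∀ n θ, w n (circleMap (c k) (r (c k)) θ) ≤ M := fun n θ => hM _ (hI n) _ (circleMap_mem_closedBall _ hR.le θ)
  have hw0 : ∀ n z, 0 ≤ w n z := fun n z => (hU0 z).trans ((hI n).2.1 z)
  have hci : CircleIntegrable h (c k) (r (c k)) := by
    refine (intervalIntegrable_const (c := M)).mono_fun (hhm.comp (continuous_circleMap _ _).measurable).aestronglyMeasurable (Eventually.of_forall fun θ => ?_)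
    have a1 := le_of_tendsto' (hlim _ (hsΩ θ)) fun n => hM n θ
    have a2 := (hw0 0 _).trans (hle _ (hsΩ θ) 0)
    simp only
    rw [Real.norm_of_nonneg a2, Real.norm_of_nonneg (a2.trans a1)]
    exact a1
  have hPI : ∀ x ∈ ball (c k) (r (c k)), PI h (c k) (r (c k)) x = h x := fun x hx => by
    have hxΩ := hcΩ k (ball_subset_closedBall hx)
    have hpc : Continuous fun θ => poissonKernel (c k) x (circleMap (c k) (r (c k)) θ) :=
      (pk_cont _ hx).comp_continuous (continuous_circleMap _ _) fun θ => circleMap_mem_sphere _ hR.le θ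
    have ht : Tendsto (fun n => PI (w n) (c k) (r (c k)) x) atTop (𝓝 (PI h (c k) (r (c k)) x)) := by
      simp only [PI, circleAverage_def]
      refine Tendsto.const_smul (intervalIntegral.tendsto_integral_filter_of_dominated_convergence
        (fun θ => poissonKernel (c k) x (circleMap (c k) (r (c k)) θ) * M) (Eventually.of_forall fun n => ?_) (Eventually.of_forall fun n => Eventually.of_forall fun θ _ => ?_)
        ((hpc.mul continuous_const).intervalIntegrable _ _) (Eventually.of_forall fun θ _ => (hlim _ (hsΩ θ)).const_mul _)) _
      · exact (hpc.mul ((hI n).1.comp (continuous_circleMap _ _))).aestronglyMeasurable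
      · have := pk_nonneg _ hx (circleMap_mem_sphere (c k) hR.le θ)
        refine (Real.norm_of_nonneg (mul_nonneg this (hw0 n _))).le.trans ?_
        exact mul_le_mul_of_nonneg_left (hM n θ) this
    refine le_antisymm (le_of_tendsto' ht fun n => ?_) (le_of_tendsto_of_tendsto' (hlim x hxΩ) ht fun n => ?_)
    · have e : w (Nat.pair k n + 1) x = PI (w (Nat.pair k n)) (c k) (r (c k)) x := by
        rw [hwS, Nat.unpair_pair, PM_in hx]
      refine (PI_mono (hI n).1 (hI _).1 _ hR hx fun ζ _ => hmono ζ (Nat.right_le_pair k n)).trans ?_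
      rw [← e]
      exact hle x hxΩ (Nat.pair k n + 1)
    · rw [← PM_in hx]
      exact le_PM (hI n).1 _ hR (fun y hy => (hI n).2.2.2 y (hcΩ k (ball_subset_closedBall hy))) x
  refine (InnerProductSpace.harmonicAt_congr_nhds ?_).1 (PI_harm hci z hzk)
  filter_upwards [isOpen_ball.mem_nhds hzk] with x hx using hPI x hx

theorem stmt2 (E : Set ℝ) (hEne : E.Nonempty) (hEcl : IsClosed E)
    (u : ℂ → ℝ) (hu_cont : Continuous u)
    (hu_zero : ∀ x ∈ E, u (x : ℂ) = 0)
    (hu_pos : ∀ z ∈ (cplx E)ᶜ, 0 < u z)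
    (hu_harm : HarmonicOn u (cplx E)ᶜ)
    (hu_symm : ∀ z : ℂ, u (starRingEnd ℂ z) = u z)
    (hu_growth : ∃ A : ℝ, ∀ z : ℂ, u z ≤ A * (1 + ‖z‖))
    (hu_AL : 0 < Filter.limsup (fun y : ℝ => u ((y : ℂ) * Complex.I) / y) Filter.atTop)
    (f : ℂ → ℂ) (hf : Differentiable ℂ f)
    (hf_growth : ∃ A B : ℝ, ∀ z : ℂ, Real.log ‖f z‖ ≤ A * ‖z‖ + B)
    (hf_int : Integrable (fun x : ℝ => logPlus ‖f (x : ℂ)‖ / (1 + x ^ 2))) :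
    BoundedTypeOn f (cplx E)ᶜ := by
  obtain ⟨A, hA⟩ := hu_growth
  have hΩ : IsOpen (cplx E)ᶜ := (cplx_closed hEcl).isOpen_compl
  have hh := (harm_iff hΩ).1 hu_harm
  obtain ⟨Θ, hu⟩ := GWu hEcl hu_cont hu_zero hu_pos hh hu_symm hA
  obtain ⟨V, Θ', A', hV, hfV⟩ := exists_V hf hf_growth hf_int
  obtain ⟨Ψ, ε, C, hε, hC0, hΨc, hΨ0, hΨs, hΨε, hΨb⟩ := exists_test hu hEcl hh hu_AL
  have hW := hu.add hV
  obtain ⟨C', hC'⟩ := pairing hW hΩ hε hC0 hΨc hΨ0 hΨs hΨε fun z hz => (hΨb z hz).trans (by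
    have := hV.nonneg (z.re + 1 * I)
    gcongr
    linarith)
  have hfp : ∀ z, 0 < ‖fold z + I‖ := fun z => norm_pos_iff.2 fun h1 => by
    have := congrArg Complex.im h1
    simp [fold_im] at this
    linarith [abs_nonneg z.im]
  obtain ⟨h, h1, h2⟩ := exists_harm hΩ ⟨I, by rintro ⟨x, _, hx⟩; simpa using congrArg Complex.im hx⟩ (UU_cont hW) (fun z => hW.nonneg _)
    (fun z _ => by
      filter_upwards [self_mem_nhdsWithin] with r hr using J_nonneg hW hr z)
    (ω := fun z => 1 / ‖fold z + I‖ ^ 4) (continuous_const.div (((fold_cont.add continuous_const).norm).pow 4) fun z => (pow_pos (hfp z) 4).ne')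
    (fun z => by have := hfp z; positivity) hC'
  have h3 : ∀ z ∈ (cplx E)ᶜ, logPlus ‖f z‖ ≤ h z := fun z hz => by
    have k := UU_ge hW z (a := 0) (by simp)
    simp only [Complex.ofReal_zero, zero_mul, add_zero] at k
    linarith [h2 z hz, hfV z, hu.nonneg z]
  refine ⟨fun z => h z + 1, (harm_iff hΩ).2 fun z hz => (h1 z hz).add ⟨contDiffAt_const, by simp⟩, fun z hz => ?_, fun z hz => by linarith [h3 z hz]⟩
  have : 0 ≤ logPlus ‖f z‖ := le_max_right _ _
  show 0 < h z + 1
  linarith [h3 z hz]
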